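/- Let γ ∈ SL₂(ℤ) be hyperbolic, i.e. γ has no eigenvalue of absolute value 1 (equivalently |trace γ| > 2), and let T_γ be the induced automorphism of the 2-torus ℝ²/ℤ² (the map induced on the quotient by the linear action of γ on ℝ²). Let μ be a Borel probability measure on ℝ²/ℤ² which is T_γ-invariant and ergodic and exact dimensional of some dimension κ > 0. Then for μ-almost every point of the torus, any lift v ∈ ℝ² is well approximable: for every ε > 0 there exist m ∈ ℤ² and a positive integer k with ‖k·v − m‖_∞ < ε/k^{1/2}. -/

import Mathlib

open MeasureTheory Filter

/-- A vector `v ∈ ℝ^d` is well approximable: for every `ε > 0` there are `m ∈ ℤ^d` and a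
positive integer `k` with `‖k·v − m‖_∞ < ε/k^(1/d)`. -/
def IsWAVec (d : ℕ) (v : Fin d → ℝ) : Prop :=
  ∀ ε : ℝ, 0 < ε → ∃ (m : Fin d → ℤ) (k : ℕ), 0 < k ∧
    ∀ i, |(k : ℝ) * v i - (m i : ℝ)| < ε / (k : ℝ) ^ ((1 : ℝ) / d)

/-- A measure `μ` is exact dimensional of dimension `κ`: for `μ`-a.e. `x`,
`log μ(B(x,r))/log r → κ` as `r → 0⁺`. -/
def ExactDimensional {X : Type*} [MetricSpace X] [MeasurableSpace X]
    (μ : Measure X) (κ : ℝ) : Prop :=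
  ∀ᵐ x ∂μ, Tendsto (fun r : ℝ => Real.log (μ (Metric.ball x r)).toReal / Real.log r)
    (nhdsWithin 0 (Set.Ioi 0)) (nhds κ)

/-- The automorphism of the `2`-torus (identified with `[0,1)²`) induced by `γ ∈ SL₂(ℤ)`. -/
noncomputable def torusAuto (γ : Matrix.SpecialLinearGroup (Fin 2) ℤ)
    (v : Fin 2 → ℝ) : Fin 2 → ℝ :=
  fun i => Int.fract (∑ j, ((γ : Matrix (Fin 2) (Fin 2) ℤ) i j : ℝ) * v j)

open scoped Topology ENNReal RealInnerProductSpace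

/-- Average of `f` along the first `n` points of the forward orbit of `x` under `h`. -/
noncomputable def orbAvg {G X : Type*} [Group G] [MulAction G X] (h : G) (f : X → ℝ) (n : ℕ)
    (x : X) : ℝ := (∑ k ∈ Finset.range n, f (h ^ k • x)) / n

section MeanErgodic

variable {G X : Type*} [Group G] [MulAction G X]

lemma tendsto_zero_of_summable_lintegral {X : Type*} [MeasurableSpace X] {ν : Measure X}
    {F : ℕ → X → ℝ} {φ : X → ℝ} (hF : ∀ m, AEStronglyMeasurable (F m) ν)
    (hφ : AEStronglyMeasurable φ ν)
    (h : ∑' m, ∫⁻ x, ‖F m x - φ x‖ₑ ∂ν ≠ ⊤) :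
    ∀ᵐ x ∂ν, Tendsto (fun m => F m x) atTop (𝓝 (φ x)) := by
  have hsum : ∫⁻ x, ∑' m, ‖F m x - φ x‖ₑ ∂ν = ∑' m, ∫⁻ x, ‖F m x - φ x‖ₑ ∂ν :=
    lintegral_tsum (fun m => ((hF m).sub hφ).enorm)
  rw [← hsum] at h
  have h2 := ae_lt_top' (AEMeasurable.tsum fun m => ((hF m).sub hφ).enorm) h
  filter_upwards [h2] with x hx
  have h3 := ENNReal.tendsto_atTop_zero_of_tsum_ne_top hx.ne
  rw [tendsto_iff_edist_tendsto_0]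
  simpa [edist_eq_enorm_sub] using h3

lemma coe_orthogonalProjection_congr {E : Type*} [NormedAddCommGroup E] [InnerProductSpace ℝ E]
    {K K' : Submodule ℝ E} [K.HasOrthogonalProjection] [K'.HasOrthogonalProjection]
    (h : K = K') (v : E) :
    (K.orthogonalProjectionOnto v : E) = K'.orthogonalProjectionOnto v := by
  subst h; rfl

variable [MeasurableSpace X] {ν : Measure X}

/-- The Koopman isometry of a measure preserving element. -/
noncomputable def koopman (h : G) (hp : MeasurePreserving (fun x : X => h • x) ν ν) :
    Lp ℝ 2 ν →L[ℝ] Lp ℝ 2 ν :=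
  (Lp.compMeasurePreservingₗᵢ ℝ (fun x : X => h • x) hp).toContinuousLinearMap

lemma koopman_coeFn (h : G) (hp : MeasurePreserving (fun x : X => h • x) ν ν) (F : Lp ℝ 2 ν) :
    koopman h hp F =ᵐ[ν] fun x => F (h • x) :=
  Lp.coeFn_compMeasurePreserving F hp

lemma koopman_norm_le (h : G) (hp : MeasurePreserving (fun x : X => h • x) ν ν) :
    ‖koopman h hp‖ ≤ 1 := by
  refine ContinuousLinearMap.opNorm_le_bound _ zero_le_one fun F => ?_
  rw [one_mul]
  exact ((Lp.compMeasurePreservingₗᵢ ℝ (fun x : X => h • x) hp).norm_map F).le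

lemma koopman_iterate (h : G) (hp : MeasurePreserving (fun x : X => h • x) ν ν)
    {f : X → ℝ} {F : Lp ℝ 2 ν} (hF : F =ᵐ[ν] f) (k : ℕ) :
    ((koopman h hp)^[k] F : Lp ℝ 2 ν) =ᵐ[ν] fun x => f (h ^ k • x) := by
  induction k with
  | zero => simpa using hF
  | succ k ih =>
    rw [Function.iterate_succ_apply']
    refine (koopman_coeFn h hp _).trans ?_
    have := hp.quasiMeasurePreserving.ae_eq_comp ih
    filter_upwards [this] with x hx
    simpa [Function.comp_def, pow_succ, mul_smul] using hx

lemma koopman_average (h : G) (hp : MeasurePreserving (fun x : X => h • x) ν ν)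
    {f : X → ℝ} {F : Lp ℝ 2 ν} (hF : F =ᵐ[ν] f) (n : ℕ) :
    (birkhoffAverage ℝ (koopman h hp) id n F : Lp ℝ 2 ν) =ᵐ[ν] orbAvg h f n := by
  have h2 : ∀ᵐ x ∂ν, ∀ k, ((koopman h hp)^[k] F : Lp ℝ 2 ν) x = f (h ^ k • x) :=
    ae_all_iff.2 fun k => koopman_iterate h hp hF k
  have hs : (birkhoffSum (koopman h hp) id n F : Lp ℝ 2 ν)
      =ᵐ[ν] fun x => ∑ k ∈ Finset.range n, f (h ^ k • x) := by
    simp only [birkhoffSum, id]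
    have := Lp.coeFn_finsetSum (Finset.range n) (fun k => (koopman h hp)^[k] F)
    filter_upwards [this, h2] with x hx hx2
    rw [hx]; simp [hx2]
  rw [birkhoffAverage]
  filter_upwards [Lp.coeFn_smul (n : ℝ)⁻¹ (birkhoffSum (koopman h hp) id n F : Lp ℝ 2 ν), hs]
    with x hx hx2
  rw [hx, Pi.smul_apply, hx2, orbAvg, smul_eq_mul, div_eq_inv_mul]

lemma koopman_symm (h : G) (hp : MeasurePreserving (fun x : X => h • x) ν ν)
    (hp' : MeasurePreserving (fun x : X => h⁻¹ • x) ν ν) (F : Lp ℝ 2 ν)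
    (hF : koopman h hp F = F) : koopman h⁻¹ hp' F = F := by
  conv_lhs => rw [← hF]
  refine Lp.ext ((koopman_coeFn _ hp' _).trans ?_)
  have := hp'.quasiMeasurePreserving.ae_eq_comp (koopman_coeFn h hp F)
  filter_upwards [this] with x hx
  simpa [Function.comp_def] using hx

/-- Mean ergodic theorem, in the form of almost everywhere convergence of forward and backward
averages to a common limit along a common sequence of times. -/
theorem exists_seq_ae_tendsto_orbAvg [IsProbabilityMeasure ν] (h : G)
    (hp : MeasurePreserving (fun x : X => h • x) ν ν)
    (hp' : MeasurePreserving (fun x : X => h⁻¹ • x) ν ν)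
    (f : ℕ → X → ℝ) (hf : ∀ i, Measurable (f i)) (hb : ∀ i, ∃ C, ∀ x, |f i x| ≤ C) :
    ∃ N : ℕ → ℕ, Tendsto N atTop atTop ∧ ∀ᵐ x ∂ν, ∀ i, ∃ l,
      Tendsto (fun j => orbAvg h (f i) (N j) x) atTop (𝓝 l) ∧
      Tendsto (fun j => orbAvg h⁻¹ (f i) (N j) x) atTop (𝓝 l) := by
  have hmem : ∀ i, MemLp (f i) 2 ν := fun i => by
    obtain ⟨C, hC⟩ := hb i
    exact MemLp.of_bound (hf i).aestronglyMeasurable C (Eventually.of_forall hC)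
  set F : ℕ → Lp ℝ 2 ν := fun i => (hmem i).toLp (f i) with hFdef
  have hF : ∀ i, F i =ᵐ[ν] f i := fun i => (hmem i).coeFn_toLp
  have hlim : ∀ i, ∃ φ : Lp ℝ 2 ν,
      Tendsto (fun n => birkhoffAverage ℝ (koopman h hp) id n (F i)) atTop (𝓝 φ) ∧
      Tendsto (fun n => birkhoffAverage ℝ (koopman h⁻¹ hp') id n (F i)) atTop (𝓝 φ) := by
    intro i
    refine ⟨_, ContinuousLinearMap.tendsto_birkhoffAverage_orthogonalProjection
      (koopman h hp) (koopman_norm_le h hp) (F i), ?_⟩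
    have h2 := ContinuousLinearMap.tendsto_birkhoffAverage_orthogonalProjection
      (koopman h⁻¹ hp') (koopman_norm_le h⁻¹ hp') (F i)
    convert h2 using 2
    · refine coe_orthogonalProjection_congr ?_ _
      ext y
      simp only [LinearMap.mem_eqLocus, ContinuousLinearMap.coe_coe, one_apply_eq_self]
      refine ⟨fun hy => koopman_symm h hp hp' y hy, fun hy => ?_⟩
      have hp'' : MeasurePreserving (fun x : X => h⁻¹⁻¹ • x) ν ν := by simpa using hp
      have := koopman_symm h⁻¹ hp' hp'' y hy
      convert this using 3
      simp
  choose φ hφ1 hφ2 using hlim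
  have hN : ∀ m : ℕ, ∃ n, m ≤ n ∧ ∀ i ≤ m,
      ‖birkhoffAverage ℝ (koopman h hp) id n (F i) - φ i‖ < (1/2 : ℝ) ^ m ∧
      ‖birkhoffAverage ℝ (koopman h⁻¹ hp') id n (F i) - φ i‖ < (1/2 : ℝ) ^ m := by
    intro m
    have hpos : (0:ℝ) < (1/2 : ℝ) ^ m := by positivity
    have : ∀ᶠ n in atTop, m ≤ n ∧ ∀ i ∈ Set.Iic m,
      ‖birkhoffAverage ℝ (koopman h hp) id n (F i) - φ i‖ < (1/2 : ℝ) ^ m ∧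
      ‖birkhoffAverage ℝ (koopman h⁻¹ hp') id n (F i) - φ i‖ < (1/2 : ℝ) ^ m := by
      refine (eventually_ge_atTop m).and ((eventually_all_finite (Set.finite_Iic m)).2 ?_)
      intro i _
      have e1 := (Metric.tendsto_nhds.1 (hφ1 i)) _ hpos
      have e2 := (Metric.tendsto_nhds.1 (hφ2 i)) _ hpos
      simp only [dist_eq_norm] at e1 e2
      exact e1.and e2
    exact this.exists
  choose N hNm hN using hN
  refine ⟨N, tendsto_atTop_mono hNm tendsto_id, ae_all_iff.2 fun i => ?_⟩
  have key : ∀ (g : G) (hg : MeasurePreserving (fun x : X => g • x) ν ν),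
      (∀ m, i ≤ m → ‖birkhoffAverage ℝ (koopman g hg) id (N m) (F i) - φ i‖ < (1/2 : ℝ) ^ m) →
      ∀ᵐ x ∂ν, Tendsto (fun j => orbAvg g (f i) (N j) x) atTop (𝓝 (φ i x)) := by
    intro g hg hle
    have hae : ∀ᵐ x ∂ν, ∀ m,
        (birkhoffAverage ℝ (koopman g hg) id (N m) (F i) : Lp ℝ 2 ν) x
          = orbAvg g (f i) (N m) x :=
      ae_all_iff.2 fun m => koopman_average g hg (hF i) (N m)
    have hB : ∀ m, ∫⁻ x, ‖(birkhoffAverage ℝ (koopman g hg) id (N (m + i)) (F i) : Lp ℝ 2 ν) x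
        - φ i x‖ₑ ∂ν ≤ ENNReal.ofReal ((1/2 : ℝ) ^ m) := by
      intro m
      set A : Lp ℝ 2 ν := birkhoffAverage ℝ (koopman g hg) id (N (m + i)) (F i)
      have h1 : ∫⁻ x, ‖A x - φ i x‖ₑ ∂ν = eLpNorm (A - φ i : Lp ℝ 2 ν) 1 ν := by
        rw [eLpNorm_one_eq_lintegral_enorm]
        refine lintegral_congr_ae ?_
        filter_upwards [Lp.coeFn_sub A (φ i)] with x hx
        rw [hx]; rfl
      rw [h1]
      refine (eLpNorm_le_eLpNorm_of_exponent_le (by norm_num : (1:ℝ≥0∞) ≤ 2)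
        (Lp.aestronglyMeasurable _)).trans ?_
      rw [← Lp.enorm_def, ← ofReal_norm]
      refine ENNReal.ofReal_le_ofReal ((hle (m + i) (by omega)).le.trans ?_)
      exact pow_le_pow_of_le_one (by norm_num) (by norm_num) (by omega)
    have hsum : ∑' m, ∫⁻ x, ‖(birkhoffAverage ℝ (koopman g hg) id (N (m + i)) (F i) : Lp ℝ 2 ν) x
        - φ i x‖ₑ ∂ν ≠ ⊤ := by
      refine ne_top_of_le_ne_top ?_ (ENNReal.tsum_le_tsum hB)
      rw [← ENNReal.ofReal_tsum_of_nonneg (fun m => by positivity)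
        (summable_geometric_of_lt_one (by norm_num) (by norm_num))]
      exact ENNReal.ofReal_ne_top
    have := tendsto_zero_of_summable_lintegral (ν := ν)
      (fun m => Lp.aestronglyMeasurable
        (birkhoffAverage ℝ (koopman g hg) id (N (m + i)) (F i) : Lp ℝ 2 ν))
      (Lp.aestronglyMeasurable (φ i)) hsum
    filter_upwards [this, hae] with x hx hx2
    rw [← tendsto_add_atTop_iff_nat i]
    simpa only [hx2] using hx
  filter_upwards [key h hp fun m hm => (hN m i hm).1, key h⁻¹ hp' fun m hm => (hN m i hm).2]
    with x h1 h2
  exact ⟨_, h1, h2⟩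

end MeanErgodic

/-- The part of `V` along `U`-orbits has two (possibly equal) points at distance in `[s₀, 1]`. -/
def HasPair {G X : Type*} [Group G] [MulAction G X] (U : ℝ → G) (s₀ : ℝ) (V : Set X) : Prop :=
  ∃ x ∈ V, ∃ s ∈ Set.Icc s₀ 1, U s • x ∈ V

/-- Sets of measure bounded below contain two points on one `U`-orbit, at distance bounded
below. -/
def PairProp {G X : Type*} [Group G] [MulAction G X] [MeasurableSpace X] (U : ℝ → G)
    (μ : Measure X) : Prop :=
  ∀ η : ℝ, 0 < η → ∃ s₀ : ℝ, 0 < s₀ ∧ s₀ < 1 ∧ ∀ V : Set X, MeasurableSet V → η ≤ μ.real V →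
    HasPair U s₀ V

section ConvexCombinations

/-- In a Hilbert space, a bounded sequence has convex combinations of its tails that converge. -/
lemma exists_convexHull_tail_tendsto {E : Type*} [NormedAddCommGroup E] [InnerProductSpace ℝ E]
    [CompleteSpace E] (v : ℕ → E) {C : ℝ} (hv : ∀ j, ‖v j‖ ≤ C) :
    ∃ (y : ℕ → E) (f : E), (∀ i, y i ∈ convexHull ℝ (v '' Set.Ici i)) ∧
      Tendsto y atTop (𝓝 f) := by
  set K : ℕ → Set E := fun i => closure (convexHull ℝ (v '' Set.Ici i)) with hK
  have hconv : ∀ i, Convex ℝ (K i) := fun i => (convex_convexHull ℝ _).closure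
  have hanti : ∀ i j, i ≤ j → K j ⊆ K i := fun i j hij =>
    closure_mono (convexHull_mono (Set.image_mono (Set.Ici_subset_Ici.2 hij)))
  have hvK : ∀ i, v i ∈ K i := fun i =>
    subset_closure (subset_convexHull ℝ _ ⟨i, Set.self_mem_Ici, rfl⟩)
  have hmin : ∀ i, ∃ x ∈ K i, ∀ w ∈ K i, ‖x‖ ≤ ‖w‖ := by
    intro i
    obtain ⟨x, hx, hx2⟩ := exists_norm_eq_iInf_of_complete_convex ⟨_, hvK i⟩
      isClosed_closure.isComplete (hconv i) 0
    refine ⟨x, hx, fun w hw => ?_⟩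
    have : ⨅ w : K i, ‖(0:E) - w‖ ≤ ‖(0:E) - w‖ :=
      ciInf_le ⟨0, by rintro _ ⟨w, rfl⟩; positivity⟩ (⟨w, hw⟩ : K i)
    rw [← hx2] at this
    simpa using this
  choose x hxK hxmin using hmin
  have hmono : Monotone fun i => ‖x i‖ ^ 2 := fun i j hij =>
    pow_le_pow_left₀ (norm_nonneg _) (hxmin i _ (hanti i j hij (hxK j))) 2
  have hbdd : BddAbove (Set.range fun i => ‖x i‖ ^ 2) := by
    refine ⟨C ^ 2, ?_⟩
    rintro _ ⟨i, rfl⟩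
    exact pow_le_pow_left₀ (norm_nonneg _) ((hxmin i _ (hvK i)).trans (hv i)) 2
  have hlim := tendsto_atTop_ciSup hmono hbdd
  set ℓ := ⨆ i, ‖x i‖ ^ 2
  have hle : ∀ i, ‖x i‖ ^ 2 ≤ ℓ := fun i => le_ciSup hbdd i
  have hdist : ∀ i j, i ≤ j → ‖x i - x j‖ ^ 2 ≤ 2 * (ℓ - ‖x i‖ ^ 2) := by
    intro i j hij
    have hmid : (1/2 : ℝ) • x i + (1/2 : ℝ) • x j ∈ K i :=
      hconv i (hxK i) (hanti i j hij (hxK j)) (by norm_num) (by norm_num) (by norm_num)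
    have h1 := hxmin i _ hmid
    rw [← smul_add, norm_smul] at h1
    have hpar := parallelogram_law_with_norm ℝ (x i) (x j)
    have h2 : (2 * ‖x i‖) ^ 2 ≤ ‖x i + x j‖ ^ 2 := by
      refine pow_le_pow_left₀ (by positivity) ?_ 2
      norm_num at h1; linarith
    nlinarith [hle j]
  have hcauchy : CauchySeq x := by
    refine cauchySeq_of_le_tendsto_0' (fun i => Real.sqrt (2 * (ℓ - ‖x i‖ ^ 2))) ?_ ?_
    · intro i j hij
      rw [dist_eq_norm]
      exact Real.le_sqrt_of_sq_le (hdist i j hij)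
    · have := ((tendsto_const_nhds (x := ℓ)).sub hlim).const_mul 2
      simpa using this.sqrt
  obtain ⟨f, hf⟩ := cauchySeq_tendsto_of_complete hcauchy
  have hy : ∀ i : ℕ, ∃ y ∈ convexHull ℝ (v '' Set.Ici i), dist (x i) y < (1/2 : ℝ) ^ i :=
    fun i => Metric.mem_closure_iff.1 (hxK i) _ (by positivity)
  choose y hy1 hy2 using hy
  refine ⟨y, f, hy1, ?_⟩
  refine tendsto_of_tendsto_of_dist hf (squeeze_zero (fun _ => dist_nonneg)
    (fun i => (hy2 i).le) (tendsto_pow_atTop_nhds_zero_of_lt_one (by norm_num) (by norm_num)))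

variable {X : Type*} [MeasurableSpace X] {μ : Measure X} [IsProbabilityMeasure μ]

/-- Sets `V j` of measure at least `η`: on a set of positive measure suitable convex combinations
of the indicators of the tails exceed `η / 2`. -/
lemma exists_measurableSet_convexComb (V : ℕ → Set X) (hV : ∀ j, MeasurableSet (V j)) {η : ℝ}
    (hη : 0 < η) (hμ : ∀ j, η ≤ μ.real (V j)) :
    ∃ (D : Set X) (F : ℕ → X → ℝ), MeasurableSet D ∧ μ D ≠ 0 ∧
      (∀ i, F i ∈ convexHull ℝ ((fun j => (V j).indicator fun _ => (1:ℝ)) '' Set.Ici i)) ∧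
      ∀ x ∈ D, ∀ᶠ i in atTop, η / 2 < F i x := by
  set w : ℕ → X → ℝ := fun j => (V j).indicator fun _ => (1:ℝ) with hw
  set v : ℕ → Lp ℝ 2 μ := fun j => indicatorConstLp 2 (hV j) (measure_ne_top μ _) (1:ℝ) with hv
  have hvn : ∀ j, ‖v j‖ ≤ 1 := by
    intro j
    rw [hv, norm_indicatorConstLp (by norm_num) (by norm_num)]
    simp only [norm_one, one_mul]
    exact Real.rpow_le_one measureReal_nonneg measureReal_le_one (by norm_num)
  obtain ⟨y, f, hy, hyf⟩ := exists_convexHull_tail_tendsto v hvn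
  set one : Lp ℝ 2 μ := indicatorConstLp 2 MeasurableSet.univ (measure_ne_top μ _) (1:ℝ)
  have hint : ∀ g : Lp ℝ 2 μ, ⟪one, g⟫ = ∫ x, g x ∂μ := fun g => by
    rw [L2.inner_indicatorConstLp_one, setIntegral_univ]
  have hyη : ∀ i, η ≤ ⟪one, y i⟫ := by
    intro i
    have hc : Convex ℝ {g : Lp ℝ 2 μ | η ≤ ⟪one, g⟫} :=
      convex_halfSpace_ge (f := fun g => ⟪one, g⟫)
        ⟨fun a b => inner_add_right _ _ _, fun c a => inner_smul_right _ _ _⟩ η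
    refine convexHull_min ?_ hc (hy i)
    rintro _ ⟨j, -, rfl⟩
    simp only [Set.mem_ofPred_eq, hint, hv]
    rw [integral_congr_ae indicatorConstLp_coeFn, integral_indicator (hV j)]
    simpa using hμ j
  have hfη : η ≤ ∫ x, f x ∂μ := by
    rw [← hint]
    exact ge_of_tendsto' ((continuous_const.inner continuous_id).continuousAt.tendsto.comp hyf)
      hyη
  have hF : ∀ i, ∃ F ∈ convexHull ℝ (w '' Set.Ici i), Measurable F ∧ y i =ᵐ[μ] F := by
    intro i
    have hc : Convex ℝ {g : Lp ℝ 2 μ | ∃ F ∈ convexHull ℝ (w '' Set.Ici i),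
        Measurable F ∧ g =ᵐ[μ] F} := by
      rintro g₁ ⟨F₁, h₁, m₁, e₁⟩ g₂ ⟨F₂, h₂, m₂, e₂⟩ a b ha hb hab
      refine ⟨a • F₁ + b • F₂, convex_convexHull ℝ _ h₁ h₂ ha hb hab,
        (m₁.const_smul a).add (m₂.const_smul b), ?_⟩
      filter_upwards [Lp.coeFn_add (a • g₁) (b • g₂), Lp.coeFn_smul a g₁, Lp.coeFn_smul b g₂,
        e₁, e₂] with x h1 h2 h3 h4 h5
      rw [h1, Pi.add_apply, h2, h3]
      simp [h4, h5]
    refine convexHull_min ?_ hc (hy i)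
    rintro _ ⟨j, hj, rfl⟩
    exact ⟨w j, subset_convexHull ℝ _ ⟨j, hj, rfl⟩, measurable_const.indicator (hV j),
      indicatorConstLp_coeFn⟩
  choose F hFc hFm hFy using hF
  obtain ⟨ns, hns, hae⟩ := (tendstoInMeasure_of_tendsto_Lp hyf).exists_seq_tendsto_ae
  refine ⟨{x | ∀ᶠ k in atTop, η / 2 < F (ns k) x}, fun k => F (ns k), ?_, ?_, ?_, fun x hx => hx⟩
  · simp only [eventually_atTop, Set.ofPred_exists, Set.ofPred_forall]
    exact MeasurableSet.iUnion fun a => MeasurableSet.iInter fun b => MeasurableSet.iInter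
      fun _ => measurableSet_lt measurable_const (hFm _)
  · intro h0
    have h1 : ∀ᵐ x ∂μ, ¬ ∀ᶠ k in atTop, η / 2 < F (ns k) x := measure_eq_zero_iff_ae_notMem.1 h0
    have h2 : ∀ᵐ x ∂μ, ∀ k, y k x = F k x := ae_all_iff.2 hFy
    have h3 : ∀ᵐ x ∂μ, f x ≤ η / 2 := by
      filter_upwards [h1, h2, hae] with x hx1 hx2 hx3
      by_contra! hlt
      refine hx1 ?_
      filter_upwards [hx3.eventually (lt_mem_nhds hlt)] with k hk
      rwa [← hx2]
    have hfi : Integrable f μ := (Lp.memLp f).integrable (by norm_num)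
    have := integral_mono_ae hfi (integrable_const (η/2)) h3
    simp at this
    linarith
  · intro i
    exact convexHull_mono (Set.image_mono (Set.Ici_subset_Ici.2 (hns.id_le i))) (hFc _)

end ConvexCombinations

/-- Every `U`-segment of length one meets `Y` for at most `L` parameters. -/
def SegBound {G X : Type*} [Group G] [MulAction G X] (U : ℝ → G) (Y : Set X) (L : ℕ) : Prop :=
  ∀ (x : X) (T : Finset ℝ), (∀ s ∈ T, |s| ≤ 1 / 2 ∧ U s • x ∈ Y) → T.card ≤ L

section SegBound

variable {G X : Type*} [Group G] [MulAction G X] {U : ℝ → G}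

lemma sum_convexComb_le_one (hU : ∀ s t, U (s + t) = U s * U t) {V : ℕ → Set X}
    (hV : ∀ j : ℕ, ¬ HasPair U (1 / (j + 2)) (V j)) {i : ℕ} {F : X → ℝ}
    (hF : F ∈ convexHull ℝ ((fun j => (V j).indicator fun _ => (1:ℝ)) '' Set.Ici i))
    (x : X) (T : Finset ℝ) (hT : ∀ s ∈ T, |s| ≤ 1 / 2)
    (hsep : ∀ s ∈ T, ∀ t ∈ T, s < t → 1 / ((i:ℝ) + 2) ≤ t - s) :
    ∑ s ∈ T, F (U s • x) ≤ 1 := by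
  have hc : Convex ℝ {F : X → ℝ | ∑ s ∈ T, F (U s • x) ≤ 1} :=
    convex_halfSpace_le (f := fun F : X → ℝ => ∑ s ∈ T, F (U s • x))
      ⟨fun a b => by simp [Finset.sum_add_distrib], fun c a => by simp [Finset.mul_sum]⟩ 1
  refine convexHull_min ?_ hc hF
  rintro _ ⟨j, hj, rfl⟩
  classical
  have h1 : ∑ s ∈ T, (V j).indicator (fun _ => (1:ℝ)) (U s • x)
      = ((T.filter fun s => U s • x ∈ V j).card : ℝ) := by
    simp [Set.indicator_apply]
  rw [Set.mem_ofPred_eq, h1]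
  have h2 : (T.filter fun s => U s • x ∈ V j).card ≤ 1 := by
    rw [Finset.card_le_one_iff]
    have key : ∀ s t, s ∈ T.filter (fun s => U s • x ∈ V j) →
        t ∈ T.filter (fun s => U s • x ∈ V j) → ¬ s < t := by
      intro s t hs ht hst
      rw [Finset.mem_filter] at hs ht
      refine hV j ⟨U s • x, hs.2, t - s, ⟨?_, ?_⟩, ?_⟩
      · refine le_trans ?_ (hsep s hs.1 t ht.1 hst)
        have : (i:ℝ) ≤ j := by exact_mod_cast (hj : i ≤ j)
        gcongr
      · have := hT s hs.1; have := hT t ht.1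
        rw [abs_le] at *; linarith
      · rw [← mul_smul, ← hU, sub_add_cancel]; exact ht.2
    intro s t hs ht
    exact le_antisymm (not_lt.1 (key t s ht hs)) (not_lt.1 (key s t hs ht))
  exact_mod_cast h2

lemma exists_sep_pos (T : Finset ℝ) : ∃ ε > 0, ∀ s ∈ T, ∀ t ∈ T, s < t → ε ≤ t - s := by
  classical
  induction T using Finset.induction_on with
  | empty => exact ⟨1, one_pos, by simp⟩
  | insert a T _ ih =>
    obtain ⟨ε, hε, h⟩ := ih
    have : ∃ δ > 0, ∀ s ∈ T, s ≠ a → δ ≤ |s - a| := by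
      clear h
      induction T using Finset.induction_on with
      | empty => exact ⟨1, one_pos, by simp⟩
      | insert b T _ ih =>
        obtain ⟨δ, hδ, h⟩ := ih (by simp_all)
        by_cases hb : b = a
        · exact ⟨δ, hδ, by
            intro s hs hsa
            rcases Finset.mem_insert.1 hs with rfl | hs
            · exact absurd hb hsa
            · exact h s hs hsa⟩
        · refine ⟨min δ |b - a|, lt_min hδ (abs_pos.2 (sub_ne_zero.2 hb)), ?_⟩
          intro s hs hsa
          rcases Finset.mem_insert.1 hs with rfl | hs
          · exact min_le_right _ _
          · exact (min_le_left _ _).trans (h s hs hsa)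
    obtain ⟨δ, hδ, h2⟩ := this
    refine ⟨min ε δ, lt_min hε hδ, ?_⟩
    intro s hs t ht hst
    rcases Finset.mem_insert.1 hs with hsa | hs' <;> rcases Finset.mem_insert.1 ht with hta | ht'
    · exact absurd hst (hsa ▸ hta ▸ lt_irrefl _)
    · subst hsa
      have := h2 t ht' hst.ne'
      rw [abs_of_pos (by linarith)] at this
      exact (min_le_right _ _).trans this
    · subst hta
      have := h2 s hs' hst.ne
      rw [abs_of_neg (by linarith)] at this
      refine (min_le_right _ _).trans ?_
      linarith
    · exact (min_le_left _ _).trans (h s hs' t ht' hst)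

lemma segBound_of_convexComb (hU : ∀ s t, U (s + t) = U s * U t) {V : ℕ → Set X}
    (hV : ∀ j : ℕ, ¬ HasPair U (1 / (j + 2)) (V j)) {η : ℝ} (hη : 0 < η) {F : ℕ → X → ℝ}
    (hF : ∀ i, F i ∈ convexHull ℝ ((fun j => (V j).indicator fun _ => (1:ℝ)) '' Set.Ici i))
    {D : Set X} (hD : ∀ x ∈ D, ∀ᶠ i in atTop, η / 2 < F i x) :
    SegBound U D ⌊2 / η⌋₊ := by
  intro x T hT
  rw [Nat.le_floor_iff (by positivity), le_div_iff₀ hη]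
  obtain ⟨ε, hε, hsep⟩ := exists_sep_pos T
  have h1 : ∀ᶠ i : ℕ in atTop, ∀ s ∈ T, η / 2 < F i (U s • x) :=
    (eventually_all_finset T).2 fun s hs => hD _ (hT s hs).2
  have h2 : ∀ᶠ i : ℕ in atTop, 1 / ((i:ℝ) + 2) ≤ ε := by
    have : Tendsto (fun i : ℕ => 1 / ((i:ℝ) + 2)) atTop (𝓝 0) :=
      tendsto_const_nhds.div_atTop
        (tendsto_atTop_add_const_right _ _ tendsto_natCast_atTop_atTop)
    filter_upwards [this.eventually (gt_mem_nhds hε)] with i hi using hi.le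
  obtain ⟨i, hi1, hi2⟩ := (h1.and h2).exists
  have h3 := sum_convexComb_le_one hU hV (hF i) x T (fun s hs => (hT s hs).1)
    fun s hs t ht hst => hi2.trans (hsep s hs t ht hst)
  have h4 : T.card • (η / 2) ≤ ∑ s ∈ T, F i (U s • x) :=
    Finset.card_nsmul_le_sum _ _ _ fun s hs => (hi1 s hs).le
  rw [nsmul_eq_mul] at h4
  linarith

lemma SegBound.smul {h : G} {c : ℝ} (hc : 1 ≤ |c|) (hh : ∀ s, h * U s = U (c * s) * h)
    {Y : Set X} {L : ℕ} (hY : SegBound U Y L) : SegBound U ((fun x => h⁻¹ • x) ⁻¹' Y) L := by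
  classical
  intro x T hT
  have hc0 : c ≠ 0 := by rintro rfl; norm_num at hc
  have hinj : Function.Injective fun s : ℝ => c⁻¹ * s := mul_right_injective₀ (inv_ne_zero hc0)
  rw [← Finset.card_image_of_injective T hinj]
  refine hY (h⁻¹ • x) _ ?_
  intro t ht
  obtain ⟨s, hs, rfl⟩ := Finset.mem_image.1 ht
  obtain ⟨h1, h2⟩ := hT s hs
  have hcomm : U (c⁻¹ * s) * h⁻¹ = h⁻¹ * U s := by
    have := hh (c⁻¹ * s)
    rw [mul_inv_cancel_left₀ hc0] at this
    rw [eq_inv_mul_iff_mul_eq, ← mul_assoc, this, mul_inv_cancel_right]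
  constructor
  · rw [abs_mul, abs_inv]
    refine le_trans ?_ h1
    exact mul_le_of_le_one_left (abs_nonneg _) (inv_le_one_of_one_le₀ hc)
  · rw [← mul_smul, hcomm, mul_smul]; exact h2

lemma SegBound.union {Y Z : Set X} {L M : ℕ} (hY : SegBound U Y L) (hZ : SegBound U Z M) :
    SegBound U (Y ∪ Z) (L + M) := by
  classical
  intro x T hT
  rw [← Finset.card_filter_add_card_filter_not (s := T) (fun s => U s • x ∈ Y)]
  refine add_le_add (hY x _ ?_) (hZ x _ ?_)
  · intro s hs
    rw [Finset.mem_filter] at hs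
    exact ⟨(hT s hs.1).1, hs.2⟩
  · intro s hs
    rw [Finset.mem_filter] at hs
    exact ⟨(hT s hs.1).1, (hT s hs.1).2.resolve_left hs.2⟩

lemma SegBound.mono {Y Z : Set X} {L : ℕ} (hY : SegBound U Y L) (h : Z ⊆ Y) :
    SegBound U Z L := fun x T hT => hY x T fun s hs => ⟨(hT s hs).1, h (hT s hs).2⟩

lemma SegBound.iUnion_pow {h : G} {c : ℝ} (hc : 1 ≤ |c|) (hh : ∀ s, h * U s = U (c * s) * h)
    {Y : Set X} {L : ℕ} (hY : SegBound U Y L) (J : ℕ) :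
    ∃ M, SegBound U (⋃ j ∈ Finset.range J, (fun x => (h ^ j)⁻¹ • x) ⁻¹' Y) M := by
  have hpow : ∀ j : ℕ, ∀ s, h ^ j * U s = U (c ^ j * s) * h ^ j := by
    intro j
    induction j with
    | zero => simp
    | succ j ih =>
      intro s
      rw [pow_succ', mul_assoc, ih, ← mul_assoc, hh, pow_succ', mul_assoc, mul_assoc]
  induction J with
  | zero => exact ⟨0, by intro x T hT; simpa [Finset.eq_empty_iff_forall_notMem] using hT⟩
  | succ J ih =>
    obtain ⟨M, hM⟩ := ih
    refine ⟨M + L, ?_⟩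
    rw [Finset.range_add_one, Finset.set_biUnion_insert, Set.union_comm]
    refine hM.union (SegBound.smul (c := c ^ J) ?_ (hpow J) hY)
    rw [abs_pow]; exact one_le_pow₀ hc

variable [TopologicalSpace X] [MeasurableSpace X] {μ : Measure X}
  [IsProbabilityMeasure μ] [μ.InnerRegularCompactLTTop]

/-- If there are sets of measure at least `η` without pairs at smaller and smaller scales, then
there are compact sets of almost full measure with bounded intersections with segments. -/
lemma exists_compact_segBound (hU : ∀ s t, U (s + t) = U s * U t) {h : G} {c : ℝ}
    (hc : 1 ≤ |c|) (hh : ∀ s, h * U s = U (c * s) * h)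
    (hinv : Measurable fun x : X => h⁻¹ • x)
    (herg : Ergodic (fun x : X => h • x) μ) (hnp : ¬ PairProp (X := X) U μ) {δ : ℝ} (hδ : 0 < δ) :
    ∃ (Y : Set X) (L : ℕ), IsCompact Y ∧ SegBound U Y L ∧ 1 - δ < μ.real Y := by
  simp only [PairProp, not_forall, not_exists, not_and] at hnp
  obtain ⟨η, hη, hnp⟩ := hnp
  have : ∀ j : ℕ, ∃ V : Set X, MeasurableSet V ∧ η ≤ μ.real V ∧
      ¬ HasPair U (1 / ((j:ℝ) + 2)) V := by
    intro j
    have h1 : 1 / ((j:ℝ) + 2) < 1 := by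
      rw [div_lt_one (by positivity)]; linarith [(Nat.cast_nonneg j : (0:ℝ) ≤ j)]
    obtain ⟨V, hV, hV2, hV3⟩ := hnp _ (by positivity) h1
    exact ⟨V, hV, hV2, hV3⟩
  choose V hVm hVη hVp using this
  obtain ⟨D, F, hDm, hD0, hF, hDF⟩ := exists_measurableSet_convexComb V hVm hη hVη
  have hDseg := segBound_of_convexComb hU hVp hη hF hDF
  have hmeas : ∀ j : ℕ, Measurable fun x : X => (h ^ j)⁻¹ • x := by
    intro j
    induction j with
    | zero => simpa using measurable_id'
    | succ j ih =>
      have : (fun x : X => (h ^ (j+1))⁻¹ • x) = (fun x => (h ^ j)⁻¹ • x) ∘ fun x => h⁻¹ • x := by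
        funext x; simp [← mul_smul, pow_succ']
      rw [this]; exact ih.comp hinv
  have hEJm : ∀ j : ℕ, MeasurableSet ((fun x : X => (h ^ j)⁻¹ • x) ⁻¹' D) :=
    fun j => hmeas j hDm
  set E : Set X := ⋃ j : ℕ, (fun x : X => (h ^ j)⁻¹ • x) ⁻¹' D with hE
  have hEsub : E ⊆ (fun x : X => h • x) ⁻¹' E := by
    intro x hx
    obtain ⟨j, hj⟩ := Set.mem_iUnion.1 hx
    refine Set.mem_iUnion.2 ⟨j + 1, ?_⟩
    simpa [pow_succ', ← mul_smul, mul_assoc] using hj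
  have hE1 : μ E = 1 := by
    rcases herg.ae_empty_or_univ_of_ae_le_preimage
      (MeasurableSet.iUnion hEJm).nullMeasurableSet (LE.le.eventuallyLE hEsub) with h0 | h1
    · refine absurd (measure_mono_null ?_ (ae_eq_empty.1 h0)) hD0
      intro x hx
      exact Set.mem_iUnion.2 ⟨0, by simpa using hx⟩
    · rw [measure_congr h1, measure_univ]
  have hlim := tendsto_measure_iUnion_accumulate (μ := μ)
    (f := fun j : ℕ => (fun x : X => (h ^ j)⁻¹ • x) ⁻¹' D)
  rw [← hE, hE1] at hlim
  have hev : ∀ᶠ n in atTop, ENNReal.ofReal (1 - δ / 2) < μ (Set.accumulate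
      (fun j : ℕ => (fun x : X => (h ^ j)⁻¹ • x) ⁻¹' D) n) := by
    refine hlim.eventually (lt_mem_nhds ?_)
    rw [← ENNReal.ofReal_one]
    exact (ENNReal.ofReal_lt_ofReal_iff one_pos).2 (by linarith)
  obtain ⟨n, hn⟩ := hev.exists
  obtain ⟨M, hM⟩ := hDseg.iUnion_pow hc hh (n + 1)
  have hmacc : MeasurableSet (Set.accumulate
      (fun j : ℕ => (fun x : X => (h ^ j)⁻¹ • x) ⁻¹' D) n) :=
    MeasurableSet.biUnion (Set.to_countable _) fun j _ => hEJm j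
  obtain ⟨Y, hYs, hYc, hY⟩ := hmacc.exists_isCompact_lt_add (μ := μ) (measure_ne_top μ _)
    (ε := ENNReal.ofReal (δ / 2)) (by simpa using hδ)
  refine ⟨Y, M, hYc, hM.mono (hYs.trans ?_), ?_⟩
  · intro x hx
    obtain ⟨j, hj, hjx⟩ := Set.mem_accumulate.1 hx
    exact Set.mem_biUnion (Finset.mem_coe.2 (Finset.mem_range.2 (by omega))) hjx
  · have h1 := hn.trans hY
    have h2 : μ Y + ENNReal.ofReal (δ / 2) = ENNReal.ofReal (μ.real Y + δ / 2) := by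
      rw [ENNReal.ofReal_add measureReal_nonneg (by positivity), ofReal_measureReal]
    rw [h2] at h1
    have := (ENNReal.ofReal_lt_ofReal_iff'.1 h1).1
    linarith

end SegBound

section Branching

/-- Iterated covering: if small sets of level `k` split into at most `c k` small sets of level
`k + 1`, then small sets of level `0` split into at most `∏ c k` small sets of level `n`. -/
lemma exists_cover_of_branching {X : Type*} {Small : ℕ → Set X → Prop} {A : Set X} {c : ℕ → ℕ}
    (n : ℕ) (h : ∀ k < n, ∀ B ⊆ A, Small k B → ∃ F : Finset (Set X), F.card ≤ c k ∧
      B ⊆ ⋃ C ∈ F, C ∧ ∀ C ∈ F, C ⊆ A ∧ Small (k + 1) C)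
    {B : Set X} (hBA : B ⊆ A) (hB : Small 0 B) :
    ∃ F : Finset (Set X), F.card ≤ ∏ k ∈ Finset.range n, c k ∧
      B ⊆ ⋃ C ∈ F, C ∧ ∀ C ∈ F, C ⊆ A ∧ Small n C := by
  classical
  induction n with
  | zero => exact ⟨{B}, by simp, by simp, by simpa using ⟨hBA, hB⟩⟩
  | succ n ih =>
    obtain ⟨F, hF, hBF, hFA⟩ := ih fun k hk => h k (hk.trans n.lt_succ_self)
    have hsplit : ∀ C : Set X, ∃ F' : Finset (Set X), C ∈ F → F'.card ≤ c n ∧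
        C ⊆ ⋃ C' ∈ F', C' ∧ ∀ C' ∈ F', C' ⊆ A ∧ Small (n + 1) C' := by
      intro C
      by_cases hC : C ∈ F
      · obtain ⟨F', h'⟩ := h n n.lt_succ_self C (hFA C hC).1 (hFA C hC).2
        exact ⟨F', fun _ => h'⟩
      · exact ⟨∅, fun h => absurd h hC⟩
    choose F' hF' using hsplit
    refine ⟨F.biUnion F', ?_, ?_, ?_⟩
    · refine (Finset.card_biUnion_le_card_mul _ _ _ fun C hC => (hF' C hC).1).trans ?_
      rw [Finset.prod_range_succ]
      exact Nat.mul_le_mul_right _ hF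
    · intro x hx
      obtain ⟨C, hC, hxC⟩ := Set.mem_iUnion₂.1 (hBF hx)
      obtain ⟨C', hC', hxC'⟩ := Set.mem_iUnion₂.1 ((hF' C hC).2.1 hxC)
      exact Set.mem_iUnion₂.2 ⟨C', Finset.mem_biUnion.2 ⟨C, hC, hC'⟩, hxC'⟩
    · intro C' hC'
      obtain ⟨C, hC, hC2⟩ := Finset.mem_biUnion.1 hC'
      exact (hF' C hC).2.2 C' hC2

lemma measureReal_biUnion_le_card_mul {X ι : Type*} [MeasurableSpace X] {μ : Measure X}
    [IsFiniteMeasure μ] (F : Finset ι) (s : ι → Set X) {m : ℝ} (h : ∀ i ∈ F, μ.real (s i) ≤ m) :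
    μ.real (⋃ i ∈ F, s i) ≤ F.card * m := by
  refine (measureReal_biUnion_finset_le F s).trans ?_
  simpa [nsmul_eq_mul] using Finset.sum_le_card_nsmul F _ m h

/-- Counting with few bad times: if at good times small sets split into at most `L` pieces and at
bad times into at most `C` pieces, and there are at most `b` bad times, then the measure is
controlled by that of the final pieces. -/
theorem measureReal_le_of_branching {X : Type*} [MeasurableSpace X] {μ : Measure X}
    [IsFiniteMeasure μ] {Small : ℕ → Set X → Prop} {A : Set X} {N L C : ℕ} {b : ℝ}
    (hL : 1 ≤ L) (hC : 1 ≤ C) (Bad : ℕ → Set X)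
    (hbad : ∀ x ∈ A, ∃ S : Finset ℕ, S ⊆ Finset.range N ∧ (S.card : ℝ) ≤ b ∧
      ∀ k < N, k ∉ S → x ∉ Bad k)
    (hmono : ∀ k B B', B' ⊆ B → Small k B → Small k B')
    (hgood : ∀ k < N, ∀ B ⊆ A, (∀ x ∈ B, x ∉ Bad k) → Small k B →
      ∃ F : Finset (Set X), F.card ≤ L ∧ B ⊆ ⋃ C ∈ F, C ∧ ∀ C ∈ F, Small (k + 1) C)
    (hany : ∀ k < N, ∀ B ⊆ A, Small k B →
      ∃ F : Finset (Set X), F.card ≤ C ∧ B ⊆ ⋃ C ∈ F, C ∧ ∀ C ∈ F, Small (k + 1) C)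
    (P : Finset (Set X)) (hP : A ⊆ ⋃ C ∈ P, C) (hP0 : ∀ C ∈ P, Small 0 C)
    {m : ℝ} (hm : 0 ≤ m) (hfin : ∀ B ⊆ A, Small N B → μ.real B ≤ m) :
    μ.real A ≤ P.card * (2 ^ N * (L ^ N * (C : ℝ) ^ b * m)) := by
  classical
  set 𝒮 : Finset (Finset ℕ) := (Finset.range N).powerset.filter fun S => (S.card : ℝ) ≤ b
  set AS : Finset ℕ → Set X := fun S => {x ∈ A | ∀ k < N, k ∉ S → x ∉ Bad k}
  have hAS : ∀ S ∈ 𝒮, ∀ B ∈ P, μ.real (AS S ∩ B) ≤ L ^ N * (C : ℝ) ^ b * m := by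
    intro S hS B hB
    have hS' := Finset.mem_filter.1 hS
    have hSA : AS S ∩ B ⊆ A := fun x hx => hx.1.1
    obtain ⟨F, hF, hBF, hFA⟩ := exists_cover_of_branching (Small := Small) (A := AS S ∩ B)
      (c := fun k => if k ∈ S then C else L) N (by
        intro k hk B' hB' hsm
        have : ∃ F : Finset (Set X), F.card ≤ (if k ∈ S then C else L) ∧ B' ⊆ ⋃ C ∈ F, C ∧
            ∀ C ∈ F, Small (k + 1) C := by
          split_ifs with hkS
          · exact hany k hk B' (hB'.trans hSA) hsm
          · exact hgood k hk B' (hB'.trans hSA) (fun x hx => (hB' hx).1.2 k hk hkS) hsm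
        obtain ⟨F, hF, hcov, hFs⟩ := this
        refine ⟨F.image fun D => D ∩ B', Finset.card_image_le.trans hF, ?_, ?_⟩
        · intro x hx
          obtain ⟨D, hD, hxD⟩ := Set.mem_iUnion₂.1 (hcov hx)
          exact Set.mem_iUnion₂.2 ⟨D ∩ B', Finset.mem_image_of_mem _ hD, hxD, hx⟩
        · intro D' hD'
          obtain ⟨D, hD, rfl⟩ := Finset.mem_image.1 hD'
          exact ⟨Set.inter_subset_right.trans hB',
            hmono _ _ _ Set.inter_subset_left (hFs D hD)⟩)
      subset_rfl (hmono _ _ _ Set.inter_subset_right (hP0 B hB))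
    have h1 : μ.real (AS S ∩ B) ≤ F.card * m :=
      (measureReal_mono hBF (measure_ne_top _ _)).trans (measureReal_biUnion_le_card_mul F id
        fun D hD => hfin D ((hFA D hD).1.trans hSA) (hFA D hD).2)
    refine h1.trans (mul_le_mul_of_nonneg_right ?_ hm)
    have h2 : (∏ k ∈ Finset.range N, if k ∈ S then C else L) ≤ L ^ N * C ^ S.card := by
      calc (∏ k ∈ Finset.range N, if k ∈ S then C else L)
          ≤ ∏ k ∈ Finset.range N, (L * if k ∈ S then C else 1) := by
            refine Finset.prod_le_prod' fun k _ => ?_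
            split_ifs
            · exact Nat.le_mul_of_pos_left _ hL
            · simp
        _ = L ^ N * C ^ S.card := by
            rw [Finset.prod_mul_distrib, Finset.prod_const, Finset.card_range,
              Finset.prod_ite_mem, Finset.inter_eq_right.2 (Finset.mem_powerset.1 hS'.1),
              Finset.prod_const]
    calc (F.card : ℝ) ≤ (L ^ N * C ^ S.card : ℕ) := by exact_mod_cast hF.trans h2
      _ = (L:ℝ) ^ N * (C:ℝ) ^ (S.card : ℝ) := by push_cast; rw [Real.rpow_natCast]
      _ ≤ (L:ℝ) ^ N * (C:ℝ) ^ b := by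
        gcongr
        · exact_mod_cast hC
        · exact hS'.2
  have hcov : A ⊆ ⋃ S ∈ 𝒮, ⋃ B ∈ P, AS S ∩ B := by
    intro x hx
    obtain ⟨S, hS1, hS2, hS3⟩ := hbad x hx
    obtain ⟨B, hB, hxB⟩ := Set.mem_iUnion₂.1 (hP hx)
    exact Set.mem_iUnion₂.2 ⟨S, Finset.mem_filter.2 ⟨Finset.mem_powerset.2 hS1, hS2⟩,
      Set.mem_iUnion₂.2 ⟨B, hB, ⟨hx, hS3⟩, hxB⟩⟩
  have h3 : μ.real A ≤ 𝒮.card * (P.card * (L ^ N * (C : ℝ) ^ b * m)) :=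
    (measureReal_mono hcov (measure_ne_top _ _)).trans (measureReal_biUnion_le_card_mul _ _
      fun S hS => measureReal_biUnion_le_card_mul _ _ (hAS S hS))
  have h4 : (𝒮.card : ℝ) ≤ 2 ^ N := by
    have : 𝒮.card ≤ 2 ^ N := by
      simpa using Finset.card_filter_le (Finset.range N).powerset fun S => (S.card : ℝ) ≤ b
    exact_mod_cast this
  calc μ.real A ≤ 𝒮.card * (P.card * (L ^ N * (C : ℝ) ^ b * m)) := h3
    _ ≤ 2 ^ N * (P.card * (L ^ N * (C : ℝ) ^ b * m)) := by gcongr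
    _ = _ := by ring

/-- Markov's inequality for the number of visits to a sequence of sets. -/
lemma measureReal_lt_card_filter_le {X : Type*} [MeasurableSpace X] {μ : Measure X}
    [IsProbabilityMeasure μ] {B : ℕ → Set X} (hB : ∀ k, MeasurableSet (B k)) {N : ℕ} {δ β : ℝ}
    (hN : 0 < N) (hβ : 0 < β) (h : ∑ k ∈ Finset.range N, μ.real (B k) ≤ δ * N)
    [∀ x, DecidablePred fun k => x ∈ B k] :
    μ.real {x | β * N < (((Finset.range N).filter fun k => x ∈ B k).card : ℝ)} ≤ δ / β := by
  set f : X → ℝ := fun x => ∑ k ∈ Finset.range N, (B k).indicator (fun _ => (1:ℝ)) x with hf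
  have hint : ∀ k, Integrable ((B k).indicator fun _ => (1:ℝ)) μ :=
    fun k => (integrable_const 1).indicator (hB k)
  have hfi : Integrable f μ := integrable_finsetSum _ fun k _ => hint k
  have hfx : ∀ x, f x = (((Finset.range N).filter fun k => x ∈ B k).card : ℝ) := by
    intro x
    simp [hf, Set.indicator_apply, Finset.sum_boole]
  have hint2 : ∫ x, f x ∂μ = ∑ k ∈ Finset.range N, μ.real (B k) := by
    rw [hf, integral_finsetSum _ fun k _ => hint k]
    exact Finset.sum_congr rfl fun k _ => integral_indicator_one (hB k)
  have h0 : 0 ≤ f := fun x => by rw [hfx]; exact Nat.cast_nonneg _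
  have h1 := mul_meas_ge_le_integral_of_nonneg (μ := μ) (Eventually.of_forall h0) hfi (β * N)
  have h2 : μ.real {x | β * N < (((Finset.range N).filter fun k => x ∈ B k).card : ℝ)} ≤
      μ.real {x | β * N ≤ f x} := measureReal_mono fun x hx => by
    rw [Set.mem_ofPred_eq] at hx ⊢; rw [hfx]; exact hx.le
  have hN' : (0:ℝ) < N := by exact_mod_cast hN
  refine h2.trans ?_
  rw [le_div_iff₀ hβ]
  refine le_of_mul_le_mul_right ?_ hN'
  linarith

end Branching

section BoxDim

/-- The box of radius `r` around `y` in the directions `U` and `S`. -/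
def orbitBox {G X : Type*} [Group G] [MulAction G X] (U S : ℝ → G) (r : ℝ) (y : X) : Set X :=
  {x | ∃ s t : ℝ, |s| ≤ r ∧ |t| ≤ r ∧ x = (U s * S t) • y}

/-- Outside a set of measure at most `1/4`, boxes have measure `O(r ^ κ)`. -/
def BoxDim {G X : Type*} [Group G] [MulAction G X] [MeasurableSpace X] (U S : ℝ → G)
    (μ : Measure X) (κ : ℝ) : Prop :=
  ∃ D : Set X, MeasurableSet D ∧ 3 / 4 ≤ μ.real D ∧ ∃ K r₁ : ℝ, 0 < K ∧ 0 < r₁ ∧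
    ∀ r, 0 < r → r ≤ r₁ → ∀ y, μ.real (D ∩ orbitBox U S r y) ≤ K * r ^ κ

/-- Almost all points lie in finitely many boxes of any given size. -/
def BoxCover {G X : Type*} [Group G] [MulAction G X] [MeasurableSpace X] (U S : ℝ → G)
    (μ : Measure X) : Prop :=
  ∀ τ > 0, ∃ P : Finset X, ∀ᵐ x ∂μ, ∃ p ∈ P, x ∈ orbitBox U S τ p

/-- A set of reals whose `ε`-separated finite subsets have at most `L` points is covered by `L`
balls of radius `ε`. -/
lemma exists_cover_of_separated_card_le {S : Set ℝ} {ε : ℝ} {L : ℕ}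
    (hε : 0 ≤ ε)
    (h : ∀ T : Finset ℝ, ↑T ⊆ S → (∀ s ∈ T, ∀ t ∈ T, s ≠ t → ε ≤ |s - t|) → T.card ≤ L) :
    ∃ T : Finset ℝ, T.card ≤ L ∧ ∀ s ∈ S, ∃ t ∈ T, |s - t| ≤ ε := by
  classical
  set Q : ℕ → Prop := fun n => ∃ T : Finset ℝ, ↑T ⊆ S ∧
    (∀ s ∈ T, ∀ t ∈ T, s ≠ t → ε ≤ |s - t|) ∧ T.card = n with hQ
  have h0 : Q 0 := ⟨∅, by simp, by simp, by simp⟩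
  obtain ⟨T, hTS, hsep, hcard⟩ := Nat.findGreatest_spec (P := Q) (Nat.zero_le L) h0
  refine ⟨T, h T hTS hsep, fun s hs => ?_⟩
  by_contra! hcon
  have hsT : s ∉ T := fun hsT => by
    have h1 := hcon s hsT
    rw [sub_self, abs_zero] at h1
    exact absurd hε h1.not_ge
  have hins : Q (T.card + 1) := by
    refine ⟨insert s T, ?_, ?_, Finset.card_insert_of_notMem hsT⟩
    · rw [Finset.coe_insert]; exact Set.insert_subset hs hTS
    · intro a ha b hb hab
      rcases Finset.mem_insert.1 ha with ha' | ha' <;> rcases Finset.mem_insert.1 hb with hb' | hb'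
      · exact absurd (ha'.trans hb'.symm) hab
      · rw [ha']; exact (hcon b hb').le
      · rw [hb', abs_sub_comm]; exact (hcon a ha').le
      · exact hsep a ha' b hb' hab
  have hle : T.card + 1 ≤ L := by
    obtain ⟨T', h1, h2, h3⟩ := hins
    exact h3 ▸ h T' h1 h2
  have := Nat.le_findGreatest hle hins
  omega

lemma exists_grid (M : ℕ) (hM : 0 < M) :
    ∃ T : Finset ℝ, T.card ≤ M + 1 ∧ ∀ s : ℝ, |s| ≤ 1 / 2 → ∃ t ∈ T, |s - t| ≤ 1 / (2 * M) := by
  classical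
  have hM' : (0:ℝ) < M := by exact_mod_cast hM
  refine ⟨(Finset.range (M + 1)).image fun j : ℕ => -1 / 2 + ((j:ℝ) + 1 / 2) / M,
    Finset.card_image_le.trans (by simp), fun s hs => ?_⟩
  rw [abs_le] at hs
  have h0 : 0 ≤ (s + 1 / 2) * M := mul_nonneg (by linarith) hM'.le
  have h1 : (s + 1 / 2) * M ≤ M := by nlinarith
  refine ⟨_, Finset.mem_image_of_mem _ (Finset.mem_range.2 (Nat.lt_succ_of_le
    (Nat.floor_le_of_le h1))), ?_⟩
  have h2 := Nat.floor_le h0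
  have h3 := Nat.lt_floor_add_one ((s + 1 / 2) * M)
  set j : ℝ := (⌊(s + 1 / 2) * M⌋₊ : ℝ)
  have h4 : s - (-1 / 2 + (j + 1 / 2) / M) = ((s + 1 / 2) * M - (j + 1 / 2)) / M := by
    field_simp; ring
  rw [h4, abs_div, abs_of_pos hM', div_le_div_iff₀ hM' (by positivity)]
  have : |(s + 1 / 2) * M - (j + 1 / 2)| ≤ 1 / 2 := by rw [abs_le]; constructor <;> linarith
  nlinarith

lemma Ergodic.measurePreserving_pow_smul {G X : Type*} [Group G] [MulAction G X]
    [MeasurableSpace X] {μ : Measure X} {h : G} (herg : Ergodic (fun x : X => h • x) μ) (k : ℕ) :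
    MeasurePreserving (fun x : X => h ^ k • x) μ μ := by
  have := herg.toMeasurePreserving.iterate k
  rwa [smul_iterate] at this

variable {G X : Type*} [Group G] [TopologicalSpace G] [IsTopologicalGroup G] [TopologicalSpace X]
  [MulAction G X] [ContinuousSMul G X] [T2Space X] {U S : ℝ → G}

lemma SegBound.exists_tube (hUc : Continuous U) (hSc : Continuous S)
    (hU : ∀ s t, U (s + t) = U s * U t) (hS : ∀ s t, S (s + t) = S s * S t)
    (hUS : ∀ s t, U s * S t = S t * U s) {Y : Set X} {L : ℕ} (hY : IsCompact Y)
    (hseg : SegBound U Y L) {ε : ℝ} (hε : 0 < ε) :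
    ∃ τ, 0 < τ ∧ τ ≤ 1 / 2 ∧ ∀ (p : X) (T : Finset ℝ),
      (∀ s ∈ T, |s| ≤ 1 / 2 ∧ ∃ t, |t| ≤ τ ∧ (S t * U s) • p ∈ Y) →
      (∀ s ∈ T, ∀ t ∈ T, s ≠ t → ε ≤ |s - t|) → T.card ≤ L := by
  classical
  have hU0 : U 0 = 1 := by simpa using hU 0 0
  have hS0 : S 0 = 1 := by simpa using hS 0 0
  have hSneg : ∀ t, S (-t) = (S t)⁻¹ := fun t => by
    rw [eq_inv_iff_mul_eq_one, ← hS, neg_add_cancel, hS0]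
  have hUneg : ∀ t, U (-t) = (U t)⁻¹ := fun t => by
    rw [eq_inv_iff_mul_eq_one, ← hU, neg_add_cancel, hU0]
  set K : Set (Fin (L + 1) → ℝ) :=
    Set.pi Set.univ (fun _ => Set.Icc (-(1/2)) (1/2)) ∩ {s | ∀ i j, i ≠ j → ε ≤ |s i - s j|}
    with hK
  have hKc : IsCompact K := by
    refine (isCompact_univ_pi fun _ => isCompact_Icc).inter_right ?_
    simp only [Set.ofPred_forall]
    refine isClosed_iInter fun i => isClosed_iInter fun j => isClosed_iInter fun _ => ?_
    exact isClosed_le continuous_const (by fun_prop)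
  have key : ∀ᶠ t : Fin (L + 1) → ℝ in 𝓝 0, ∀ z ∈ K ×ˢ Y,
      ∃ i, (S (t i - t 0) * U (z.1 i - z.1 0)) • z.2 ∉ Y := by
    refine (hKc.prod hY).eventually_forall_of_forall_eventually
      (P := fun (t : Fin (L + 1) → ℝ) z => ∃ i, (S (t i - t 0) * U (z.1 i - z.1 0)) • z.2 ∉ Y) ?_
    rintro ⟨s, y⟩ ⟨hs, hy⟩
    have hinj : Function.Injective s := by
      intro i j hij
      by_contra hne
      have := hs.2 i j hne
      simp only [hij, sub_self, abs_zero] at this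
      linarith
    have hex : ∃ i, U (s i - s 0) • y ∉ Y := by
      by_contra! hcon
      have := hseg (U (-s 0) • y) (Finset.univ.image s) (by
        intro r hr
        obtain ⟨i, -, rfl⟩ := Finset.mem_image.1 hr
        refine ⟨abs_le.2 (hs.1 i trivial), ?_⟩
        rw [← mul_smul, ← hU, ← sub_eq_add_neg]
        exact hcon i)
      rw [Finset.card_image_of_injective _ hinj] at this
      simp at this
    obtain ⟨i, hi⟩ := hex
    have hcont : Continuous fun w : (Fin (L + 1) → ℝ) × ((Fin (L + 1) → ℝ) × X) =>
        (S (w.1 i - w.1 0) * U (w.2.1 i - w.2.1 0)) • w.2.2 := by fun_prop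
    have hmem : (fun w : (Fin (L + 1) → ℝ) × ((Fin (L + 1) → ℝ) × X) =>
        (S (w.1 i - w.1 0) * U (w.2.1 i - w.2.1 0)) • w.2.2) (0, (s, y)) ∈ Yᶜ := by
      simpa [hS0] using hi
    filter_upwards [hcont.continuousAt.eventually (hY.isClosed.isOpen_compl.mem_nhds hmem)]
      with w hw using ⟨i, hw⟩
  obtain ⟨τ, hτ, hball⟩ := Metric.eventually_nhds_iff_ball.1 key
  refine ⟨min (τ / 2) (1 / 2), by positivity, min_le_right _ _, fun p T hT hsep => ?_⟩
  by_contra! hcard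
  obtain ⟨T', hT'T, hT'c⟩ := Finset.exists_subset_card_eq (Nat.succ_le_of_lt hcard)
  let e : Fin (L + 1) ≃ T' := (Fintype.equivFinOfCardEq (by simpa using hT'c)).symm
  have hemem : ∀ i, (e i : ℝ) ∈ T := fun i => hT'T (e i).2
  choose t ht htY using fun i => (hT _ (hemem i)).2
  have htb : t ∈ Metric.ball (0 : Fin (L + 1) → ℝ) τ := by
    rw [mem_ball_zero_iff]
    refine lt_of_le_of_lt ((pi_norm_le_iff_of_nonneg (by positivity : 0 ≤ τ / 2)).2 fun i => ?_)
      (half_lt_self hτ)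
    exact (ht i).trans (min_le_left _ _)
  obtain ⟨i, hi⟩ := hball t htb (fun i => (e i : ℝ), (S (t 0) * U (e 0)) • p) ⟨⟨fun i _ =>
    abs_le.1 (hT _ (hemem i)).1, fun i j hij => hsep _ (hemem i) _ (hemem j) fun h =>
      hij (e.injective (Subtype.ext h))⟩, htY 0⟩
  apply hi
  have : (S (t i - t 0) * U (e i - e 0)) • (S (t 0) * U (e 0)) • p = (S (t i) * U (e i)) • p := by
    rw [← mul_smul, mul_assoc, ← mul_assoc (U _) (S _), hUS, mul_assoc (S (t 0)), ← hU,
      ← mul_assoc, ← hS, sub_add_cancel, sub_add_cancel]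
  rw [this]; exact htY i

lemma pow_mul_param {G : Type*} [Group G] {U : ℝ → G} {h : G} {c : ℝ}
    (hh : ∀ s, h * U s = U (c * s) * h) (j : ℕ) (s : ℝ) :
    h ^ j * U s = U (c ^ j * s) * h ^ j := by
  induction j generalizing s with
  | zero => simp
  | succ j ih => rw [pow_succ', mul_assoc, ih, ← mul_assoc, hh, pow_succ', mul_assoc, mul_assoc]

lemma exists_large_scale {κ β : ℝ} (hκ : 0 < κ) (hβ : β = κ / 4) (L : ℝ) {a : ℝ} (ha : 1 < a) :
    ∃ W : ℕ, 0 < W ∧ 4 * L ^ 2 * ((⌈a ^ W⌉₊ + 1 : ℕ) : ℝ) ^ (2 * β) * (a ^ W) ^ (-κ) < 1 := by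
  have h1 : Tendsto (fun W : ℕ => 4 * L ^ 2 * 3 ^ (κ / 2) * (a ^ W) ^ (-(κ / 2))) atTop (𝓝 0) := by
    have := ((tendsto_rpow_neg_atTop (half_pos hκ)).comp
      (tendsto_pow_atTop_atTop_of_one_lt ha)).const_mul (4 * L ^ 2 * 3 ^ (κ / 2))
    simpa using this
  obtain ⟨W, hW, hW0⟩ := ((h1.eventually (gt_mem_nhds one_pos)).and (eventually_gt_atTop 0)).exists
  refine ⟨W, hW0, lt_of_le_of_lt ?_ hW⟩
  have hΛ : 1 ≤ a ^ W := one_le_pow₀ ha.le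
  have hΛ0 : 0 < a ^ W := by positivity
  have h2 : ((⌈a ^ W⌉₊ + 1 : ℕ) : ℝ) ≤ 3 * a ^ W := by
    push_cast
    linarith [Nat.ceil_lt_add_one hΛ0.le]
  have h3 : ((⌈a ^ W⌉₊ + 1 : ℕ) : ℝ) ^ (2 * β) ≤ 3 ^ (κ / 2) * (a ^ W) ^ (κ / 2) := by
    rw [← Real.mul_rpow (by norm_num) hΛ0.le, show 2 * β = κ / 2 by rw [hβ]; ring]
    exact Real.rpow_le_rpow (by positivity) h2 (by positivity)
  calc 4 * L ^ 2 * ((⌈a ^ W⌉₊ + 1 : ℕ) : ℝ) ^ (2 * β) * (a ^ W) ^ (-κ)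
      ≤ 4 * L ^ 2 * (3 ^ (κ / 2) * (a ^ W) ^ (κ / 2)) * (a ^ W) ^ (-κ) := by gcongr
    _ = 4 * L ^ 2 * 3 ^ (κ / 2) * ((a ^ W) ^ (κ / 2) * (a ^ W) ^ (-κ)) := by ring
    _ = _ := by rw [← Real.rpow_add hΛ0]; ring_nf

lemma scale_identity {P K L C Λ β κ : ℝ} (hC : 0 ≤ C) (hΛ : 0 < Λ) (m : ℕ) :
    P * (2 ^ (2 * m) * (L ^ (2 * m) * C ^ (β * (2 * m : ℕ)) * (K * (2 * (Λ ^ m)⁻¹) ^ κ))) =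
      P * K * 2 ^ κ * (4 * L ^ 2 * C ^ (2 * β) * Λ ^ (-κ)) ^ m := by
  have h1 : C ^ (β * (2 * m : ℕ)) = (C ^ (2 * β)) ^ m := by
    rw [← Real.rpow_natCast (C ^ _), ← Real.rpow_mul hC]; push_cast; ring_nf
  have h2 : ((Λ ^ m)⁻¹) ^ κ = (Λ ^ (-κ)) ^ m := by
    rw [← Real.rpow_natCast (Λ ^ _), ← Real.rpow_mul hΛ.le, ← Real.rpow_natCast Λ,
      ← Real.rpow_neg hΛ.le, ← Real.rpow_mul hΛ.le]
    ring_nf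
  rw [Real.mul_rpow (by norm_num) (by positivity), h1, h2, pow_mul, pow_mul]
  simp only [mul_pow]
  norm_num
  ring

variable [MeasurableSpace X] [BorelSpace X] {μ : Measure X} [IsProbabilityMeasure μ]

lemma measurableSet_orbitBox (hUc : Continuous U) (hSc : Continuous S) (r : ℝ) (y : X) :
    MeasurableSet (orbitBox U S r y) := by
  have : orbitBox U S r y = (fun w : ℝ × ℝ => (U w.1 * S w.2) • y) ''
      (Set.Icc (-r) r ×ˢ Set.Icc (-r) r) := by
    ext x
    simp only [orbitBox, Set.mem_ofPred_eq, Set.mem_image, Prod.exists, Set.mem_prod, Set.mem_Icc,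
      ← abs_le]
    constructor
    · rintro ⟨s, t, hs, ht, rfl⟩; exact ⟨s, t, ⟨hs, ht⟩, rfl⟩
    · rintro ⟨s, t, ⟨hs, ht⟩, rfl⟩; exact ⟨s, t, hs, ht, rfl⟩
  rw [this]
  exact ((isCompact_Icc.prod isCompact_Icc).image (by fun_prop)).measurableSet

/-- Positive dimension along boxes gives pairs in every set of positive measure. -/
theorem pairProp_of_boxDim [μ.InnerRegularCompactLTTop] (hUc : Continuous U) (hSc : Continuous S)
    (hU : ∀ s t, U (s + t) = U s * U t) (hS : ∀ s t, S (s + t) = S s * S t)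
    (hUS : ∀ s t, U s * S t = S t * U s) {h : G} {c : ℝ} (hc : 1 < |c|)
    (hhU : ∀ s, h * U s = U (c * s) * h) (hhS : ∀ s, h * S s = S (c⁻¹ * s) * h)
    (herg : Ergodic (fun x : X => h • x) μ) {κ : ℝ} (hκ : 0 < κ) (hdim : BoxDim U S μ κ)
    (hcov : BoxCover U S μ) : PairProp (X := X) U μ := by
  classical
  by_contra hnp
  have hU0 : U 0 = 1 := by simpa using hU 0 0
  have hS0 : S 0 = 1 := by simpa using hS 0 0
  have hUneg : ∀ t, (U t)⁻¹ = U (-t) := fun t => by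
    rw [eq_comm, eq_inv_iff_mul_eq_one, ← hU, neg_add_cancel, hU0]
  have hSneg : ∀ t, (S t)⁻¹ = S (-t) := fun t => by
    rw [eq_comm, eq_inv_iff_mul_eq_one, ← hS, neg_add_cancel, hS0]
  obtain ⟨D, hDm, hDμ, K, r₁, hK, hr₁, hD⟩ := hdim
  obtain ⟨β, hβ⟩ : ∃ β, β = κ / 4 := ⟨_, rfl⟩
  have hβ0 : 0 < β := by linarith
  obtain ⟨Y, L, hYc, hseg, hYμ⟩ := exists_compact_segBound hU hc.le hhU
    (continuous_const_smul h⁻¹).measurable herg hnp (div_pos hβ0 four_pos)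
  have hYm := hYc.measurableSet
  obtain ⟨W, hW0, hW⟩ := exists_large_scale hκ hβ ((L + 1 : ℕ) : ℝ) hc
  set Λ : ℝ := |c| ^ W with hΛdef
  have hΛ1 : 1 ≤ Λ := one_le_pow₀ hc.le
  have hΛ0 : 0 < Λ := by positivity
  set R : G := h ^ W with hR
  set d : ℝ := c ^ W with hd
  have hdΛ : |d| = Λ := by rw [hd, abs_pow]
  have hd0 : d ≠ 0 := by rw [← abs_pos, hdΛ]; exact hΛ0
  have hRU : ∀ (k : ℕ) s, R ^ k * U s = U (d ^ k * s) * R ^ k := pow_mul_param (pow_mul_param hhU W)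
  have hRS : ∀ (k : ℕ) s, R ^ k * S s = S ((c⁻¹ ^ W) ^ k * s) * R ^ k :=
    pow_mul_param (pow_mul_param hhS W)
  have hRp : ∀ k : ℕ, MeasurePreserving (fun x : X => R ^ k • x) μ μ := fun k => by
    rw [hR, ← pow_mul]; exact herg.measurePreserving_pow_smul _
  have hciΛ : |c⁻¹ ^ W| = Λ⁻¹ := by rw [inv_pow, abs_inv, ← hd, hdΛ]
  have hcile : ∀ k : ℕ, |(c⁻¹ ^ W) ^ k| ≤ 1 := fun k => by
    rw [abs_pow, hciΛ]
    exact pow_le_one₀ (by positivity) (inv_le_one_of_one_le₀ hΛ1)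
  obtain ⟨τ, hτ0, hτ1, hτ⟩ := hseg.exists_tube hUc hSc hU hS hUS hYc
    (ε := 1 / (2 * Λ)) (by positivity)
  obtain ⟨P, hP⟩ := hcov τ hτ0
  set Cn : ℕ := ⌈Λ⌉₊ + 1 with hCn
  have hCn1 : 1 ≤ Cn := by omega
  set Small : ℕ → Set X → Prop := fun k A => ∃ (p : X) (s₀ : ℝ), ∀ x ∈ A, ∃ s t : ℝ,
    |s - s₀| * Λ ^ k ≤ 1 / 2 ∧ |t| ≤ τ ∧ x = (S t * U s) • p with hSmall
  -- splitting a small set along a finite set of centres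
  have hsplit : ∀ (k : ℕ) (B : Set X) (p : X) (s₀ : ℝ) (T : Finset ℝ), (∀ x ∈ B, ∃ s t : ℝ,
      |t| ≤ τ ∧ x = (S t * U s) • p ∧ ∃ v ∈ T, |d ^ k * (s - s₀) - v| ≤ 1 / (2 * Λ)) →
      ∃ F : Finset (Set X), F.card ≤ T.card ∧ B ⊆ ⋃ C ∈ F, C ∧ ∀ C ∈ F, Small (k + 1) C := by
    intro k B p s₀ T hB
    have hdk : d ^ k ≠ 0 := pow_ne_zero _ hd0
    refine ⟨T.image fun v => {x | ∃ s t : ℝ, |s - (s₀ + (d ^ k)⁻¹ * v)| * Λ ^ (k + 1) ≤ 1 / 2 ∧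
      |t| ≤ τ ∧ x = (S t * U s) • p}, Finset.card_image_le, ?_, ?_⟩
    · intro x hx
      obtain ⟨s, t, ht, hxp, v, hv, hvs⟩ := hB x hx
      refine Set.mem_iUnion₂.2 ⟨_, Finset.mem_image_of_mem _ hv, s, t, ?_, ht, hxp⟩
      have h1 : d ^ k * (s - s₀) - v = d ^ k * (s - (s₀ + (d ^ k)⁻¹ * v)) := by
        field_simp; ring
      rw [h1, abs_mul, abs_pow, hdΛ, le_div_iff₀ (by positivity)] at hvs
      rw [pow_succ]
      linarith
    · intro C hC
      obtain ⟨v, -, rfl⟩ := Finset.mem_image.1 hC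
      exact ⟨p, s₀ + (d ^ k)⁻¹ * v, fun x hx => hx⟩
  have hmove : ∀ (k : ℕ) s t s₀ p, R ^ k • (S t * U s) • p =
      (S ((c⁻¹ ^ W) ^ k * t) * U (d ^ k * (s - s₀))) • R ^ k • U s₀ • (p : X) := by
    intro k s t s₀ p
    simp only [← mul_smul]
    congr 1
    have e1 : U (d ^ k * s) * R ^ k = U (d ^ k * (s - s₀)) * (R ^ k * U s₀) := by
      rw [hRU, ← mul_assoc, ← hU, ← mul_add, sub_add_cancel]
    rw [← mul_assoc, hRS, mul_assoc (S _) (R ^ k), hRU, e1, mul_assoc]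
  set Bad : ℕ → Set X := fun k => (fun x => R ^ k • x) ⁻¹' Yᶜ with hBad
  have hBadm : ∀ k, MeasurableSet (Bad k) := fun k => (hRp k).measurable hYm.compl
  have hBadμ : ∀ k, μ.real (Bad k) ≤ β / 4 := fun k => by
    rw [(hRp k).measureReal_preimage hYm.compl.nullMeasurableSet,
      measureReal_compl hYm, probReal_univ]
    linarith
  have hmain : ∀ m : ℕ, 0 < m → 2 * (Λ ^ m)⁻¹ ≤ r₁ →
      1 / 2 ≤ P.card * (2 ^ (2 * m) * (((L + 1 : ℕ) : ℝ) ^ (2 * m) *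
        (Cn : ℝ) ^ (β * (2 * m : ℕ)) * (K * (2 * (Λ ^ m)⁻¹) ^ κ))) := by
    intro m hm hmr
    set N := 2 * m with hN
    set Ω : Set X := {x | β * N < (((Finset.range N).filter fun k => x ∈ Bad k).card : ℝ)}
    have hΩ : μ.real Ω ≤ 1 / 4 := by
      have := measureReal_lt_card_filter_le (μ := μ) hBadm (N := N) (δ := β / 4) (by omega) hβ0 (by
        refine (Finset.sum_le_card_nsmul _ _ _ fun k _ => hBadμ k).trans ?_
        rw [Finset.card_range, nsmul_eq_mul]; linarith)
      refine this.trans (le_of_eq ?_)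
      field_simp
    set Z : Set X := {x | ∃ p ∈ P, x ∈ orbitBox U S τ p}
    have hZ : μ.real Zᶜ = 0 := by
      rw [measureReal_def, show μ Zᶜ = 0 from ae_iff.1 hP]; rfl
    set E : Set X := (fun x => R ^ m • x) ⁻¹' D with hE
    have hEc : μ.real Eᶜ ≤ 1 / 4 := by
      rw [measureReal_compl ((hRp m).measurable hDm), probReal_univ,
        (hRp m).measureReal_preimage hDm.nullMeasurableSet]
      linarith
    set A : Set X := E ∩ Z ∩ Ωᶜ
    have hA : 1 / 2 ≤ μ.real A := by
      have h1 : (Set.univ : Set X) ⊆ A ∪ (Eᶜ ∪ (Zᶜ ∪ Ω)) := by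
        intro x _
        by_cases hx1 : x ∈ E <;> by_cases hx2 : x ∈ Z <;> by_cases hx3 : x ∈ Ω <;>
          simp [A, hx1, hx2, hx3]
      have h2 := measureReal_mono (μ := μ) h1 (measure_ne_top _ _)
      rw [probReal_univ] at h2
      have h3 := measureReal_union_le (μ := μ) A (Eᶜ ∪ (Zᶜ ∪ Ω))
      have h4 := measureReal_union_le (μ := μ) Eᶜ (Zᶜ ∪ Ω)
      have h5 := measureReal_union_le (μ := μ) Zᶜ Ω
      linarith
    refine hA.trans ?_
    set PB : Finset (Set X) := P.image fun p => orbitBox U S τ p with hPB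
    have hPBc : (PB.card : ℝ) ≤ P.card := by exact_mod_cast Finset.card_image_le
    refine (measureReal_le_of_branching (Small := Small) (A := A) (N := N) (L := L + 1) (C := Cn)
      (b := β * N) (by omega) hCn1 Bad ?_ ?_ ?_ ?_ PB ?_ ?_
      (m := K * (2 * (Λ ^ m)⁻¹) ^ κ) (by positivity) ?_).trans ?_
    · intro x hx
      refine ⟨(Finset.range N).filter fun k => x ∈ Bad k, Finset.filter_subset _ _,
        not_lt.1 hx.2, fun k hk hkS hxk => hkS ?_⟩
      exact Finset.mem_filter.2 ⟨Finset.mem_range.2 hk, hxk⟩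
    · rintro k B B' hBB ⟨p, s₀, hp⟩
      exact ⟨p, s₀, fun x hx => hp x (hBB hx)⟩
    · rintro k - B - hgood ⟨p, s₀, hp⟩
      obtain ⟨T, hT, hTcov⟩ := exists_cover_of_separated_card_le (S := {v : ℝ | |v| ≤ 1 / 2 ∧
        ∃ t, |t| ≤ τ ∧ (S t * U v) • R ^ k • U s₀ • p ∈ Y}) (ε := 1 / (2 * Λ)) (L := L)
        (by positivity) fun T hTS hsep => hτ _ T (fun s hs => hTS hs) hsep
      obtain ⟨F, hF, hF2⟩ := hsplit k B p s₀ T (by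
        intro x hx
        obtain ⟨s, t, hs, ht, hxp⟩ := hp x hx
        refine ⟨s, t, ht, hxp, hTcov _ ⟨?_, (c⁻¹ ^ W) ^ k * t, ?_, ?_⟩⟩
        · rw [abs_mul, abs_pow, hdΛ, mul_comm]; exact hs
        · rw [abs_mul]
          exact (mul_le_of_le_one_left (abs_nonneg _) (hcile k)).trans ht
        · rw [← hmove, ← hxp]
          exact not_not.1 (hgood x hx))
      exact ⟨F, by omega, hF2⟩
    · rintro k - B - ⟨p, s₀, hp⟩
      obtain ⟨T, hT, hTcov⟩ := exists_grid ⌈Λ⌉₊ (Nat.ceil_pos.2 hΛ0)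
      obtain ⟨F, hF, hF2⟩ := hsplit k B p s₀ T (by
        intro x hx
        obtain ⟨s, t, hs, ht, hxp⟩ := hp x hx
        obtain ⟨v, hv, hv2⟩ := hTcov (d ^ k * (s - s₀)) (by
          rw [abs_mul, abs_pow, hdΛ, mul_comm]; exact hs)
        refine ⟨s, t, ht, hxp, v, hv, hv2.trans ?_⟩
        have := Nat.le_ceil Λ
        gcongr)
      exact ⟨F, by omega, hF2⟩
    · intro x hx
      obtain ⟨p, hp, hxp⟩ := hx.1.2
      exact Set.mem_iUnion₂.2 ⟨_, Finset.mem_image_of_mem _ hp, hxp⟩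
    · intro C hC
      obtain ⟨p, -, rfl⟩ := Finset.mem_image.1 hC
      refine ⟨p, 0, ?_⟩
      rintro x ⟨s, t, hs, ht, hx⟩
      exact ⟨s, t, by simpa using hs.trans hτ1, ht, by rw [hx, hUS]⟩
    · rintro B hBA ⟨p, s₀, hp⟩
      rcases B.eq_empty_or_nonempty with rfl | ⟨x₀, hx₀⟩
      · simp; positivity
      obtain ⟨s', t', hs', ht', hx₀p⟩ := hp x₀ hx₀
      have hsub : B ⊆ (fun x => R ^ m • x) ⁻¹' (D ∩ orbitBox U S (2 * (Λ ^ m)⁻¹) (R ^ m • x₀)) := by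
        intro x hx
        refine ⟨(hBA hx).1.1, ?_⟩
        obtain ⟨s, t, hs, ht, hxp⟩ := hp x hx
        refine ⟨d ^ m * (s - s'), (c⁻¹ ^ W) ^ m * (t - t'), ?_, ?_, ?_⟩
        · have h1 : |s - s'| * Λ ^ N ≤ 1 := by
            have : |s - s'| ≤ |s - s₀| + |s' - s₀| := by
              rw [abs_sub_comm s' s₀]; exact abs_sub_le _ _ _
            calc |s - s'| * Λ ^ N ≤ (|s - s₀| + |s' - s₀|) * Λ ^ N := by gcongr
              _ ≤ 1 := by linarith
          rw [hN, two_mul, pow_add] at h1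
          rw [abs_mul, abs_pow, hdΛ, ← div_eq_mul_inv, le_div_iff₀ (by positivity)]
          linarith
        · rw [abs_mul, abs_pow, hciΛ, inv_pow, mul_comm]
          have : |t - t'| ≤ 2 := (abs_sub _ _).trans (by linarith)
          gcongr
        · rw [hxp, hx₀p]
          simp only [← mul_smul]
          congr 1
          have e1 : S t * U s = U (s - s') * S (t - t') * (S t' * U s') := by
            rw [mul_assoc, ← mul_assoc (S _) (S _), ← hS, sub_add_cancel, ← mul_assoc, hUS,
              mul_assoc, ← hU, sub_add_cancel]
          have e2 : R ^ m * (U (s - s') * S (t - t')) =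
              U (d ^ m * (s - s')) * S ((c⁻¹ ^ W) ^ m * (t - t')) * R ^ m := by
            rw [← mul_assoc, hRU, mul_assoc, hRS, mul_assoc]
          rw [e1, ← mul_assoc, e2, mul_assoc _ (R ^ m)]
      refine (measureReal_mono hsub (measure_ne_top _ _)).trans ?_
      rw [(hRp m).measureReal_preimage
        (hDm.inter (measurableSet_orbitBox hUc hSc _ _)).nullMeasurableSet]
      exact hD _ (by positivity) hmr _
    · gcongr
  set ρ : ℝ := 4 * ((L + 1 : ℕ) : ℝ) ^ 2 * (Cn : ℝ) ^ (2 * β) * Λ ^ (-κ) with hρ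
  have hΛ1' : 1 < Λ := one_lt_pow₀ hc hW0.ne'
  have hρ0 : 0 ≤ ρ := by positivity
  have hexp : ∀ m : ℕ, P.card * (2 ^ (2 * m) * (((L + 1 : ℕ) : ℝ) ^ (2 * m) *
      (Cn : ℝ) ^ (β * (2 * m : ℕ)) * (K * (2 * (Λ ^ m)⁻¹) ^ κ))) =
      P.card * K * 2 ^ κ * ρ ^ m := by
    intro m
    exact scale_identity (Nat.cast_nonneg _) hΛ0 m
  have hlim : Tendsto (fun m : ℕ => P.card * K * 2 ^ κ * ρ ^ m) atTop (𝓝 0) := by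
    simpa using (tendsto_pow_atTop_nhds_zero_of_lt_one hρ0 hW).const_mul (P.card * K * 2 ^ κ)
  have hlim2 : Tendsto (fun m : ℕ => 2 * (Λ ^ m)⁻¹) atTop (𝓝 0) := by
    simpa using (tendsto_inv_atTop_zero.comp
      (tendsto_pow_atTop_atTop_of_one_lt hΛ1')).const_mul 2
  obtain ⟨m, hm1, hm2, hm3⟩ := ((hlim.eventually (gt_mem_nhds one_half_pos)).and
    ((hlim2.eventually (gt_mem_nhds hr₁)).and (eventually_gt_atTop 0))).exists
  have := hmain m hm3 hm2.le
  rw [hexp] at this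
  linarith

end BoxDim

section Reduction

lemma gram_aux {A B C D E F : ℝ} (hA : 0 < A) (hAB : A ≤ B) (hBC : B ≤ C) (hD0 : 0 ≤ D)
    (hE0 : 0 ≤ E) (hF0 : 0 ≤ F) (hD : 2 * D ≤ B) (hE : 2 * E ≤ A) (hF : 2 * F ≤ A)
    (h : 2 * (D + E + F) ≤ A + B) :
    A * D ^ 2 + B * E ^ 2 + C * F ^ 2 + 2 * D * E * F ≤ 3 / 4 * (A * B * C) := by
  have hB : 0 < B := hA.trans_le hAB
  have h1 : A * D ^ 2 + B * E ^ 2 + B * F ^ 2 + 2 * D * E * F ≤ 3 / 4 * (A * B * B) := by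
    have hEF : E * F ≤ (E + F) ^ 2 / 4 := by nlinarith [sq_nonneg (E - F)]
    have h2 : E ^ 2 + F ^ 2 ≤ A ^ 2 / 2 := by nlinarith
    have h3 : A * D ^ 2 ≤ A * B / 2 * D := by nlinarith [mul_nonneg hA.le hD0]
    by_cases hT : E + F ≤ A / 2
    · have h5 : E ^ 2 + F ^ 2 ≤ A ^ 2 / 4 := by nlinarith [mul_nonneg hE0 hF0]
      have h6 : E * F ≤ A ^ 2 / 16 := by nlinarith
      have h7 : D * (E * F) ≤ B / 2 * (A ^ 2 / 16) := by
        apply mul_le_mul <;> first | positivity | linarith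
      have h8 : A ^ 2 * B ≤ A * B * B := by nlinarith [mul_pos hA hB]
      have h9 : B * (E ^ 2 + F ^ 2) ≤ B * (A ^ 2 / 4) := by gcongr
      have h10 : A * B / 2 * D ≤ A * B / 2 * (B / 2) := by gcongr; linarith
      nlinarith
    · push Not at hT
      set T := E + F with hTd
      have h5 : E ^ 2 + F ^ 2 ≤ T ^ 2 - A * T + A ^ 2 / 2 := by nlinarith
      have h6 : D * (E * F) ≤ D * (T ^ 2 / 4) := by gcongr
      have h7 : D ≤ (A + B) / 2 - T := by linarith
      have hTA : T ≤ A := by linarith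
      have h9 : B * (E ^ 2 + F ^ 2) ≤ B * (T ^ 2 - A * T + A ^ 2 / 2) := by gcongr
      have h10 : D * (A * B / 2 + T ^ 2 / 2) ≤ ((A + B) / 2 - T) * (A * B / 2 + T ^ 2 / 2) := by
        gcongr
      have h11 : ((A + B) / 2 - T) * (A * B / 2 + T ^ 2 / 2) + B * (T ^ 2 - A * T + A ^ 2 / 2) ≤
          3 / 4 * (A * B * B) := by
        obtain ⟨y, rfl⟩ : ∃ y, B = A + y := ⟨B - A, by ring⟩
        obtain ⟨z, hz⟩ : ∃ z, T = A / 2 + z := ⟨T - A / 2, by ring⟩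
        have hz0 : 0 ≤ z := by linarith
        have hz1 : 0 ≤ A / 2 - z := by linarith
        have hy : 0 ≤ y := by linarith
        rw [hz]
        nlinarith [mul_nonneg hz0 hz1, mul_nonneg hA.le (mul_nonneg hz0 hz1), mul_nonneg hy (mul_nonneg hz0 hz1), mul_nonneg hz0 (mul_nonneg hz0 hz1), mul_nonneg hA.le hy, mul_nonneg hA.le (mul_nonneg hA.le hy),mul_nonneg hA.le (mul_nonneg hy hy), mul_nonneg hy (mul_nonneg hy hz1), mul_nonneg hA.le (mul_nonneg hy hz1), mul_nonneg hA.le (mul_nonneg hA.le hz1)]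
      nlinarith
  nlinarith [mul_nonneg (sub_nonneg.2 hBC) (mul_pos hA hB).le, mul_nonneg (sub_nonneg.2 hBC) (sq_nonneg F), mul_nonneg (sub_nonneg.2 hBC) (sub_nonneg.2 (show F^2 ≤ A*B/4 by nlinarith))]

lemma gram_ordered {A B C d e f : ℝ} (hA : 0 < A) (hAB : A ≤ B) (hBC : B ≤ C)
    (hB : ∀ s t : ℤ, 0 ≤ s ^ 2 * A + t ^ 2 * C + 2 * s * f + 2 * t * d + 2 * s * t * e)
    (hC : ∀ s t : ℤ, 0 ≤ s ^ 2 * A + t ^ 2 * B + 2 * s * e + 2 * t * d + 2 * s * t * f)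
    (hdet : A * B * C + 2 * d * e * f - A * d ^ 2 - B * e ^ 2 - C * f ^ 2 = 1) :
    A * B * C ≤ 4 := by
  have hf1 := hB 1 0
  have hf2 := hB (-1) 0
  have he1 := hC 1 0
  have he2 := hC (-1) 0
  have hd1 := hC 0 1
  have hd2 := hC 0 (-1)
  have h1 := hC 1 1
  have h2 := hC 1 (-1)
  have h3 := hC (-1) 1
  have h4 := hC (-1) (-1)
  push_cast at *
  have key : A * d ^ 2 + B * e ^ 2 + C * f ^ 2 - 2 * d * e * f ≤ 3 / 4 * (A * B * C) := by
    have hde : |d| * |e| * |f| = |d * e * f| := by rw [abs_mul, abs_mul]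
    by_cases hs : 0 ≤ d * e * f
    · have g1 : f ^ 2 ≤ A * A / 4 := by nlinarith
      have g2 : e ^ 2 ≤ A * A / 4 := by nlinarith
      have g3 : d ^ 2 ≤ B * B / 4 := by nlinarith
      have hB0 : 0 < B := hA.trans_le hAB
      have hC0 : 0 < C := hB0.trans_le hBC
      have k1 : C * f ^ 2 ≤ C * (A * B / 4) := by gcongr; nlinarith
      have k2 : B * e ^ 2 ≤ B * (A * C / 4) := by gcongr; nlinarith
      have k3 : A * d ^ 2 ≤ A * (B * C / 4) := by gcongr; nlinarith
      nlinarith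
    · push Not at hs
      have := gram_aux (D := |d|) (E := |e|) (F := |f|) hA hAB hBC (abs_nonneg _) (abs_nonneg _)
        (abs_nonneg _) (by cases abs_cases d <;> linarith) (by cases abs_cases e <;> linarith)
        (by cases abs_cases f <;> linarith) (by
          rcases abs_cases d with ⟨h5, h6⟩ | ⟨h5, h6⟩ <;> rcases abs_cases e with ⟨h7, h8⟩ | ⟨h7, h8⟩ <;>
          rcases abs_cases f with ⟨h9, h10⟩ | ⟨h9, h10⟩ <;> rw [h5, h7, h9]
          · exact absurd (mul_nonneg (mul_nonneg h6 h8) h10) hs.not_ge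
          · linarith
          · linarith
          · exact absurd (mul_nonneg_of_nonpos_of_nonpos
              (mul_nonpos_of_nonneg_of_nonpos h6 h8.le) h10.le) hs.not_ge
          · linarith
          · exact absurd (mul_nonneg_of_nonpos_of_nonpos
              (mul_nonpos_of_nonpos_of_nonneg h6.le h8) h10.le) hs.not_ge
          · exact absurd (mul_nonneg (mul_nonneg_of_nonpos_of_nonpos h6.le h8.le) h10) hs.not_ge
          · linarith)
      have habs : |d| * |e| * |f| = -(d * e * f) := by rw [hde, abs_of_neg hs]
      simp only [sq_abs] at this
      linarith
  linarith

lemma gram_le_four {A B C d e f : ℝ} (hA : 0 < A) (hB : 0 < B) (hC : 0 < C)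
    (h1 : ∀ s t : ℤ, 0 ≤ s ^ 2 * B + t ^ 2 * C + 2 * s * f + 2 * t * e + 2 * s * t * d)
    (h2 : ∀ s t : ℤ, 0 ≤ s ^ 2 * A + t ^ 2 * C + 2 * s * f + 2 * t * d + 2 * s * t * e)
    (h3 : ∀ s t : ℤ, 0 ≤ s ^ 2 * A + t ^ 2 * B + 2 * s * e + 2 * t * d + 2 * s * t * f)
    (hdet : A * B * C + 2 * d * e * f - A * d ^ 2 - B * e ^ 2 - C * f ^ 2 = 1) :
    A * B * C ≤ 4 := by
  rcases le_total A B with hAB | hAB <;> rcases le_total B C with hBC | hBC <;>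
    rcases le_total A C with hAC | hAC
  · exact gram_ordered hA hAB hBC h2 h3 hdet
  · exact gram_ordered hA hAB hBC h2 h3 hdet
  · linarith [gram_ordered (d := d) (e := f) (f := e) hA hAC hBC h3 h2 (by linarith)]
  · linarith [gram_ordered (d := f) (e := d) (f := e) hC hAC hAB
      (fun s t => by linarith [h1 t s]) (fun s t => by linarith [h2 t s]) (by linarith)]
  · linarith [gram_ordered (d := e) (e := d) (f := f) hB hAB hAC
      (fun s t => by linarith [h1 s t]) (fun s t => by linarith [h3 t s]) (by linarith)]
  · linarith [gram_ordered (d := e) (e := f) (f := d) hB hBC hAC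
      (fun s t => by linarith [h3 t s]) (fun s t => by linarith [h1 s t]) (by linarith)]
  · linarith [gram_ordered (d := f) (e := e) (f := d) hC hBC hAB
      (fun s t => by linarith [h2 t s]) (fun s t => by linarith [h1 t s]) (by linarith)]
  · linarith [gram_ordered (d := f) (e := e) (f := d) hC hBC hAB
      (fun s t => by linarith [h2 t s]) (fun s t => by linarith [h1 t s]) (by linarith)]

end Reduction

abbrev SL3R : Type := Matrix.SpecialLinearGroup (Fin 3) ℝ

/-- The integral matrices in `SL₃(ℝ)`. -/
def SL3Z : Subgroup SL3R := (Matrix.SpecialLinearGroup.map (n := Fin 3) (Int.castRingHom ℝ)).range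

/-- The space of unimodular lattices in `ℝ³`. -/
abbrev LatticeSpace : Type := SL3R ⧸ SL3Z

namespace LatticeSpace

lemma isClosedEmbedding_val : Topology.IsClosedEmbedding (Subtype.val : SL3R → Matrix (Fin 3) (Fin 3) ℝ) :=
  Matrix.SpecialLinearGroup.isClosedEmbedding_val

instance : LocallyCompactSpace SL3R :=
  haveI : LocallyCompactSpace (Matrix (Fin 3) (Fin 3) ℝ) :=
    inferInstanceAs (LocallyCompactSpace (Fin 3 → Fin 3 → ℝ))
  isClosedEmbedding_val.locallyCompactSpace

instance : SecondCountableTopology SL3R :=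
  haveI : SecondCountableTopology (Matrix (Fin 3) (Fin 3) ℝ) :=
    inferInstanceAs (SecondCountableTopology (Fin 3 → Fin 3 → ℝ))
  isClosedEmbedding_val.isEmbedding.secondCountableTopology

instance : IsClosed (SL3Z : Set SL3R) := by
  have h : Topology.IsClosedEmbedding (Int.castRingHom ℝ) := Int.isClosedEmbedding_coe_real
  simpa [SL3Z] using (h.specialLinearGroup_map (n := Fin 3)).isClosed_range

instance : LocallyCompactSpace LatticeSpace := inferInstance
instance : SecondCountableTopology LatticeSpace := inferInstance
instance : T2Space LatticeSpace := inferInstance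
instance : MeasurableSpace LatticeSpace := borel _
instance : BorelSpace LatticeSpace := ⟨rfl⟩

/-- The vectors of a lattice. -/
def vecs (x : LatticeSpace) : Set (Fin 3 → ℝ) :=
  {w | ∃ (g : SL3R) (m : Fin 3 → ℤ), (g : LatticeSpace) = x ∧ w = g.1.mulVec fun i => (m i : ℝ)}

lemma mulVec_intCast (A : Matrix (Fin 3) (Fin 3) ℤ) (m : Fin 3 → ℤ) :
    (A.map (Int.castRingHom ℝ)).mulVec (fun i => (m i : ℝ)) = fun i => ((A.mulVec m) i : ℝ) := by
  ext i
  simp [Matrix.mulVec, dotProduct]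

lemma mem_vecs_mk {g : SL3R} {w : Fin 3 → ℝ} :
    w ∈ vecs (g : LatticeSpace) ↔ ∃ m : Fin 3 → ℤ, w = g.1.mulVec fun i => (m i : ℝ) := by
  constructor
  · rintro ⟨g', m, hg, rfl⟩
    obtain ⟨γ, hγ⟩ := QuotientGroup.eq.1 hg.symm
    have hg' : g' = g * Matrix.SpecialLinearGroup.map (Int.castRingHom ℝ) γ := by
      rw [hγ, mul_inv_cancel_left]
    refine ⟨γ.1.mulVec m, ?_⟩
    rw [hg', ← mulVec_intCast, Matrix.mulVec_mulVec]
    rfl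
  · rintro ⟨m, rfl⟩
    exact ⟨g, m, rfl, rfl⟩

/-- The lattices all of whose nonzero vectors have sup norm at least `c`. -/
def thick (c : ℝ) : Set LatticeSpace := {x | ∀ w ∈ vecs x, w ≠ 0 → c ≤ ‖w‖}

lemma mulVec_eq_zero_iff (g : SL3R) (w : Fin 3 → ℝ) : g.1.mulVec w = 0 ↔ w = 0 := by
  constructor
  · intro h
    have : (g⁻¹).1.mulVec (g.1.mulVec w) = w := by
      rw [Matrix.mulVec_mulVec]
      have h1 : (g⁻¹).1 * g.1 = 1 := by
        have := inv_mul_cancel g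
        exact congrArg Subtype.val this
      rw [h1, Matrix.one_mulVec]
    rw [← this, h, Matrix.mulVec_zero]
  · rintro rfl; exact Matrix.mulVec_zero _

lemma mk_mem_thick {g : SL3R} {c : ℝ} : (g : LatticeSpace) ∈ thick c ↔
    ∀ m : Fin 3 → ℤ, m ≠ 0 → c ≤ ‖g.1.mulVec fun i => (m i : ℝ)‖ := by
  have hm : ∀ m : Fin 3 → ℤ, (fun i => (m i : ℝ)) = 0 ↔ m = 0 := fun m => by
    simp [funext_iff]
  constructor
  · intro h m hm0
    exact h _ (mem_vecs_mk.2 ⟨m, rfl⟩) fun h0 => hm0 ((hm m).1 ((mulVec_eq_zero_iff g _).1 h0))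
  · intro h w hw hw0
    obtain ⟨m, rfl⟩ := mem_vecs_mk.1 hw
    exact h m fun h0 => hw0 ((mulVec_eq_zero_iff g _).2 ((hm m).2 h0))

lemma continuous_mulVec : Continuous fun p : SL3R × (Fin 3 → ℝ) => p.1.1.mulVec p.2 :=
  Continuous.matrix_mulVec (continuous_subtype_val.comp continuous_fst) continuous_snd

lemma isClosed_thick (c : ℝ) : IsClosed (thick c) := by
  rw [← (QuotientGroup.isQuotientMap_mk SL3Z).isClosed_preimage]
  have : ((↑) : SL3R → LatticeSpace) ⁻¹' thick c =
      ⋂ (m : Fin 3 → ℤ) (_ : m ≠ 0), {g | c ≤ ‖g.1.mulVec fun i => (m i : ℝ)‖} := by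
    ext g
    simp only [Set.mem_preimage, mk_mem_thick, Set.mem_iInter, Set.mem_ofPred_eq]
  rw [this]
  refine isClosed_iInter fun m => isClosed_iInter fun _ => isClosed_le continuous_const ?_
  exact (continuous_mulVec.comp (continuous_id.prodMk continuous_const)).norm

lemma exists_norm_mulVec_le (A : Matrix (Fin 3) (Fin 3) ℝ) :
    ∃ C > 0, ∀ w, ‖A.mulVec w‖ ≤ C * ‖w‖ := by
  obtain ⟨C, hC, h⟩ := (LinearMap.toContinuousLinearMap A.mulVecLin).bound
  exact ⟨C, hC, h⟩

lemma one_le_norm_intCast {m : Fin 3 → ℤ} (hm : m ≠ 0) : 1 ≤ ‖fun i => (m i : ℝ)‖ := by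
  obtain ⟨i, hi⟩ := Function.ne_iff.1 hm
  refine le_trans ?_ (norm_le_pi_norm (fun i => (m i : ℝ)) i)
  rw [Real.norm_eq_abs, ← Int.cast_abs]
  exact_mod_cast Int.one_le_abs hi

lemma exists_mem_thick (x : LatticeSpace) : ∃ c > 0, x ∈ thick c := by
  obtain ⟨g, rfl⟩ := QuotientGroup.mk_surjective x
  obtain ⟨C, hC, h⟩ := exists_norm_mulVec_le (g⁻¹).1
  refine ⟨C⁻¹, inv_pos.2 hC, mk_mem_thick.2 fun m hm => ?_⟩
  have h1 := h (g.1.mulVec fun i => (m i : ℝ))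
  rw [Matrix.mulVec_mulVec, show (g⁻¹).1 * g.1 = 1 from
    congrArg Subtype.val (inv_mul_cancel g), Matrix.one_mulVec] at h1
  rw [inv_le_iff_one_le_mul₀ hC, mul_comm]
  exact (one_le_norm_intCast hm).trans h1

lemma thick_anti {c c' : ℝ} (h : c ≤ c') : thick c' ⊆ thick c :=
  fun _ hx w hw hw0 => h.trans (hx w hw hw0)

/-- The sum of the squares of the entries of a matrix. -/
def sqSum (M : Matrix (Fin 3) (Fin 3) ℝ) : ℝ := ∑ i, ∑ j, M i j ^ 2

lemma finite_setOf_sqSum_le (g : SL3R) (M : ℝ) :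
    {γ : Matrix.SpecialLinearGroup (Fin 3) ℤ |
      sqSum (g * Matrix.SpecialLinearGroup.map (Int.castRingHom ℝ) γ).1 ≤ M}.Finite := by
  obtain ⟨C, hC, h⟩ := exists_norm_mulVec_le (g⁻¹).1
  set B : ℤ := ⌈C * √M⌉ with hB
  have hfin : {A : Matrix (Fin 3) (Fin 3) ℤ | ∀ i j, A i j ∈ Set.Icc (-B) B}.Finite := by
    have := Set.Finite.pi' (ι := Fin 3) (κ := fun _ => Fin 3 → ℤ)
      (t := fun _ => {v | ∀ j, v j ∈ Set.Icc (-B) B})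
      fun _ => Set.Finite.pi' (t := fun _ => Set.Icc (-B) B) fun _ => Set.finite_Icc _ _
    exact this
  refine (hfin.preimage (f := Subtype.val) Subtype.val_injective.injOn).subset ?_
  intro γ hγ i j
  set N := (g * Matrix.SpecialLinearGroup.map (Int.castRingHom ℝ) γ).1 with hN
  have hcol : ‖fun i => N i j‖ ≤ √M := by
    rw [pi_norm_le_iff_of_nonneg (Real.sqrt_nonneg _)]
    intro k
    rw [Real.norm_eq_abs]
    refine Real.abs_le_sqrt (le_trans ?_ (hγ : sqSum N ≤ M))
    refine le_trans ?_ (Finset.single_le_sum (f := fun i => ∑ j, N i j ^ 2)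
      (fun i _ => Finset.sum_nonneg fun j _ => sq_nonneg _) (Finset.mem_univ k))
    exact Finset.single_le_sum (f := fun j => N k j ^ 2) (fun j _ => sq_nonneg _)
      (Finset.mem_univ j)
  have h1 := h (fun i => N i j)
  have h2 : (g⁻¹).1.mulVec (fun i => N i j) = fun i => (γ.1 i j : ℝ) := by
    have h3 : (g⁻¹).1 * N = γ.1.map (Int.castRingHom ℝ) := by
      have := congrArg Subtype.val (inv_mul_cancel_left g
        (Matrix.SpecialLinearGroup.map (Int.castRingHom ℝ) γ))
      exact this
    ext i
    have := congrFun (congrFun h3 i) j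
    simpa [Matrix.mul_apply, Matrix.mulVec, dotProduct] using this
  rw [h2] at h1
  have h4 : |(γ.1 i j : ℝ)| ≤ C * √M :=
    (norm_le_pi_norm (fun i => (γ.1 i j : ℝ)) i).trans (h1.trans (by gcongr))
  have h5 : |γ.1 i j| ≤ B := by
    have : (|γ.1 i j| : ℤ) ≤ (B : ℝ) := by push_cast; exact h4.trans (Int.le_ceil _)
    exact_mod_cast this
  exact abs_le.1 h5

lemma exists_minimal_sqSum (g : SL3R) : ∃ g' : SL3R, (g' : LatticeSpace) = g ∧
    ∀ γ : Matrix.SpecialLinearGroup (Fin 3) ℤ,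
      sqSum g'.1 ≤ sqSum (g' * Matrix.SpecialLinearGroup.map (Int.castRingHom ℝ) γ).1 := by
  have ht : Tendsto (fun γ : Matrix.SpecialLinearGroup (Fin 3) ℤ =>
      sqSum (g * Matrix.SpecialLinearGroup.map (Int.castRingHom ℝ) γ).1) cofinite atTop := by
    refine tendsto_atTop.2 fun M => eventually_cofinite.2 ?_
    exact (finite_setOf_sqSum_le g M).subset fun γ hγ => (not_le.1 hγ).le
  obtain ⟨γ₀, h⟩ := ht.exists_forall_le
  refine ⟨g * Matrix.SpecialLinearGroup.map (Int.castRingHom ℝ) γ₀, ?_, fun γ => ?_⟩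
  · refine QuotientGroup.eq.2 ?_
    rw [mul_inv_rev, inv_mul_cancel_right]
    exact inv_mem ⟨γ₀, rfl⟩
  · rw [mul_assoc, ← map_mul]
    exact h _

lemma abs_entry_le_of_minimal {g : SL3R} {c : ℝ} (hc : 0 < c)
    (hg : (g : LatticeSpace) ∈ thick c)
    (hmin : ∀ γ : Matrix.SpecialLinearGroup (Fin 3) ℤ,
      sqSum g.1 ≤ sqSum (g * Matrix.SpecialLinearGroup.map (Int.castRingHom ℝ) γ).1) (i j) :
    |g.1 i j| ≤ 2 / c ^ 2 := by
  set M := g.1 with hM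
  have hcol : ∀ j, c ^ 2 ≤ M 0 j ^ 2 + M 1 j ^ 2 + M 2 j ^ 2 := by
    intro j
    have h1 := mk_mem_thick.1 hg (Pi.single j 1) (by
      intro h; have := congrFun h j; simp at this)
    have h2 : (g.1.mulVec fun i => (((Pi.single j 1 : Fin 3 → ℤ) i : ℤ) : ℝ)) = fun i => M i j := by
      have : (fun i => (((Pi.single j 1 : Fin 3 → ℤ) i : ℤ) : ℝ)) = Pi.single j 1 := by
        ext i; by_cases h : i = j
        · subst h; simp
        · simp [h]
      rw [this, Matrix.mulVec_single_one]; rfl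
    rw [h2] at h1
    obtain ⟨k, hk⟩ : ∃ k, c ≤ |M k j| := by
      by_contra! hcon
      exact absurd h1 (not_le.2 ((pi_norm_lt_iff hc).2 hcon))
    have h3 : c ^ 2 ≤ M k j ^ 2 := by rw [← sq_abs (M k j)]; gcongr
    fin_cases k
    · have : c ^ 2 ≤ M 0 j ^ 2 := h3
      nlinarith [sq_nonneg (M 1 j), sq_nonneg (M 2 j)]
    · have : c ^ 2 ≤ M 1 j ^ 2 := h3
      nlinarith [sq_nonneg (M 0 j), sq_nonneg (M 2 j)]
    · have : c ^ 2 ≤ M 2 j ^ 2 := h3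
      nlinarith [sq_nonneg (M 0 j), sq_nonneg (M 1 j)]
  have hdet : M.det = 1 := g.2
  rw [Matrix.det_fin_three] at hdet
  have hsq : ∀ T : Matrix (Fin 3) (Fin 3) ℤ, T.det = 1 →
      sqSum M ≤ sqSum (M * T.map (Int.castRingHom ℝ)) := fun T hT => hmin ⟨T, hT⟩
  have hs1 : ∀ s t : ℤ, sqSum M ≤ sqSum (M * (!![1, 0, 0; s, 1, 0; t, 0, 1] :
      Matrix (Fin 3) (Fin 3) ℤ).map (Int.castRingHom ℝ)) :=
    fun s t => hsq _ (by simp [Matrix.det_fin_three])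
  have hs2 : ∀ s t : ℤ, sqSum M ≤ sqSum (M * (!![1, s, 0; 0, 1, 0; 0, t, 1] :
      Matrix (Fin 3) (Fin 3) ℤ).map (Int.castRingHom ℝ)) :=
    fun s t => hsq _ (by simp [Matrix.det_fin_three])
  have hs3 : ∀ s t : ℤ, sqSum M ≤ sqSum (M * (!![1, 0, s; 0, 1, t; 0, 0, 1] :
      Matrix (Fin 3) (Fin 3) ℤ).map (Int.castRingHom ℝ)) :=
    fun s t => hsq _ (by simp [Matrix.det_fin_three])
  simp only [sqSum, Fin.sum_univ_three, Matrix.mul_apply, Matrix.map_apply, Matrix.of_apply,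
    Matrix.cons_val', Matrix.cons_val_zero, Matrix.cons_val_one, Matrix.cons_val,
    Int.coe_castRingHom, Int.cast_one, Int.cast_zero, mul_one, mul_zero, add_zero, zero_add]
    at hs1 hs2 hs3
  have hc2 : 0 < c ^ 2 := by positivity
  have h4 := gram_le_four (A := M 0 0 ^ 2 + M 1 0 ^ 2 + M 2 0 ^ 2)
    (B := M 0 1 ^ 2 + M 1 1 ^ 2 + M 2 1 ^ 2) (C := M 0 2 ^ 2 + M 1 2 ^ 2 + M 2 2 ^ 2)
    (d := M 0 1 * M 0 2 + M 1 1 * M 1 2 + M 2 1 * M 2 2)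
    (e := M 0 0 * M 0 2 + M 1 0 * M 1 2 + M 2 0 * M 2 2)
    (f := M 0 0 * M 0 1 + M 1 0 * M 1 1 + M 2 0 * M 2 1)
    (hc2.trans_le (hcol 0)) (hc2.trans_le (hcol 1)) (hc2.trans_le (hcol 2))
    (fun s t => by linarith [hs1 s t]) (fun s t => by linarith [hs2 s t])
    (fun s t => by linarith [hs3 s t])
    (by
      rw [show (1 : ℝ) = 1 ^ 2 by norm_num]
      nth_rewrite 1 [← hdet]
      ring)
  have hrow : ∀ i, M i j ^ 2 ≤ M 0 j ^ 2 + M 1 j ^ 2 + M 2 j ^ 2 := by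
    intro i
    have h0 := sq_nonneg (M 0 j)
    have h1 := sq_nonneg (M 1 j)
    have h2 := sq_nonneg (M 2 j)
    have : ∀ k : Fin 3, k = 0 ∨ k = 1 ∨ k = 2 := by decide
    rcases this i with rfl | rfl | rfl <;> linarith
  have hA := hcol 0
  have hB := hcol 1
  have hC := hcol 2
  set A := M 0 0 ^ 2 + M 1 0 ^ 2 + M 2 0 ^ 2
  set B := M 0 1 ^ 2 + M 1 1 ^ 2 + M 2 1 ^ 2
  set C := M 0 2 ^ 2 + M 1 2 ^ 2 + M 2 2 ^ 2
  have h5 : ∀ X Y Z : ℝ, c ^ 2 ≤ Y → c ^ 2 ≤ Z → 0 ≤ X → X * Y * Z ≤ 4 →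
      X ≤ (2 / c ^ 2) ^ 2 := by
    intro X Y Z hY hZ hX h
    rw [div_pow, le_div_iff₀ (by positivity)]
    calc X * (c ^ 2) ^ 2 = X * c ^ 2 * c ^ 2 := by ring
      _ ≤ X * Y * Z :=
        mul_le_mul (mul_le_mul_of_nonneg_left hY hX) hZ hc2.le (mul_nonneg hX (hc2.le.trans hY))
      _ ≤ 2 ^ 2 := by linarith
  have hA4 := h5 A B C hB hC (hc2.le.trans hA) h4
  have hB4 := h5 B A C hA hC (hc2.le.trans hB) (by rwa [mul_comm B A])
  have hC4 := h5 C A B hA hB (hc2.le.trans hC) (by rwa [mul_assoc, mul_comm])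
  refine abs_le_of_sq_le_sq (le_trans (hrow i) ?_) (by positivity)
  fin_cases j
  exacts [hA4, hB4, hC4]

/-- Mahler's compactness criterion. -/
theorem isCompact_thick {c : ℝ} (hc : 0 < c) : IsCompact (thick c) := by
  have hK : IsCompact (Subtype.val ⁻¹' (Set.pi Set.univ fun _ : Fin 3 => Set.pi Set.univ
      fun _ : Fin 3 => Set.Icc (-(2 / c ^ 2)) (2 / c ^ 2)) : Set SL3R) :=
    isClosedEmbedding_val.isCompact_preimage
      (isCompact_univ_pi fun _ => isCompact_univ_pi fun _ => isCompact_Icc)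
  refine (hK.image QuotientGroup.continuous_mk).of_isClosed_subset (isClosed_thick c) ?_
  intro x hx
  obtain ⟨g, rfl⟩ := QuotientGroup.mk_surjective x
  obtain ⟨g', hg', hmin⟩ := exists_minimal_sqSum g
  refine ⟨g', fun i _ j _ => ?_, hg'⟩
  exact abs_le.1 (abs_entry_le_of_minimal hc (hg'.symm ▸ hx) hmin i j)

end LatticeSpace

section LimitMeasure

variable {G X : Type*} [Group G] [MulAction G X] [TopologicalSpace X] [ContinuousConstSMul G X]
  [MeasurableSpace X] [BorelSpace X]

/-- The average of the first `n + 1` translates of a measure by the powers of `a`. -/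
noncomputable def avgMeasure (a : G) (μ : Measure X) (n : ℕ) : Measure X :=
  ((n + 1 : ℕ) : ℝ≥0∞)⁻¹ • ∑ k ∈ Finset.range (n + 1), μ.map (a ^ k • ·)

variable (a : G) (μ : Measure X)

lemma avgMeasure_apply (n : ℕ) {s : Set X} (hs : MeasurableSet s) :
    avgMeasure a μ n s =
      ((n + 1 : ℕ) : ℝ≥0∞)⁻¹ * ∑ k ∈ Finset.range (n + 1), μ {x | a ^ k • x ∈ s} := by
  simp only [avgMeasure, Measure.smul_apply, Measure.finsetSum_apply, smul_eq_mul]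
  congr 1
  refine Finset.sum_congr rfl fun k _ => ?_
  rw [Measure.map_apply (continuous_const_smul _).measurable hs]
  rfl

variable [IsProbabilityMeasure μ]

instance (n : ℕ) : IsProbabilityMeasure (avgMeasure a μ n) := by
  constructor
  rw [avgMeasure_apply a μ n MeasurableSet.univ]
  simp only [Set.mem_univ, Set.ofPred_true, measure_univ, Finset.sum_const, Finset.card_range,
    nsmul_eq_mul, mul_one]
  exact ENNReal.inv_mul_cancel (by positivity) (ENNReal.natCast_ne_top _)

lemma integral_avgMeasure (n : ℕ) (f : BoundedContinuousFunction X ℝ) :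
    ∫ x, f x ∂(avgMeasure a μ n) =
      ((n + 1 : ℕ) : ℝ)⁻¹ * ∑ k ∈ Finset.range (n + 1), ∫ x, f (a ^ k • x) ∂μ := by
  have hm : ∀ k : ℕ, Measurable (fun x : X => a ^ k • x) := fun k =>
    (continuous_const_smul _).measurable
  have : ∀ k, IsProbabilityMeasure (μ.map (a ^ k • ·)) := fun k =>
    Measure.isProbabilityMeasure_map (hm k).aemeasurable
  rw [avgMeasure, integral_smul_measure, integral_finsetSum_measure fun k _ => f.integrable _]
  simp only [ENNReal.toReal_inv, ENNReal.toReal_natCast, smul_eq_mul]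
  congr 1
  refine Finset.sum_congr rfl fun k _ => ?_
  rw [integral_map (hm k).aemeasurable f.continuous.measurable.aestronglyMeasurable]

lemma measureReal_avgMeasure (n : ℕ) {s : Set X} (hs : MeasurableSet s) :
    (avgMeasure a μ n).real s =
      ((n + 1 : ℕ) : ℝ)⁻¹ * ∑ k ∈ Finset.range (n + 1), μ.real {x | a ^ k • x ∈ s} := by
  rw [measureReal_def, avgMeasure_apply a μ n hs, ENNReal.toReal_mul,
    ENNReal.toReal_sum fun k _ => measure_ne_top _ _, ENNReal.toReal_inv, ENNReal.toReal_natCast]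
  rfl

variable {a μ}

/-- Limits of averages of translates exist for tight sequences of translates. -/
theorem exists_limit_avgMeasure [T2Space X] [HasOuterApproxClosed X] {g : G} (hag : Commute a g)
    (hg : MeasurePreserving (g • · : X → X) μ μ)
    (htight : ∀ ε : ℝ, 0 < ε → ∃ K : Set X, IsCompact K ∧
      ∀ k : ℕ, μ.real {x | a ^ k • x ∉ K} ≤ ε) :
    ∃ ν : Measure X, IsProbabilityMeasure ν ∧ MeasurePreserving (a • · : X → X) ν ν ∧
      MeasurePreserving (g • · : X → X) ν ν ∧
      ∀ O : Set X, IsOpen O → ∀ c : ℝ, c < ν.real O → ∃ᶠ n in atTop,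
        c < (avgMeasure a μ n).real O := by
  set P : ℕ → ProbabilityMeasure X := fun n => ⟨avgMeasure a μ n, inferInstance⟩ with hP
  have hcpt : IsCompact (closure (Set.range P)) := by
    refine isCompact_closure_of_isTightMeasureSet
      (isTightMeasureSet_iff_exists_isCompact_measure_compl_le.2 fun ε hε => ?_)
    obtain ⟨ε', hε'0, hε'⟩ : ∃ ε' : ℝ, 0 < ε' ∧ ENNReal.ofReal ε' ≤ ε := by
      rcases eq_or_ne ε ⊤ with rfl | h
      · exact ⟨1, one_pos, le_top⟩
      · exact ⟨ε.toReal, ENNReal.toReal_pos hε.ne' h, ENNReal.ofReal_toReal_le⟩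
    obtain ⟨K, hK, h⟩ := htight ε' hε'0
    refine ⟨K, hK, ?_⟩
    rintro _ ⟨_, ⟨n, rfl⟩, rfl⟩
    refine le_trans ?_ hε'
    change avgMeasure a μ n Kᶜ ≤ _
    rw [← ofReal_measureReal]
    refine ENNReal.ofReal_le_ofReal ?_
    rw [measureReal_avgMeasure a μ n hK.measurableSet.compl, inv_mul_le_iff₀ (by positivity)]
    calc _ ≤ ∑ k ∈ Finset.range (n + 1), ε' := Finset.sum_le_sum fun k _ => h k
      _ = _ := by simp
  obtain ⟨ν, -, hν⟩ := hcpt.ultrafilter_le_nhds ((hyperfilter ℕ).map P)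
    (le_principal_iff.2 (Ultrafilter.mem_coe.2 (Ultrafilter.mem_map.2 (by
      have : P ⁻¹' closure (Set.range P) = Set.univ :=
        Set.eq_univ_of_forall fun n => subset_closure ⟨n, rfl⟩
      rw [this]; exact univ_mem))))
  have hlim : Tendsto P (hyperfilter ℕ : Filter ℕ) (𝓝 ν) := hν
  have hint := ProbabilityMeasure.tendsto_iff_forall_integral_tendsto.1 hlim
  have hmeas : ∀ b : G, Measurable (b • · : X → X) := fun b => (continuous_const_smul b).measurable
  have hinv : ∀ b : G, (∀ f : BoundedContinuousFunction X ℝ, Tendsto (fun n =>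
      ∫ x, f (b • x) ∂(avgMeasure a μ n) - ∫ x, f x ∂(avgMeasure a μ n)) atTop (𝓝 0)) →
      MeasurePreserving (b • · : X → X) (ν : Measure X) (ν : Measure X) := by
    intro b hb
    refine ⟨hmeas b, ?_⟩
    have : IsProbabilityMeasure ((ν : Measure X).map (b • ·)) :=
      Measure.isProbabilityMeasure_map (hmeas b).aemeasurable
    refine ext_of_forall_integral_eq_of_IsFiniteMeasure fun f => ?_
    rw [integral_map (hmeas b).aemeasurable f.continuous.measurable.aestronglyMeasurable]
    have h1 := hint (f.compContinuous ⟨(b • ·), continuous_const_smul b⟩)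
    have h2 := (h1.sub (hint f))
    have h3 := tendsto_nhds_unique h2 ((hb f).mono_left Nat.hyperfilter_le_atTop)
    exact sub_eq_zero.1 h3
  refine ⟨ν, inferInstance, hinv a fun f => ?_, hinv g fun f => ?_, fun O hO c hc => ?_⟩
  · have hbd : ∀ n : ℕ, |∫ x, f (a • x) ∂(avgMeasure a μ n) - ∫ x, f x ∂(avgMeasure a μ n)| ≤
        2 * ‖f‖ * (1 / ((n : ℝ) + 1)) := by
      intro n
      have h1 := integral_avgMeasure a μ n (f.compContinuous ⟨(a • ·), continuous_const_smul a⟩)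
      have h2 := integral_avgMeasure a μ n f
      have h3 : ∀ k : ℕ, |∫ x, f (a ^ k • x) ∂μ| ≤ ‖f‖ := fun k => by
        have := norm_integral_le_of_norm_le_const (μ := μ) (f := fun x => f (a ^ k • x))
          (C := ‖f‖) (Eventually.of_forall fun x => f.norm_coe_le_norm _)
        simpa using this
      simp only [BoundedContinuousFunction.compContinuous_apply, ContinuousMap.coe_mk] at h1
      rw [h1, h2, ← mul_sub, ← Finset.sum_sub_distrib]
      have h4 : ∀ k x, a • a ^ k • x = a ^ (k + 1) • (x : X) := fun k x => by
        rw [smul_smul, pow_succ']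
      simp only [h4]
      rw [Finset.sum_range_sub (fun k => ∫ x, f (a ^ k • x) ∂μ), abs_mul, abs_of_pos (by positivity)]
      have := abs_sub (∫ x, f (a ^ (n + 1) • x) ∂μ) (∫ x, f (a ^ 0 • x) ∂μ)
      have := h3 (n + 1)
      have := h3 0
      calc _ ≤ ((n + 1 : ℕ) : ℝ)⁻¹ * (2 * ‖f‖) := by gcongr; linarith
        _ = _ := by push_cast; ring
    refine squeeze_zero_norm hbd ?_
    simpa using (tendsto_one_div_add_atTop_nhds_zero_nat (𝕜 := ℝ)).const_mul (2 * ‖f‖)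
  · have : ∀ n, ∫ x, f (g • x) ∂(avgMeasure a μ n) - ∫ x, f x ∂(avgMeasure a μ n) = 0 := by
      intro n
      have h1 := integral_avgMeasure a μ n (f.compContinuous ⟨(g • ·), continuous_const_smul g⟩)
      simp only [BoundedContinuousFunction.compContinuous_apply, ContinuousMap.coe_mk] at h1
      rw [h1, integral_avgMeasure a μ n f, sub_eq_zero]
      congr 1
      refine Finset.sum_congr rfl fun k _ => ?_
      have h2 : ∀ x : X, g • a ^ k • x = a ^ k • g • x := fun x => by
        rw [smul_smul, smul_smul, (hag.pow_left k).eq]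
      simp only [h2]
      have h3 := integral_map (μ := μ) hg.measurable.aemeasurable
        (f := fun x => f (a ^ k • x))
        (f.continuous.comp (continuous_const_smul _)).measurable.aestronglyMeasurable
      rw [hg.map_eq] at h3
      exact h3.symm
    simp only [this]
    exact tendsto_const_nhds
  · have h1 := ProbabilityMeasure.le_liminf_measure_open_of_tendsto hlim hO
    have h2 : ENNReal.ofReal (max c 0) < liminf (fun i => (P i : Measure X) O) (hyperfilter ℕ) ∨
        c < 0 := by
      rcases lt_or_ge c 0 with h | h
      · exact Or.inr h
      · refine Or.inl (lt_of_lt_of_le ?_ h1)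
        rw [max_eq_left h, ENNReal.ofReal_lt_iff_lt_toReal h (measure_ne_top _ _)]
        exact hc
    rcases h2 with h2 | h2
    · have h3 := eventually_lt_of_lt_liminf h2
      refine Frequently.filter_mono (Eventually.frequently (f := (hyperfilter ℕ : Filter ℕ)) ?_)
        Nat.hyperfilter_le_atTop
      filter_upwards [h3] with n hn
      refine (le_max_left c 0).trans_lt ?_
      rw [measureReal_def]
      exact (ENNReal.ofReal_lt_iff_lt_toReal (le_max_right _ _) (measure_ne_top _ _)).1 hn
    · exact Frequently.of_forall fun n => h2.trans_le measureReal_nonneg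

end LimitMeasure

lemma exists_open_forall_notMem {P X : Type*} [TopologicalSpace P] [TopologicalSpace X] [T2Space X]
    {f : P × X → X} (hf : Continuous f) {C : Set P} {Z : Set X} (hC : IsCompact C)
    (hZ : IsCompact Z) (h : ∀ p ∈ C, ∀ x ∈ Z, f (p, x) ∉ Z) :
    ∃ (N : Set P) (O : Set X), IsOpen N ∧ IsOpen O ∧ C ⊆ N ∧ Z ⊆ O ∧
      ∀ p ∈ N, ∀ x ∈ O, f (p, x) ∉ O := by
  obtain ⟨A, B, hA, hB, hCA, hZB, hAB⟩ := SeparatedNhds.of_isCompact_isCompact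
    ((hC.prod hZ).image hf) hZ (Set.disjoint_left.2 (by
      rintro _ ⟨⟨p, x⟩, ⟨hp, hx⟩, rfl⟩
      exact h p hp x hx))
  obtain ⟨N, O, hN, hO, hCN, hZO, hNO⟩ := generalized_tube_lemma hC hZ (hA.preimage hf)
    (fun z hz => hCA ⟨z, hz, rfl⟩)
  refine ⟨N, O ∩ B, hN, hO.inter hB, hCN, Set.subset_inter hZO hZB, fun p hp x hx hf => ?_⟩
  exact Set.disjoint_left.1 hAB (hNO (Set.mk_mem_prod hp hx.1)) hf.2

lemma HasPair.mono {G X : Type*} [Group G] [MulAction G X] {U : ℝ → G} {s₀ : ℝ} {V W : Set X} (h : HasPair U s₀ V) (hVW : V ⊆ W) :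
    HasPair U s₀ W := by
  obtain ⟨x, hx, s, hs, hxs⟩ := h
  exact ⟨x, hVW hx, s, hs, hVW hxs⟩

lemma exists_isOpen_not_hasPair {G X : Type*} [Group G] [TopologicalSpace G] [MulAction G X]
    [TopologicalSpace X] [ContinuousSMul G X] [T2Space X] {U : ℝ → G} (hUc : Continuous U) {s₀ : ℝ} {Z : Set X} (hZ : IsCompact Z)
    (h : ¬ HasPair U s₀ Z) : ∃ O, IsOpen O ∧ Z ⊆ O ∧ ¬ HasPair U s₀ O := by
  obtain ⟨N, O, -, hO, hN, hZO, hNO⟩ := exists_open_forall_notMem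
    (f := fun p : ℝ × X => U p.1 • p.2) (by fun_prop) (isCompact_Icc (a := s₀) (b := 1)) hZ
    (fun s hs x hx hsx => h ⟨x, hx, s, hs, hsx⟩)
  exact ⟨O, hO, hZO, fun ⟨x, hx, s, hs, hsx⟩ => hNO s (hN hs) x hx hsx⟩

section LimitMeasure

variable {G X : Type*} [Group G] [TopologicalSpace G] [MulAction G X] [TopologicalSpace X]
  [ContinuousSMul G X] [MeasurableSpace X] [BorelSpace X]
  {μ ν : Measure X} [IsProbabilityMeasure μ] [IsProbabilityMeasure ν] {U : ℝ → G}

lemma exists_lt_of_lt_avgMeasure {a : G} {O : Set X} (hO : IsOpen O) {c : ℝ} {n : ℕ}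
    (h : c < (avgMeasure a μ n).real O) : ∃ k : ℕ, c < μ.real {x | a ^ k • x ∈ O} := by
  by_contra! hcon
  rw [measureReal_avgMeasure a μ n hO.measurableSet] at h
  refine absurd h (not_lt.2 ?_)
  rw [inv_mul_le_iff₀ (by positivity)]
  calc _ ≤ ∑ k ∈ Finset.range (n + 1), c := Finset.sum_le_sum fun k _ => hcon k
    _ = _ := by simp

/-- Pairs persist in limits of averages of translates, if the translations can be compensated by
elements preserving the measure. -/
theorem PairProp.of_limit [T2Space X] [ν.InnerRegularCompactLTTop] (hUc : Continuous U) {a h : G}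
    (hah : Commute a h) (hU : ∀ s, Commute (a * h⁻¹) (U s))
    (hh : MeasurePreserving (h • · : X → X) μ μ)
    (hlim : ∀ O : Set X, IsOpen O → ∀ c : ℝ, c < ν.real O → ∃ᶠ n in atTop,
        c < (avgMeasure a μ n).real O) (hμ : PairProp (X := X) U μ) : PairProp (X := X) U ν := by
  intro η hη
  obtain ⟨s₀, hs0, hs1, hpair⟩ := hμ (η / 2) (half_pos hη)
  refine ⟨s₀, hs0, hs1, fun V hV hVη => ?_⟩
  by_contra hno
  obtain ⟨Z, hZV, hZ, hZη⟩ : ∃ Z ⊆ V, IsCompact Z ∧ η / 2 < ν.real Z := by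
    obtain ⟨Z, hZV, hZ, h⟩ := MeasurableSet.exists_lt_isCompact_of_ne_top hV (measure_ne_top ν V)
      (r := ENNReal.ofReal (η / 2)) (by
        rw [ENNReal.ofReal_lt_iff_lt_toReal (by positivity) (measure_ne_top _ _)]
        exact (half_lt_self hη).trans_le hVη)
    exact ⟨Z, hZV, hZ,
      (ENNReal.ofReal_lt_iff_lt_toReal (by positivity) (measure_ne_top _ _)).1 h⟩
  obtain ⟨O, hO, hZO, hnO⟩ := exists_isOpen_not_hasPair hUc hZ fun hp => hno (hp.mono hZV)
  have hOη : η / 2 < ν.real O := hZη.trans_le (measureReal_mono hZO (measure_ne_top _ _))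
  obtain ⟨n, hn⟩ := (hlim O hO _ hOη).exists
  obtain ⟨k, hk⟩ := exists_lt_of_lt_avgMeasure hO hn
  have hpre : {x : X | a ^ k • x ∈ O} =
      (h ^ k • · : X → X) ⁻¹' {x | (a * h⁻¹) ^ k • x ∈ O} := by
    ext x
    simp only [Set.mem_ofPred_eq, Set.mem_preimage, smul_smul]
    rw [(hah.inv_right).mul_pow, inv_pow, inv_mul_cancel_right]
  have hmeas : MeasurableSet {x : X | (a * h⁻¹) ^ k • x ∈ O} :=
    (hO.preimage (continuous_const_smul _)).measurableSet
  have hhk : MeasurePreserving (h ^ k • · : X → X) μ μ := by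
    have := hh.iterate k
    rwa [smul_iterate] at this
  rw [hpre, hhk.measureReal_preimage hmeas.nullMeasurableSet] at hk
  obtain ⟨x, hx, s, hs, hsx⟩ := hpair _ hmeas hk.le
  refine hnO ⟨_, hx, s, hs, ?_⟩
  rw [smul_smul, ← ((hU s).pow_left k).eq, ← smul_smul]
  exact hsx

end LimitMeasure

section Separating

variable {X : Type*} [TopologicalSpace X]

lemma exists_finset_countableBasis [SecondCountableTopology X] {Z O : Set X} (hZ : IsCompact Z)
    (hO : IsOpen O) (hZO : Z ⊆ O) :
    ∃ s : Finset (TopologicalSpace.countableBasis X), Z ⊆ ⋃ u ∈ s, u.1 ∧ ⋃ u ∈ s, u.1 ⊆ O := by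
  classical
  have hB := TopologicalSpace.isBasis_countableBasis X
  obtain ⟨t, ht⟩ := hZ.elim_finite_subcover
    (fun u : {u : TopologicalSpace.countableBasis X // u.1 ⊆ O} => u.1.1)
    (fun u => hB.isOpen u.1.2) (fun x hx => by
      obtain ⟨u, hu, hxu, huO⟩ := hB.exists_subset_of_mem_open (hZO hx) hO
      exact Set.mem_iUnion.2 ⟨⟨⟨u, hu⟩, huO⟩, hxu⟩)
  refine ⟨t.image Subtype.val, fun x hx => ?_, ?_⟩
  · obtain ⟨u, hu, hxu⟩ := Set.mem_iUnion₂.1 (ht hx)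
    exact Set.mem_iUnion₂.2 ⟨u.1, Finset.mem_image_of_mem _ hu, hxu⟩
  · refine Set.iUnion₂_subset fun u hu => ?_
    obtain ⟨v, -, rfl⟩ := Finset.mem_image.1 hu
    exact v.2

/-- Countably many functions of compact support separate compact sets from the complements of
their open neighbourhoods. -/
lemma exists_seq_bump_separating [T2Space X] [LocallyCompactSpace X] [SecondCountableTopology X] :
    ∃ f : ℕ → C(X, ℝ), (∀ i, HasCompactSupport (f i)) ∧ (∀ i x, 0 ≤ f i x ∧ f i x ≤ 1) ∧
      ∀ Z O : Set X, IsCompact Z → IsOpen O → Z ⊆ O → ∃ i, ∃ W, IsOpen W ∧ Z ⊆ W ∧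
        (∀ x ∈ W, f i x = 1) ∧ ∀ x, f i x ≠ 0 → x ∈ O := by
  classical
  let B := TopologicalSpace.countableBasis X
  have hB := TopologicalSpace.isBasis_countableBasis X
  have hop : ∀ s : Finset B, IsOpen (⋃ u ∈ s, u.1) := fun s =>
    isOpen_biUnion fun u _ => hB.isOpen u.2
  have key : ∀ st : Finset B × Finset B, ∃ f : C(X, ℝ), HasCompactSupport f ∧
      (∀ x, 0 ≤ f x ∧ f x ≤ 1) ∧ (IsCompact (closure (⋃ u ∈ st.1, u.1)) →
        closure (⋃ u ∈ st.1, u.1) ⊆ ⋃ u ∈ st.2, u.1 → (∀ x ∈ ⋃ u ∈ st.1, u.1, f x = 1) ∧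
        ∀ x, f x ≠ 0 → x ∈ ⋃ u ∈ st.2, u.1) := by
    rintro ⟨s, t⟩
    by_cases h : IsCompact (closure (⋃ u ∈ s, u.1)) ∧ closure (⋃ u ∈ s, u.1) ⊆ ⋃ u ∈ t, u.1
    · obtain ⟨f, h1, h2, h3, h4⟩ :=
        exists_continuousMap_one_of_isCompact_subset_isOpen h.1 (hop t) h.2
      exact ⟨f, h2, h4, fun _ _ => ⟨fun x hx => h1 (subset_closure hx),
        fun x hx => h3 (subset_tsupport _ hx)⟩⟩
    · exact ⟨0, HasCompactSupport.zero, fun x => by simp, fun h1 h2 => absurd ⟨h1, h2⟩ h⟩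
  choose F hF1 hF2 hF3 using key
  have hcount : Countable B := (TopologicalSpace.countable_countableBasis X).to_subtype
  obtain ⟨e, he⟩ := exists_surjective_nat (Finset B × Finset B)
  refine ⟨fun i => F (e i), fun i => hF1 _, fun i => hF2 _, fun Z O hZ hO hZO => ?_⟩
  obtain ⟨K, hK, hZK, hKO⟩ := exists_compact_between hZ hO hZO
  obtain ⟨s, hs, hsK⟩ := exists_finset_countableBasis hZ isOpen_interior hZK
  have hcl : closure (⋃ u ∈ s, u.1) ⊆ K :=
    closure_minimal (hsK.trans interior_subset) hK.isClosed
  have hcpt := hK.of_isClosed_subset isClosed_closure hcl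
  obtain ⟨t, ht, htO⟩ := exists_finset_countableBasis hcpt hO (hcl.trans hKO)
  obtain ⟨i, hi⟩ := he (s, t)
  refine ⟨i, ⋃ u ∈ s, u.1, hop s, hs, ?_⟩
  have := hF3 (s, t) hcpt ht
  simp only [hi]
  exact ⟨this.1, fun x hx => htO (this.2 x hx)⟩

/-- Functions of compact support are uniformly continuous along one-parameter subgroups. -/
lemma HasCompactSupport.exists_abs_smul_sub_lt {G : Type*} [Group G] [TopologicalSpace G]
    [MulAction G X] [ContinuousSMul G X] {f : X → ℝ} (hf : Continuous f)
    (hfc : HasCompactSupport f) {U : ℝ → G} (hUc : Continuous U)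
    (hU : ∀ s t, U (s + t) = U s * U t) {ε : ℝ} (hε : 0 < ε) :
    ∃ δ > 0, ∀ t, |t| < δ → ∀ x, |f (U t • x) - f x| < ε := by
  have hU0 : U 0 = 1 := by simpa using hU 0 0
  set K : Set X := (fun p : ℝ × X => U p.1 • p.2) '' (Set.Icc (-1) 1 ×ˢ tsupport f) with hK
  have hKc : IsCompact K := (isCompact_Icc.prod hfc).image (by fun_prop)
  have hop : IsOpen {p : ℝ × X | |f (U p.1 • p.2) - f p.2| < ε} :=
    isOpen_lt (by fun_prop) continuous_const
  obtain ⟨N, O, hN, -, h0N, hKO, hNO⟩ := generalized_tube_lemma (isCompact_singleton (x := (0 : ℝ)))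
    hKc hop (by rintro ⟨s, x⟩ ⟨rfl, -⟩; simpa [hU0] using hε)
  obtain ⟨δ, hδ, hδN⟩ := Metric.isOpen_iff.1 hN 0 (h0N rfl)
  refine ⟨min δ 1, lt_min hδ one_pos, fun t ht x => ?_⟩
  by_cases hx : x ∈ K
  · exact hNO (Set.mk_mem_prod (hδN (by simpa using ht.trans_le (min_le_left _ _))) (hKO hx))
  · have ht1 := abs_lt.1 (ht.trans_le (min_le_right _ _))
    have h1 : f x = 0 := by
      by_contra h
      exact hx ⟨(0, x), ⟨by simp, subset_tsupport _ h⟩, by simp [hU0]⟩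
    have h2 : f (U t • x) = 0 := by
      by_contra h
      refine hx ⟨(-t, U t • x), ⟨⟨by linarith, by linarith⟩, subset_tsupport _ h⟩, ?_⟩
      simp only [smul_smul]
      rw [← hU, neg_add_cancel, hU0, one_smul]
    simpa [h1, h2] using hε

end Separating

section Averages

variable {G X : Type*} [Group G] [MulAction G X] {h : G} {f f' : X → ℝ}

lemma tendsto_orbAvg_sub {x y : X}
    (hxy : Tendsto (fun k : ℕ => f (h ^ k • x) - f' (h ^ k • y)) atTop (𝓝 0)) :
    Tendsto (fun n => orbAvg h f n x - orbAvg h f' n y) atTop (𝓝 0) := by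
  refine hxy.cesaro.congr fun n => ?_
  simp only [orbAvg, Finset.sum_sub_distrib]
  ring

lemma abs_orbAvg_le {C : ℝ} (hC : ∀ x, |f x| ≤ C) (n : ℕ) (x : X) : |orbAvg h f n x| ≤ C := by
  have hC0 : 0 ≤ C := (abs_nonneg _).trans (hC x)
  rw [orbAvg, abs_div, Nat.abs_cast]
  refine div_le_of_le_mul₀ (Nat.cast_nonneg _) hC0 ((Finset.abs_sum_le_sum_abs _ _).trans ?_)
  refine (Finset.sum_le_sum fun k _ => hC _).trans ?_
  simp [mul_comm]

lemma tendsto_orbAvg_smul_sub {C : ℝ} (hC : ∀ x, |f x| ≤ C) (x : X) :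
    Tendsto (fun n => orbAvg h f n (h • x) - orbAvg h f n x) atTop (𝓝 0) := by
  have hbd : ∀ n : ℕ, |orbAvg h f n (h • x) - orbAvg h f n x| ≤ 2 * C * (1 / (n : ℝ)) := by
    intro n
    have h1 : ∀ k : ℕ, h ^ k • h • x = h ^ (k + 1) • x := fun k => by rw [smul_smul, pow_succ]
    simp only [orbAvg, h1]
    rw [← sub_div, ← Finset.sum_sub_distrib, Finset.sum_range_sub (fun k => f (h ^ k • x)), abs_div,
      Nat.abs_cast, div_eq_mul_one_div]
    have := abs_sub (f (h ^ n • x)) (f (h ^ 0 • x))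
    have := hC (h ^ n • x)
    have := hC (h ^ 0 • x)
    gcongr
    linarith
  refine squeeze_zero_norm hbd ?_
  simpa using (tendsto_one_div_atTop_nhds_zero_nat (𝕜 := ℝ)).const_mul (2 * C)

lemma Filter.Tendsto.congr_sub {u v : ℕ → ℝ} (huv : Tendsto (fun n => u n - v n) atTop (𝓝 0))
    {N : ℕ → ℕ} (hN : Tendsto N atTop atTop) {l : ℝ} :
    Tendsto (fun j => u (N j)) atTop (𝓝 l) ↔ Tendsto (fun j => v (N j)) atTop (𝓝 l) := by
  have h1 := huv.comp hN
  constructor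
  · intro h
    simpa using h.sub h1
  · intro h
    simpa using h1.add h

/-- The points at which the averages along the sequence `N` have a limit exceeding `r`. -/
def limAvgSet (h : G) (f : X → ℝ) (N : ℕ → ℕ) (r : ℝ) : Set X :=
  {x | ∃ l, r < l ∧ Tendsto (fun j => orbAvg h f (N j) x) atTop (𝓝 l)}

lemma smul_mem_limAvgSet {C : ℝ} (hC : ∀ x, |f x| ≤ C) {N : ℕ → ℕ} (hN : Tendsto N atTop atTop)
    {r : ℝ} {x : X} : h • x ∈ limAvgSet h f N r ↔ x ∈ limAvgSet h f N r := by
  simp only [limAvgSet, Set.mem_ofPred_eq, (tendsto_orbAvg_smul_sub hC x).congr_sub hN]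

variable [MeasurableSpace X] {ν : Measure X}

lemma measurable_orbAvg (hm : Measurable (h • · : X → X)) (hf : Measurable f) (n : ℕ) :
    Measurable (orbAvg h f n) := by
  have hk : ∀ k : ℕ, Measurable (fun x : X => h ^ k • x) := fun k => by
    have := hm.iterate k
    rwa [smul_iterate] at this
  exact (Finset.measurable_sum _ fun k _ => hf.comp (hk k)).div_const _

lemma measurableSet_limAvgSet (hm : Measurable (h • · : X → X)) (hf : Measurable f) (N : ℕ → ℕ)
    (r : ℝ) : MeasurableSet (limAvgSet h f N r) := by
  have h1 : MeasurableSet {x | ∃ l, Tendsto (fun j => orbAvg h f (N j) x) atTop (𝓝 l)} :=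
    MeasureTheory.measurableSet_exists_tendsto fun j => measurable_orbAvg hm hf (N j)
  have h2 : Measurable fun x => limUnder atTop fun j => orbAvg h f (N j) x :=
    (StronglyMeasurable.limUnder fun j =>
      (measurable_orbAvg hm hf (N j)).stronglyMeasurable).measurable
  convert! h1.inter (h2 (measurableSet_Ioi (a := r))) using 1
  ext x
  constructor
  · rintro ⟨l, hl, hl'⟩
    refine ⟨⟨l, hl'⟩, ?_⟩
    change r < limUnder atTop fun j => orbAvg h f (N j) x
    rwa [hl'.limUnder_eq]
  · rintro ⟨⟨l, hl'⟩, hr⟩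
    change r < limUnder atTop fun j => orbAvg h f (N j) x at hr
    rw [hl'.limUnder_eq] at hr
    exact ⟨l, hr, hl'⟩

/-- Integrals over invariant sets can be computed through averages. -/
lemma setIntegral_orbAvg [IsFiniteMeasure ν] (hp : MeasurePreserving (h • · : X → X) ν ν)
    (hf : Measurable f)
    {C : ℝ} (hC : ∀ x, |f x| ≤ C) {A : Set X} (hA : MeasurableSet A)
    (hinv : ∀ x, h • x ∈ A ↔ x ∈ A) {n : ℕ} (hn : n ≠ 0) :
    ∫ x in A, orbAvg h f n x ∂ν = ∫ x in A, f x ∂ν := by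
  have hpA : MeasurePreserving (h • · : X → X) (ν.restrict A) (ν.restrict A) := by
    have := hp.restrict_preimage hA
    rwa [show (h • · : X → X) ⁻¹' A = A from Set.ext hinv] at this
  have hk : ∀ k : ℕ, MeasurePreserving (h ^ k • · : X → X) (ν.restrict A) (ν.restrict A) :=
    fun k => by
      have := hpA.iterate k
      rwa [smul_iterate] at this
  have hint : ∀ k : ℕ, Integrable (fun x => f (h ^ k • x)) (ν.restrict A) := fun k =>
    Integrable.of_bound (hf.comp (hk k).measurable).aestronglyMeasurable C
      (Eventually.of_forall fun x => hC _)
  have heq : ∀ k : ℕ, ∫ x in A, f (h ^ k • x) ∂ν = ∫ x in A, f x ∂ν := fun k => by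
    have := integral_map (hk k).measurable.aemeasurable (f := f)
      (by rw [(hk k).map_eq]; exact hf.aestronglyMeasurable)
    rw [(hk k).map_eq] at this
    exact this.symm
  simp only [orbAvg]
  rw [integral_div, integral_finsetSum _ fun k _ => hint k]
  simp only [heq, Finset.sum_const, Finset.card_range, nsmul_eq_mul]
  field_simp

/-- If averages of `f` converge to limits exceeding `r` on an invariant set `A`, then
`r ν(A) ≤ ∫_A f`. -/
lemma mul_measureReal_le_setIntegral [IsFiniteMeasure ν]
    (hp : MeasurePreserving (h • · : X → X) ν ν) (hf : Measurable f)
    {C : ℝ} (hC : ∀ x, |f x| ≤ C) {A : Set X} (hA : MeasurableSet A)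
    (hinv : ∀ x, h • x ∈ A ↔ x ∈ A) {N : ℕ → ℕ} (hN : Tendsto N atTop atTop) {r : ℝ}
    (hr : ∀ᵐ x ∂ν, x ∈ A → ∃ l, r ≤ l ∧ Tendsto (fun j => orbAvg h f (N j) x) atTop (𝓝 l)) :
    r * ν.real A ≤ ∫ x in A, f x ∂ν := by
  have hr' : ∀ᵐ x ∂ν.restrict A, ∃ l, r ≤ l ∧
      Tendsto (fun j => orbAvg h f (N j) x) atTop (𝓝 l) := (ae_restrict_iff' hA).2 hr
  set φ : X → ℝ := fun x => limUnder atTop fun j => orbAvg h f (N j) x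
  have hφ : ∀ᵐ x ∂ν.restrict A, r ≤ φ x ∧
      Tendsto (fun j => orbAvg h f (N j) x) atTop (𝓝 (φ x)) := by
    filter_upwards [hr'] with x ⟨l, hl, h⟩
    have : φ x = l := h.limUnder_eq
    rw [this]; exact ⟨hl, h⟩
  have hlim : Tendsto (fun j => ∫ x in A, orbAvg h f (N j) x ∂ν) atTop (𝓝 (∫ x in A, φ x ∂ν)) :=
    tendsto_integral_of_dominated_convergence (fun _ => C)
      (fun j => (measurable_orbAvg hp.measurable hf (N j)).aestronglyMeasurable)
      (integrable_const _) (fun j => Eventually.of_forall fun x => abs_orbAvg_le hC _ x)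
      (hφ.mono fun x hx => hx.2)
  have heq : ∫ x in A, φ x ∂ν = ∫ x in A, f x ∂ν := by
    refine tendsto_nhds_unique hlim (tendsto_const_nhds.congr' ?_)
    filter_upwards [hN.eventually_ne_atTop 0] with j hj
    exact (setIntegral_orbAvg hp hf hC hA hinv hj).symm
  rw [← heq]
  have hφm : Measurable φ := (StronglyMeasurable.limUnder fun j =>
      (measurable_orbAvg hp.measurable hf (N j)).stronglyMeasurable).measurable
  have hφi : Integrable φ (ν.restrict A) :=
    Integrable.of_bound hφm.aestronglyMeasurable C (hφ.mono fun x hx =>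
      le_of_tendsto hx.2.norm (Eventually.of_forall fun j => abs_orbAvg_le hC _ x))
  calc r * ν.real A = ∫ x in A, r ∂ν := by simp [mul_comm]
    _ ≤ ∫ x in A, φ x ∂ν :=
      integral_mono_ae (integrable_const _) hφi (hφ.mono fun x hx => hx.1)

end Averages

section Drift

variable {G X : Type*} [Group G] [MulAction G X]

lemma pow_smul_param_smul {b : G} {U : ℝ → G} {d : ℝ} (hbU : ∀ s, b * U s = U (d * s) * b)
    (k : ℕ) (s : ℝ) (x : X) : b ^ k • U s • x = U (d ^ k * s) • b ^ k • x := by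
  rw [smul_smul, pow_mul_param hbU, mul_smul]

variable [TopologicalSpace G] [TopologicalSpace X] [ContinuousSMul G X]

/-- Points on a contracted orbit have the same averages. -/
lemma tendsto_orbAvg_contracted_sub {b : G} {U : ℝ → G} (hUc : Continuous U)
    (hU : ∀ s t, U (s + t) = U s * U t) {d : ℝ} (hd : |d| < 1)
    (hbU : ∀ s, b * U s = U (d * s) * b) {f : X → ℝ} (hf : Continuous f)
    (hfc : HasCompactSupport f) (s : ℝ) (x : X) :
    Tendsto (fun n => orbAvg b f n (U s • x) - orbAvg b f n x) atTop (𝓝 0) := by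
  refine tendsto_orbAvg_sub (Metric.tendsto_atTop.2 fun ε hε => ?_)
  obtain ⟨δ, hδ, H⟩ := hfc.exists_abs_smul_sub_lt hf hUc hU hε
  have h1 : Tendsto (fun k : ℕ => d ^ k * s) atTop (𝓝 0) := by
    simpa using (tendsto_pow_atTop_nhds_zero_of_abs_lt_one hd).mul_const s
  obtain ⟨k₀, hk₀⟩ := Metric.tendsto_atTop.1 h1 δ hδ
  refine ⟨k₀, fun k hk => ?_⟩
  rw [pow_smul_param_smul hbU, Real.dist_eq, sub_zero]
  exact H _ (by simpa [Real.dist_eq] using hk₀ k hk) _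

variable [MeasurableSpace X] [BorelSpace X] {ν : Measure X}

/-- The functions whose support contains no `U`-pair have small averages on a large set. -/
lemma measureReal_iUnion_limAvgSet_le [IsProbabilityMeasure ν] {b : G} {U : ℝ → G}
    (hp : MeasurePreserving (b • · : X → X) ν ν) (hUc : Continuous U)
    (hU : ∀ s t, U (s + t) = U s * U t) {d : ℝ} (hd : |d| < 1)
    (hbU : ∀ s, b⁻¹ * U s = U (d * s) * b⁻¹) {s₀ η : ℝ}
    (hs₀ : ∀ V : Set X, MeasurableSet V → η ≤ ν.real V → HasPair U s₀ V)
    {f : ℕ → C(X, ℝ)} (hfc : ∀ i, HasCompactSupport (f i)) (hf1 : ∀ i x, 0 ≤ f i x ∧ f i x ≤ 1)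
    {N : ℕ → ℕ} (hN : Tendsto N atTop atTop) {X₁ : Set X} (hX₁ : MeasurableSet X₁)
    (hX₁' : ∀ᵐ x ∂ν, x ∈ X₁) (hlim : ∀ x ∈ X₁, ∀ i, ∃ l,
      Tendsto (fun j => orbAvg b (f i) (N j) x) atTop (𝓝 l) ∧
      Tendsto (fun j => orbAvg b⁻¹ (f i) (N j) x) atTop (𝓝 l))
    {I : Set ℕ} (hI : ∀ i ∈ I, ¬ HasPair U s₀ {x | f i x ≠ 0}) :
    ν.real (⋃ i ∈ I, limAvgSet b (f i) N (1 / 4)) ≤ 4 * η := by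
  classical
  have hb : ∀ i x, |f i x| ≤ 1 := fun i x => abs_le.2 ⟨by linarith [hf1 i x], (hf1 i x).2⟩
  set C : ℕ → Set X := fun i => ⋃ _ : i ∈ I, limAvgSet b (f i) N (1 / 4) with hC
  have hmemC : ∀ {i x}, x ∈ C i ↔ i ∈ I ∧ x ∈ limAvgSet b (f i) N (1 / 4) := by simp [hC]
  have hmemD : ∀ {i x}, x ∈ disjointed C i ↔ x ∈ C i ∧ ∀ j < i, x ∉ C j := by
    intro i x
    rw [disjointed_eq_inter_compl]
    simp
  have hCm : ∀ i, MeasurableSet (C i) := fun i =>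
    MeasurableSet.iUnion fun _ => measurableSet_limAvgSet hp.measurable (f i).continuous.measurable _ _
  have hDm : ∀ i, MeasurableSet (disjointed C i) := fun i => .disjointed hCm i
  have hDinv : ∀ i x, b • x ∈ disjointed C i ↔ x ∈ disjointed C i := by
    intro i x
    simp only [hmemD, hmemC, smul_mem_limAvgSet (hb _) hN]
  have hUinv : ∀ s x, x ∈ X₁ → U s • x ∈ X₁ → ∀ i, U s • x ∈ C i ↔ x ∈ C i := by
    intro s x hx hy i
    rw [hmemC, hmemC]
    refine and_congr_right fun _ => ?_
    obtain ⟨l, hl, hl'⟩ := hlim x hx i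
    obtain ⟨m, hm, hm'⟩ := hlim _ hy i
    have h1 := ((tendsto_orbAvg_contracted_sub hUc hU hd hbU (f i).continuous (hfc i) s
      x).congr_sub hN).1 hm'
    have h2 : m = l := tendsto_nhds_unique h1 hl'
    subst h2
    constructor
    · rintro ⟨r, hr, h⟩
      exact ⟨m, by rwa [tendsto_nhds_unique hm h], hl⟩
    · rintro ⟨r, hr, h⟩
      exact ⟨m, by rwa [tendsto_nhds_unique hl h], hm⟩
  set E : ℕ → Set X := fun i => disjointed C i ∩ {x | f i x ≠ 0} with hE
  have hS : ∀ i, MeasurableSet {x | f i x ≠ 0} := fun i =>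
    (f i).continuous.measurable (measurableSet_singleton 0).compl
  have hEm : ∀ i, MeasurableSet (E i) := fun i => (hDm i).inter (hS i)
  have hnp : ¬ HasPair U s₀ (X₁ ∩ ⋃ i, E i) := by
    rintro ⟨x, ⟨hx, hxE⟩, s, hs, hy, hyE⟩
    obtain ⟨i, hi⟩ := Set.mem_iUnion.1 hxE
    obtain ⟨j, hj⟩ := Set.mem_iUnion.1 hyE
    have hj' : x ∈ disjointed C j := by
      have := hmemD.1 hj.1
      simp only [hUinv s x hx hy] at this
      exact hmemD.2 this
    have hij : i = j := by
      by_contra hne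
      exact Set.disjoint_left.1 (disjoint_disjointed C hne) hi.1 hj'
    subst hij
    exact hI i (hmemC.1 (hmemD.1 hi.1).1).1 ⟨x, hi.2, s, hs, hj.2⟩
  have hV : ν.real (⋃ i, E i) < η := by
    have h1 : ν.real (X₁ ∩ ⋃ i, E i) = ν.real (⋃ i, E i) := by
      refine measureReal_congr ?_
      filter_upwards [hX₁'] with x hx
      exact propext ⟨fun h => h.2, fun h => ⟨hx, h⟩⟩
    rw [← h1]
    by_contra! h2
    exact hnp (hs₀ _ (hX₁.inter (.iUnion hEm)) h2)
  have hDE : ∀ i, ν (disjointed C i) ≤ 4 * ν (E i) := by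
    intro i
    have h1 := mul_measureReal_le_setIntegral (r := 1 / 4) hp (f i).continuous.measurable (hb i)
      (hDm i) (hDinv i) hN (Eventually.of_forall fun x hx => by
        obtain ⟨l, hl, h⟩ := (hmemC.1 (hmemD.1 hx).1).2
        exact ⟨l, hl.le, h⟩)
    have h2 : ∫ x in disjointed C i, f i x ∂ν ≤ ν.real (E i) := by
      have h3 : ∫ x in disjointed C i, f i x ∂ν ≤
          ∫ x in disjointed C i, Set.indicator {x | f i x ≠ 0} (fun _ => (1 : ℝ)) x ∂ν := by
        refine integral_mono ?_ ?_ fun x => ?_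
        · exact Integrable.of_bound (f i).continuous.aestronglyMeasurable 1
            (Eventually.of_forall (hb i))
        · exact (integrable_const _).indicator (hS i)
        · by_cases hx : f i x = 0
          · simp [hx]
          · rw [Set.indicator_of_mem (by exact hx)]
            exact (hf1 i x).2
      refine h3.trans_eq ?_
      rw [integral_indicator_const _ (hS i), smul_eq_mul, mul_one,
        measureReal_restrict_apply (hS i), Set.inter_comm]
    have h4 : ν.real (disjointed C i) ≤ 4 * ν.real (E i) := by linarith
    rw [← ENNReal.toReal_le_toReal (measure_ne_top _ _) (by finiteness), ENNReal.toReal_mul]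
    exact h4
  have hsum : ν (⋃ i, disjointed C i) ≤ 4 * ν (⋃ i, E i) := by
    rw [measure_iUnion (disjoint_disjointed C) hDm, measure_iUnion (fun i j hij =>
      (disjoint_disjointed C hij).mono Set.inter_subset_left Set.inter_subset_left) hEm,
      ← ENNReal.tsum_mul_left]
    exact ENNReal.tsum_le_tsum hDE
  rw [iUnion_disjointed] at hsum
  have h5 : ν.real (⋃ i, C i) ≤ 4 * ν.real (⋃ i, E i) := by
    have := ENNReal.toReal_mono (by finiteness) hsum
    rwa [ENNReal.toReal_mul] at this
  linarith

/-- Away from a small set, a displacement `ℓ' p * ℓ` with `ℓ'` contracted by `b` and `ℓ` commuting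
with `b` produces four points of the form `z`, `ℓ • z`, `U s • z`, `ℓ • U s • z` in `Y`. -/
theorem PairProp.exists_four_points [T2Space X] [LocallyCompactSpace X] [SecondCountableTopology X]
    [IsProbabilityMeasure ν] {b : G} {U ℓ' : ℝ → G}
    (hp : MeasurePreserving (b • · : X → X) ν ν)
    (hp' : MeasurePreserving (b⁻¹ • · : X → X) ν ν)
    (hUc : Continuous U) (hU : ∀ s t, U (s + t) = U s * U t) {d : ℝ} (hd : |d| < 1)
    (hbU : ∀ s, b⁻¹ * U s = U (d * s) * b⁻¹) (hℓc : Continuous ℓ') (hℓ0 : ℓ' 0 = 1)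
    (hbℓ : ∀ p, b * ℓ' p = ℓ' (d * p) * b) (hν : PairProp U ν) {δ : ℝ} (hδ : 0 < δ)
    {Y : Set X} (hY : IsCompact Y) (hYν : ν.real Yᶜ ≤ δ / 16) :
    ∃ Y₂, MeasurableSet Y₂ ∧ ν.real Y₂ᶜ ≤ δ ∧ ∀ x ∈ Y₂, ∀ p ℓ, Commute b ℓ →
      ℓ' p • ℓ • x ∈ Y₂ → ∃ z s, 0 < s ∧ z ∈ Y ∧ ℓ • z ∈ Y ∧ U s • z ∈ Y ∧ ℓ • U s • z ∈ Y := by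
  classical
  obtain ⟨f, hfc, hf1, hfsep⟩ := exists_seq_bump_separating (X := X)
  have hb : ∀ i x, |f i x| ≤ 1 := fun i x => abs_le.2 ⟨by linarith [hf1 i x], (hf1 i x).2⟩
  set χ : X → ℝ := Yᶜ.indicator fun _ => 1 with hχ
  have hχm : Measurable χ := measurable_const.indicator hY.measurableSet.compl
  have hχb : ∀ x, |χ x| ≤ 1 := fun x => by
    by_cases hx : x ∈ Y <;> simp [hχ, hx]
  set F : ℕ → X → ℝ := fun i => Nat.casesOn i χ fun i => f i with hF
  obtain ⟨N, hN, hae⟩ := exists_seq_ae_tendsto_orbAvg b hp hp' F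
    (fun i => by cases i; exacts [hχm, (f _).continuous.measurable])
    (fun i => by cases i; exacts [⟨1, hχb⟩, ⟨1, hb _⟩])
  obtain ⟨T, hTsub, hTm, hT0⟩ := exists_measurable_superset_of_null (ae_iff.1 hae)
  have hX₁ : ∀ x ∈ Tᶜ, ∀ i, ∃ l, Tendsto (fun j => orbAvg b (F i) (N j) x) atTop (𝓝 l) ∧
      Tendsto (fun j => orbAvg b⁻¹ (F i) (N j) x) atTop (𝓝 l) := fun x hx => by
    by_contra h
    exact hx (hTsub h)
  have hX₁' : ∀ᵐ x ∂ν, x ∈ Tᶜ := by rw [ae_iff]; simpa using hT0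
  obtain ⟨s₀, hs₀, -, hpair⟩ := hν (δ / 8) (by positivity)
  set I : Set ℕ := {i | ¬ HasPair U s₀ {x | f i x ≠ 0}} with hI
  have hC := measureReal_iUnion_limAvgSet_le hp hUc hU hd hbU hpair hfc hf1 hN hTm.compl hX₁'
    (fun x hx i => hX₁ x hx (i + 1)) (I := I) (fun i hi => hi)
  set C : Set X := ⋃ i ∈ I, limAvgSet b (f i) N (1 / 4) with hCdef
  have hCm : MeasurableSet C := .iUnion fun i => .iUnion fun _ =>
    measurableSet_limAvgSet hp.measurable (f i).continuous.measurable _ _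
  set B : Set X := limAvgSet b χ N (1 / 8) with hB
  have hBm : MeasurableSet B := measurableSet_limAvgSet hp.measurable hχm _ _
  have hBν : ν.real B ≤ δ / 2 := by
    have h1 := mul_measureReal_le_setIntegral (r := 1 / 8) hp hχm hχb hBm
      (fun x => smul_mem_limAvgSet hχb hN) hN (Eventually.of_forall fun x hx => by
        obtain ⟨l, hl, h⟩ := hx
        exact ⟨l, hl.le, h⟩)
    rw [hχ, integral_indicator_const _ hY.measurableSet.compl, smul_eq_mul, mul_one] at h1
    have h2 : (ν.restrict B).real Yᶜ ≤ ν.real Yᶜ := by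
      rw [measureReal_restrict_apply hY.measurableSet.compl]
      exact measureReal_mono Set.inter_subset_left (measure_ne_top _ _)
    linarith
  refine ⟨(T ∪ B ∪ C)ᶜ, ((hTm.union hBm).union hCm).compl, ?_, ?_⟩
  · rw [compl_compl]
    have h1 := measureReal_union_le (μ := ν) (T ∪ B) C
    have h2 := measureReal_union_le (μ := ν) T B
    have h3 : ν.real T = 0 := by simp [measureReal_def, hT0]
    linarith
  · intro x hx p ℓ hbℓ' hx'
    simp only [Set.mem_compl_iff, Set.mem_union, not_or] at hx hx'
    by_contra hcon
    set Z : Set X := Y ∩ (ℓ • ·) ⁻¹' Y with hZdef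
    have hZ : IsCompact Z := hY.inter_right (hY.isClosed.preimage (continuous_const_smul ℓ))
    have hZnp : ¬ HasPair U s₀ Z := by
      rintro ⟨z, hz, s, hs, hsz⟩
      exact hcon ⟨z, s, hs₀.trans_le hs.1, hz.1, hz.2, hsz.1, hsz.2⟩
    obtain ⟨O, hO, hZO, hOnp⟩ := exists_isOpen_not_hasPair hUc hZ hZnp
    obtain ⟨i, W, hW, hZW, hfW, hfO⟩ := hfsep Z O hZ hO hZO
    have hiI : i ∈ I := fun h => hOnp (HasPair.mono h hfO)
    have hop : IsOpen {q : ℝ × X | q.2 ∈ W ∨ ℓ' q.1 • ℓ • q.2 ∉ Y} :=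
      (hW.preimage continuous_snd).union (hY.isClosed.isOpen_compl.preimage (by fun_prop))
    obtain ⟨M, O', hM, -, h0M, hYO', hMO'⟩ := generalized_tube_lemma
      (isCompact_singleton (x := (0 : ℝ))) hY hop (by
        rintro ⟨s, y⟩ ⟨rfl, hy⟩
        by_cases h : ℓ • y ∈ Y
        · exact Or.inl (hZW ⟨hy, h⟩)
        · exact Or.inr (by simpa [hℓ0] using h))
    have hpk : Tendsto (fun k : ℕ => d ^ k * p) atTop (𝓝 0) := by
      simpa using (tendsto_pow_atTop_nhds_zero_of_abs_lt_one hd).mul_const p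
    set x' := ℓ' p • ℓ • x with hx'def
    have hev : ∀ᶠ k : ℕ in atTop, 0 ≤ f i (b ^ k • x) - 1 + χ (b ^ k • x) + χ (b ^ k • x') := by
      filter_upwards [hpk (hM.mem_nhds (h0M rfl))] with k hk
      have hx'k : b ^ k • x' = ℓ' (d ^ k * p) • ℓ • b ^ k • x := by
        rw [hx'def, pow_smul_param_smul hbℓ, smul_smul (b ^ k), (hbℓ'.pow_left k).eq, mul_smul]
      have h01 := hf1 i (b ^ k • x)
      have hχ0 : ∀ y, 0 ≤ χ y := fun y => Set.indicator_nonneg (fun _ _ => zero_le_one) y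
      by_cases h1 : b ^ k • x ∈ Y
      · by_cases h2 : b ^ k • x' ∈ Y
        · have h3 : b ^ k • x ∈ W :=
            (hMO' (Set.mk_mem_prod hk (hYO' h1))).resolve_right (by simpa [← hx'k] using h2)
          rw [hfW _ h3]
          linarith [hχ0 (b ^ k • x), hχ0 (b ^ k • x')]
        · rw [show χ (b ^ k • x') = 1 from Set.indicator_of_mem (by exact h2) _]
          linarith [hχ0 (b ^ k • x)]
      · rw [show χ (b ^ k • x) = 1 from Set.indicator_of_mem (by exact h1) _]
        linarith [hχ0 (b ^ k • x')]
    set g : ℕ → ℝ := fun k => f i (b ^ k • x) - 1 + χ (b ^ k • x) + χ (b ^ k • x') with hg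
    have hces : Tendsto (fun n : ℕ => (n⁻¹ : ℝ) * ∑ k ∈ Finset.range n, min (g k) 0) atTop (𝓝 0) :=
      Tendsto.cesaro (tendsto_const_nhds.congr' (hev.mono fun k hk => (min_eq_right hk).symm))
    obtain ⟨L, hL, -⟩ := hX₁ x hx.1.1 (i + 1)
    obtain ⟨l, hl, -⟩ := hX₁ x hx.1.1 0
    obtain ⟨l', hl', -⟩ := hX₁ x' hx'.1.1 0
    have hle : l ≤ 1 / 8 := by
      by_contra! h
      exact hx.1.2 ⟨l, h, hl⟩
    have hle' : l' ≤ 1 / 8 := by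
      by_contra! h
      exact hx'.1.2 ⟨l', h, hl'⟩
    have hfin : 0 ≤ L - 1 + l + l' := by
      refine le_of_tendsto_of_tendsto (hces.comp hN) (((hL.sub_const 1).add hl).add hl') ?_
      filter_upwards [hN.eventually_ne_atTop 0] with j hj
      have hj' : (N j : ℝ) ≠ 0 := by exact_mod_cast hj
      have h1 : ∑ k ∈ Finset.range (N j), min (g k) 0 ≤ ∑ k ∈ Finset.range (N j), g k :=
        Finset.sum_le_sum fun k _ => min_le_left _ _
      calc (N j : ℝ)⁻¹ * ∑ k ∈ Finset.range (N j), min (g k) 0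
          ≤ (N j : ℝ)⁻¹ * ∑ k ∈ Finset.range (N j), g k := by gcongr
        _ = _ := by
          simp only [hg, orbAvg, hF, Finset.sum_add_distrib, Finset.sum_sub_distrib,
            Finset.sum_const, Finset.card_range, nsmul_eq_mul, mul_one]
          field_simp
          rfl
    exact hx.2 (Set.mem_iUnion₂.2 ⟨i, hiI, L, by linarith, hL⟩)

end Drift

section Agreement

variable {G X : Type*} [Group G] [MulAction G X]

lemma abs_orbAvg_sub_orbAvg_le {h : G} {f f' : X → ℝ} {K : Set X} {ε : ℝ} (hε : 0 ≤ ε)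
    (hK : ∀ y ∈ K, |f y - f' y| ≤ ε) {x : X} (hx : ∀ k : ℕ, h ^ k • x ∈ K) (n : ℕ) :
    |orbAvg h f n x - orbAvg h f' n x| ≤ ε := by
  rw [orbAvg, orbAvg, ← sub_div, ← Finset.sum_sub_distrib, abs_div, Nat.abs_cast]
  refine div_le_of_le_mul₀ (Nat.cast_nonneg _) hε ((Finset.abs_sum_le_sum_abs _ _).trans ?_)
  refine (Finset.sum_le_sum fun k _ => hK _ (hx k)).trans ?_
  simp [mul_comm]

variable [TopologicalSpace X]

/-- The points whose orbit is bounded by one of the sets `K m` and for which forward and backward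
averages of all test functions agree asymptotically. -/
def agreeSet (a : G) (N : ℕ → ℕ) (K : ℕ → Set X) : Set X :=
  {x | (∃ m, ∀ k : ℤ, a ^ k • x ∈ K m) ∧ ∀ f : C(X, ℝ), (∀ y, |f y| ≤ 1) →
    Tendsto (fun j => orbAvg a f (N j) x - orbAvg a⁻¹ f (N j) x) atTop (𝓝 0)}

theorem exists_seq_ae_mem_agreeSet [LocallyCompactSpace X] [SecondCountableTopology X]
    [MeasurableSpace X] [BorelSpace X] {ν : Measure X} [IsProbabilityMeasure ν] {a : G}
    (hp : MeasurePreserving (a • · : X → X) ν ν) (hp' : MeasurePreserving (a⁻¹ • · : X → X) ν ν)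
    {K : ℕ → Set X} (hK : ∀ m, IsCompact (K m))
    (hae : ∀ᵐ x ∂ν, ∃ m, ∀ k : ℤ, a ^ k • x ∈ K m) :
    ∃ N : ℕ → ℕ, Tendsto N atTop atTop ∧ ∀ᵐ x ∂ν, x ∈ agreeSet a N K := by
  set F : ℕ → X → ℝ := fun i x => max (-1) (min 1 (TopologicalSpace.denseSeq C(X, ℝ) i x)) with hF
  have hFc : ∀ i, Continuous (F i) := fun i =>
    continuous_const.max (continuous_const.min (ContinuousMap.continuous _))
  have hFb : ∀ i x, |F i x| ≤ 1 := fun i x => abs_le.2 ⟨le_max_left _ _,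
    max_le (by norm_num) (min_le_left _ _)⟩
  obtain ⟨N, hN, h⟩ := exists_seq_ae_tendsto_orbAvg a hp hp' F (fun i => (hFc i).measurable)
    fun i => ⟨1, hFb i⟩
  refine ⟨N, hN, ?_⟩
  filter_upwards [h, hae] with x hx hxK
  refine ⟨hxK, fun f hf => Metric.tendsto_atTop.2 fun ε hε => ?_⟩
  obtain ⟨m, hm⟩ := hxK
  have hu := (ContinuousMap.tendsto_iff_forall_isCompact_tendstoUniformlyOn.1
    (tendsto_id (x := 𝓝 f))) (K m) (hK m)
  obtain ⟨i, hi⟩ := (TopologicalSpace.denseRange_denseSeq C(X, ℝ)).exists_mem_open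
    (isOpen_interior (s := {g : C(X, ℝ) | ∀ y ∈ K m, |f y - g y| < ε / 4}))
    ⟨f, mem_interior_iff_mem_nhds.2 (by
      have := Metric.tendstoUniformlyOn_iff.1 hu (ε / 4) (by positivity)
      simp only [Real.dist_eq, id] at this
      exact this)⟩
  have hi' : ∀ y ∈ K m, |f y - TopologicalSpace.denseSeq C(X, ℝ) i y| < ε / 4 :=
    interior_subset hi
  have hclose : ∀ y ∈ K m, |f y - F i y| ≤ ε / 4 := by
    intro y hy
    have h1 := abs_lt.1 (hi' y hy)
    have h2 := abs_le.1 (hf y)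
    refine abs_le.2 ⟨?_, ?_⟩
    · have : F i y ≤ f y + ε / 4 :=
        max_le (by linarith) ((min_le_right _ _).trans (by linarith))
      linarith
    · have : f y - ε / 4 ≤ F i y :=
        (le_min (by linarith) (by linarith)).trans (le_max_right _ _)
      linarith
  obtain ⟨l, hl, hl'⟩ := hx i
  have hl0 := hl.sub hl'
  rw [sub_self] at hl0
  obtain ⟨j₀, hj₀⟩ := Metric.tendsto_atTop.1 hl0 (ε / 4) (by positivity)
  refine ⟨j₀, fun j hj => ?_⟩
  have h1 := hj₀ j hj
  have h2 := abs_orbAvg_sub_orbAvg_le (h := a) (x := x) (f := f) (f' := F i) (by positivity) hclose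
    (fun k => by simpa using hm k) (N j)
  have h3 := abs_orbAvg_sub_orbAvg_le (h := a⁻¹) (x := x) (f := f) (f' := F i) (by positivity)
    hclose (fun k => by simpa using hm (-k)) (N j)
  rw [Real.dist_eq, sub_zero] at h1 ⊢
  rw [abs_lt] at h1 ⊢
  rw [abs_le] at h2 h3
  constructor <;> linarith

variable [TopologicalSpace G] [ContinuousSMul G X]

/-- Four points in position `z`, `ℓ z`, `u z`, `ℓ u z`, with `ℓ` contracted by `a`, `u` expanded
and their commutator `c` centralized by `a`, make the averages at `z` invariant under `c`. This is
incompatible with `c` moving points out of every bounded set. -/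
theorem not_four_points_mem_agreeSet [T2Space X] [LocallyCompactSpace X]
    [SecondCountableTopology X] {a c : G} {u ℓ : ℝ → G}
    (huc : Continuous u) (hu : ∀ s t, u (s + t) = u s * u t)
    (hℓc : Continuous ℓ) (hℓ : ∀ s t, ℓ (s + t) = ℓ s * ℓ t) {d : ℝ} (hd : |d| < 1)
    (hau : ∀ s, a⁻¹ * u s = u (d * s) * a⁻¹) (haℓ : ∀ s, a * ℓ s = ℓ (d * s) * a)
    (hac : Commute a c) {q s : ℝ} (hcomm : ℓ q * u s = c * (u s * ℓ q)) {N : ℕ → ℕ}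
    (hN : Tendsto N atTop atTop) {K : ℕ → Set X} (hK : ∀ m, IsCompact (K m))
    (hesc : ∀ m, ∀ x ∈ K m, ∃ i n : ℤ, a ^ i • c ^ n • x ∉ K m) {z : X}
    (hz : z ∈ agreeSet a N K) (hℓz : ℓ q • z ∈ agreeSet a N K) (huz : u s • z ∈ agreeSet a N K)
    (hℓuz : ℓ q • u s • z ∈ agreeSet a N K) : False := by
  classical
  have hcs : ∀ (g : G) {f : C(X, ℝ)}, HasCompactSupport f →
      HasCompactSupport (f.comp ⟨(g • · : X → X), continuous_const_smul g⟩) := fun g f hf =>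
    hf.comp_homeomorph (Homeomorph.smul g)
  let S : Subgroup G :=
    { carrier := {g | ∀ f : C(X, ℝ), HasCompactSupport f → (∀ x, |f x| ≤ 1) →
        Tendsto (fun j => orbAvg a f (N j) z - orbAvg a (fun x => f (g • x)) (N j) z)
          atTop (𝓝 0)}
      one_mem' := fun f _ _ => by simp
      mul_mem' := by
        intro g g' hg hg' f hf hf1
        have h1 := (hg f hf hf1).add
          (hg' (f.comp ⟨(g • · : X → X), continuous_const_smul g⟩) (hcs g hf) fun x => hf1 _)
        rw [add_zero] at h1
        refine h1.congr fun j => ?_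
        simp [mul_smul, Function.comp_def]
      inv_mem' := by
        intro g hg f hf hf1
        have h1 := hg (f.comp ⟨(g⁻¹ • · : X → X), continuous_const_smul g⁻¹⟩) (hcs g⁻¹ hf)
          fun x => hf1 _
        rw [← neg_zero]
        refine h1.neg.congr fun j => ?_
        simp [Function.comp_def] }
  have haS : a ∈ S := by
    intro f _ hf1
    have h1 := ((tendsto_orbAvg_smul_sub (h := a) hf1 z).comp hN).neg
    refine (h1.congr fun j => ?_).trans (by simp)
    have h2 : orbAvg a (fun x => f (a • x)) (N j) z = orbAvg a f (N j) (a • z) := by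
      simp only [orbAvg, smul_smul, ← pow_succ', ← pow_succ]
    simp [h2]
  have hcS : c ∈ S := by
    intro f hf hf1
    set f' : C(X, ℝ) := f.comp ⟨(c • · : X → X), continuous_const_smul c⟩ with hf'
    have hf'c : HasCompactSupport f' := hcs c hf
    have hf'1 : ∀ x, |f' x| ≤ 1 := fun x => hf1 _
    have e1 := hz.2 f hf1
    have e2 := (tendsto_orbAvg_contracted_sub huc hu hd hau f.continuous hf s z).comp hN
    have e3 := huz.2 f hf1
    have e4 := (tendsto_orbAvg_contracted_sub hℓc hℓ hd haℓ f.continuous hf q (u s • z)).comp hN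
    have e5 := hℓuz.2 f hf1
    have e6 := (tendsto_orbAvg_contracted_sub huc hu hd hau f'.continuous hf'c s (ℓ q • z)).comp hN
    have e7 := hℓz.2 f' hf'1
    have e8 := (tendsto_orbAvg_contracted_sub hℓc hℓ hd haℓ f'.continuous hf'c q z).comp hN
    have e9 : ∀ n, orbAvg a⁻¹ f n (ℓ q • u s • z) = orbAvg a⁻¹ f' n (u s • ℓ q • z) := by
      intro n
      simp only [orbAvg]
      refine congrArg (· / (n : ℝ)) (Finset.sum_congr rfl fun k _ => ?_)
      change f _ = f (c • _)
      congr 1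
      simp only [smul_smul]
      rw [hcomm, ← mul_assoc, ((hac.inv_left).pow_left k).eq, mul_assoc]
    have := ((((((e1.sub e2).sub e3).sub e4).add e5).add e6).sub e7).add e8
    simp only [sub_zero, add_zero] at this
    refine this.congr fun j => ?_
    simp only [Function.comp, e9]
    change _ = orbAvg a f (N j) z - orbAvg a f' (N j) z
    ring
  obtain ⟨m, hm⟩ := hz.1
  obtain ⟨φ, hφK, -, hφc, hφ⟩ := exists_continuous_one_zero_of_isCompact_of_isGδ (hK m)
    (hK m).isClosed.isGδ isClosed_empty (Set.disjoint_empty _)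
  have hφ1 : ∀ x, |φ x| ≤ 1 := fun x => abs_le.2 ⟨by linarith [(hφ x).1], (hφ x).2⟩
  have hmemK : ∀ x, x ∈ K m ↔ φ x = 1 := fun x => by rw [hφK]; rfl
  obtain ⟨T, hT⟩ := (hK m).elim_finite_subcover (fun g : S => {x | φ (g.1 • x) < 1})
    (fun g => isOpen_lt (by fun_prop) continuous_const) (fun x hx => by
      obtain ⟨i, n, hin⟩ := hesc m x hx
      refine Set.mem_iUnion.2 ⟨⟨a ^ i * c ^ n, S.mul_mem (S.zpow_mem haS i) (S.zpow_mem hcS n)⟩, ?_⟩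
      rw [← mul_smul, hmemK] at hin
      exact lt_of_le_of_ne (hφ _).2 hin)
  have hcont : Continuous fun x => ∑ g ∈ T, φ (g.1 • x) := by fun_prop
  obtain ⟨y, hy, hmax⟩ := (hK m).exists_isMaxOn ⟨z, by simpa using hm 0⟩ hcont.continuousOn
  have hlt : ∑ g ∈ T, φ (g.1 • y) < T.card := by
    obtain ⟨g, hg, hgy⟩ := Set.mem_iUnion₂.1 (hT hy)
    calc ∑ g ∈ T, φ (g.1 • y) < ∑ g ∈ T, (1 : ℝ) :=
          Finset.sum_lt_sum (fun g _ => (hφ _).2) ⟨g, hg, hgy⟩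
      _ = T.card := by simp
  have hone : ∀ j, N j ≠ 0 → orbAvg a φ (N j) z = 1 := by
    intro j hj
    have h1 : ∀ k : ℕ, φ (a ^ k • z) = 1 := fun k => (hmemK _).1 (by simpa using hm k)
    simp only [orbAvg, h1]
    simp [hj]
  have hlim : Tendsto (fun j => ∑ g ∈ T, orbAvg a (fun x => φ (g.1 • x)) (N j) z) atTop
      (𝓝 (∑ g ∈ T, (1 : ℝ))) := by
    refine tendsto_finsetSum _ fun g _ => ?_
    have h1 := (g.2 φ hφc hφ1).const_sub 1
    rw [sub_zero] at h1
    refine h1.congr' ?_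
    filter_upwards [hN.eventually_ne_atTop 0] with j hj
    rw [hone j hj]
    ring
  have hle : ∑ g ∈ T, (1 : ℝ) ≤ ∑ g ∈ T, φ (g.1 • y) := by
    refine le_of_tendsto hlim ?_
    filter_upwards [hN.eventually_ne_atTop 0] with j hj
    have h1 : ∑ g ∈ T, orbAvg a (fun x => φ (g.1 • x)) (N j) z =
        (∑ k ∈ Finset.range (N j), ∑ g ∈ T, φ (g.1 • a ^ k • z)) / N j := by
      simp only [orbAvg]
      rw [← Finset.sum_div, Finset.sum_comm]
    rw [h1, div_le_iff₀ (by positivity)]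
    refine (Finset.sum_le_card_nsmul _ _ (∑ g ∈ T, φ (g.1 • y)) fun k _ => ?_).trans ?_
    · exact hmax (by simpa using hm k)
    · simp [mul_comm]
  simp at hle
  linarith

end Agreement

section LinearForms

/-- Two linear forms in three integer variables take simultaneously small values. -/
lemma exists_ne_zero_abs_lt_abs_lt (y z : (Fin 3 → ℤ) →+ ℝ) {ε : ℝ} (hε : 0 < ε) :
    ∃ m ≠ 0, |y m| < ε ∧ |z m| < ε := by
  classical
  have hbd : ∀ w : (Fin 3 → ℤ) →+ ℝ, ∀ m : Fin 3 → ℤ, ∀ Q : ℕ, (∀ i, m i ∈ Finset.Icc (0 : ℤ) Q) →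
      |w m| ≤ (∑ i, |w (Pi.single i 1)|) * Q := by
    intro w m Q hm
    have h1 : w m = ∑ i, (m i : ℝ) * w (Pi.single i 1) := by
      conv_lhs => rw [← Finset.univ_sum_single m]
      rw [map_sum]
      refine Finset.sum_congr rfl fun i _ => ?_
      rw [show Pi.single i (m i) = m i • (Pi.single i 1 : Fin 3 → ℤ) by
        rw [← Pi.single_smul]; simp, map_zsmul, zsmul_eq_mul]
    rw [h1, Finset.sum_mul]
    refine (Finset.abs_sum_le_sum_abs _ _).trans (Finset.sum_le_sum fun i _ => ?_)
    have h2 := Finset.mem_Icc.1 (hm i)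
    rw [abs_mul, mul_comm, abs_of_nonneg (show (0 : ℝ) ≤ m i by exact_mod_cast h2.1)]
    gcongr
    exact_mod_cast h2.2
  obtain ⟨K, hK⟩ := exists_nat_ge ((∑ i, |y (Pi.single i 1)|) / ε + (∑ i, |z (Pi.single i 1)|) / ε)
  have hy0 : 0 ≤ (∑ i, |y (Pi.single i 1)|) / ε := by positivity
  have hz0 : 0 ≤ (∑ i, |z (Pi.single i 1)|) / ε := by positivity
  set Q : ℕ := (2 * K + 1) ^ 2 with hQ
  have hfl : ∀ w : (Fin 3 → ℤ) →+ ℝ, (∑ i, |w (Pi.single i 1)|) / ε ≤ K → ∀ m : Fin 3 → ℤ,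
      (∀ i, m i ∈ Finset.Icc (0 : ℤ) Q) →
      ⌊w m / ε⌋ ∈ Finset.Icc (-(K * Q : ℤ)) (K * Q) := by
    intro w hw m hm
    have h1 := hbd w m Q hm
    rw [div_le_iff₀ hε] at hw
    have h2 : |w m / ε| ≤ (K * Q : ℤ) := by
      rw [abs_div, abs_of_pos hε, div_le_iff₀ hε]
      push_cast
      calc |w m| ≤ _ := h1
        _ ≤ K * ε * Q := by gcongr
        _ = _ := by ring
    rw [abs_le] at h2
    refine Finset.mem_Icc.2 ⟨Int.le_floor.2 (by exact_mod_cast h2.1), ?_⟩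
    exact Int.cast_le.1 ((Int.floor_le _).trans h2.2)
  have hcard : (Finset.Icc (-(K * Q : ℤ)) (K * Q) ×ˢ Finset.Icc (-(K * Q : ℤ)) (K * Q)).card <
      (Fintype.piFinset fun _ : Fin 3 => Finset.Icc (0 : ℤ) Q).card := by
    have e : ((K * Q : ℤ) + 1 - -(K * Q : ℤ)).toNat = 2 * K * Q + 1 := by
      rw [show ((K * Q : ℤ) + 1 - -(K * Q : ℤ)) = ((2 * K * Q + 1 : ℕ) : ℤ) by push_cast; ring]
      exact Int.toNat_natCast _
    rw [Finset.card_product, Fintype.card_piFinset, Int.card_Icc, Int.card_Icc, e]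
    simp only [sub_zero, Finset.prod_const, Finset.card_univ, Fintype.card_fin]
    rw [show ((Q : ℤ) + 1).toNat = Q + 1 by simp]
    calc (2 * K * Q + 1) * (2 * K * Q + 1)
        ≤ ((2 * K + 1) * (Q + 1)) * ((2 * K + 1) * (Q + 1)) := by gcongr <;> nlinarith
      _ = Q * (Q + 1) ^ 2 := by rw [hQ]; ring
      _ < (Q + 1) * (Q + 1) ^ 2 := by gcongr; omega
      _ = _ := by ring
  obtain ⟨m, hm, m', hm', hne, heq⟩ := Finset.exists_ne_map_eq_of_card_lt_of_maps_to hcard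
    (f := fun m : Fin 3 → ℤ => (⌊y m / ε⌋, ⌊z m / ε⌋)) (fun m hm => by
      have hm := Fintype.mem_piFinset.1 hm
      exact Finset.mem_product.2 ⟨hfl y (by linarith) m hm, hfl z (by linarith) m hm⟩)
  rw [Prod.mk.injEq] at heq
  have hlt : ∀ w : (Fin 3 → ℤ) →+ ℝ, ⌊w m / ε⌋ = ⌊w m' / ε⌋ → |w (m - m')| < ε := by
    intro w hw
    have := Int.abs_sub_lt_one_of_floor_eq_floor hw
    rwa [← sub_div, abs_div, abs_of_pos hε, div_lt_one hε, ← map_sub] at this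
  exact ⟨m - m', sub_ne_zero.2 hne, hlt y heq.1, hlt z heq.2⟩

/-- Scaling two coordinates by `L ^ i` and the third one by `L ^ (-2 i)`. -/
lemma exists_zpow_mul_lt {L c M z : ℝ} (hL : 1 < L) (hc : 0 < c) (hM : 0 ≤ M)
    (h : M ^ 2 * |z| < c ^ 3 / L ^ 2) : ∃ i : ℤ, L ^ i * M < c ∧ L ^ (-2 * i) * |z| < c := by
  have hL0 : 0 < L := by positivity
  rcases hM.eq_or_lt with rfl | hM
  · obtain ⟨n, hn⟩ := pow_unbounded_of_one_lt (|z| / c) hL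
    refine ⟨n, by simpa using hc, ?_⟩
    have h1 : L ^ n ≤ L ^ (2 * n) := pow_le_pow_right₀ hL.le (by omega)
    rw [show (-2 * (n : ℤ)) = -((2 * n : ℕ) : ℤ) by push_cast; ring, zpow_neg, zpow_natCast,
      inv_mul_lt_iff₀ (by positivity)]
    rw [div_lt_iff₀ hc] at hn
    nlinarith
  · obtain ⟨i, hi, hi'⟩ := exists_mem_Ioc_zpow (div_pos hc hM) hL
    refine ⟨i, by rwa [lt_div_iff₀ hM] at hi, ?_⟩
    have hp : 0 < L ^ i := zpow_pos hL0 i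
    rw [zpow_add_one₀ hL0.ne', div_le_iff₀ hM] at hi'
    rw [show (-2 * i) = -(i * 2) by ring, zpow_neg, zpow_mul, zpow_ofNat,
      inv_mul_lt_iff₀ (by positivity)]
    have h2 : c ^ 2 ≤ (L ^ i * L * M) ^ 2 := by gcongr
    rw [lt_div_iff₀ (by positivity)] at h
    have h3 : c ^ 2 * |z| ≤ (L ^ i) ^ 2 * (M ^ 2 * |z| * L ^ 2) := by nlinarith [abs_nonneg z]
    have h4 : (L ^ i) ^ 2 * (M ^ 2 * |z| * L ^ 2) < (L ^ i) ^ 2 * c ^ 3 := by gcongr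
    have h5 : 0 < c ^ 2 := by positivity
    refine lt_of_mul_lt_mul_left ((h3.trans_lt h4).trans_eq ?_) h5.le
    ring

/-- A unimodular shear together with a diagonal matrix moves some nonzero lattice vector close to
zero. -/
theorem exists_ne_zero_shear_lt (y₁ y₂ z : (Fin 3 → ℤ) →+ ℝ) {c₀ : ℝ} (hc₀ : 0 < c₀)
    (hlat : ∀ m ≠ 0, c₀ ≤ |y₁ m| ∨ c₀ ≤ |y₂ m| ∨ c₀ ≤ |z m|) {L c r : ℝ} (hL : 1 < L) (hc : 0 < c)
    (hr : r ≠ 0) : ∃ m ≠ 0, ∃ i n : ℤ, L ^ i * |y₁ m + n * r * y₂ m| < c ∧ L ^ i * |y₂ m| < c ∧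
      L ^ (-2 * i) * |z m| < c := by
  by_contra! hcon
  set c' : ℝ := c ^ 3 / L ^ 2 with hc'
  have hc'0 : 0 < c' := by positivity
  have key : ∀ m ≠ 0, ∀ n : ℤ, ∀ M, |y₁ m + n * r * y₂ m| ≤ M → |y₂ m| ≤ M → c' ≤ M ^ 2 * |z m| := by
    intro m hm n M h1 h2
    by_contra! h
    obtain ⟨i, hi, hi'⟩ := exists_zpow_mul_lt hL hc ((abs_nonneg _).trans h1) h
    have hp : 0 < L ^ i := zpow_pos (by positivity) i
    exact absurd hi' (not_lt.2 (hcon m hm i n ((mul_le_mul_of_nonneg_left h1 hp.le).trans_lt hi)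
      ((mul_le_mul_of_nonneg_left h2 hp.le).trans_lt hi)))
  have key₁ : ∀ m ≠ 0, y₂ m = 0 → c' ≤ |y₁ m| ^ 2 * |z m| := fun m hm h =>
    key m hm 0 _ (by simp) (by simp [h])
  have key₂ : ∀ m ≠ 0, y₂ m ≠ 0 → c' ≤ ((|r| + 1) * |y₂ m|) ^ 2 * |z m| := by
    intro m hm h
    have hry : r * y₂ m ≠ 0 := mul_ne_zero hr h
    refine key m hm (-round (y₁ m / (r * y₂ m))) _ ?_ ?_
    · have h1 := abs_sub_round (y₁ m / (r * y₂ m))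
      have h2 : y₁ m + (-round (y₁ m / (r * y₂ m)) : ℤ) * r * y₂ m =
          (y₁ m / (r * y₂ m) - round (y₁ m / (r * y₂ m))) * (r * y₂ m) := by
        push_cast; field_simp; ring
      rw [h2, abs_mul, abs_mul]
      nlinarith [abs_nonneg (y₂ m), mul_nonneg (abs_nonneg r) (abs_nonneg (y₂ m))]
    · nlinarith [abs_nonneg (y₂ m), mul_nonneg (abs_nonneg r) (abs_nonneg (y₂ m))]
  have hz : ∀ m ≠ 0, z m ≠ 0 := by
    intro m hm h
    by_cases h2 : y₂ m = 0
    · have := key₁ m hm h2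
      simp [h] at this
      linarith
    · have := key₂ m hm h2
      simp [h] at this
      linarith
  have hsmall : ∀ ε > 0, ∃ m ≠ 0, y₂ m = 0 ∧ |z m| < ε := by
    intro ε hε
    obtain ⟨η, hη, hη1, hηε, hηc⟩ : ∃ η : ℝ, 0 < η ∧ η ≤ 1 ∧ η ≤ ε ∧
        (|r| + 1) ^ 2 * η ≤ c' := by
      refine ⟨min 1 (min ε (c' / (|r| + 1) ^ 2)), by positivity, min_le_left _ _,
        (min_le_right _ _).trans (min_le_left _ _), ?_⟩
      rw [mul_comm, ← le_div_iff₀ (by positivity)]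
      exact (min_le_right _ _).trans (min_le_right _ _)
    obtain ⟨m, hm, h1, h2⟩ := exists_ne_zero_abs_lt_abs_lt y₂ z hη
    refine ⟨m, hm, ?_, h2.trans_le hηε⟩
    by_contra h
    have h3 := key₂ m hm h
    have h4 : |y₂ m| ^ 2 ≤ 1 := pow_le_one₀ (abs_nonneg _) (h1.le.trans hη1)
    have h5 : ((|r| + 1) * |y₂ m|) ^ 2 * |z m| < (|r| + 1) ^ 2 * η := by
      have hp : 0 < (|r| + 1) ^ 2 := by positivity
      calc ((|r| + 1) * |y₂ m|) ^ 2 * |z m| = (|r| + 1) ^ 2 * (|y₂ m| ^ 2 * |z m|) := by ring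
        _ ≤ (|r| + 1) ^ 2 * (1 * |z m|) := by gcongr
        _ < _ := by rw [one_mul]; gcongr
    linarith
  obtain ⟨m₀, hm₀, hy₀, -⟩ := hsmall 1 one_pos
  have hz₀ := hz m₀ hm₀
  have hy₁ : y₁ m₀ ≠ 0 := by
    intro h
    have := key₁ m₀ hm₀ hy₀
    simp [h] at this
    linarith
  obtain ⟨m₁, hm₁, hy₁₂, hz₁⟩ := hsmall (min c₀ (c₀ * |z m₀| / |y₁ m₀|)) (by positivity)
  -- the two vectors are linearly independent
  have hind : y₁ m₁ * z m₀ ≠ y₁ m₀ * z m₁ := by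
    intro h
    rcases hlat m₁ hm₁ with h1 | h1 | h1
    · have h2 : |y₁ m₁| * |z m₀| = |y₁ m₀| * |z m₁| := by rw [← abs_mul, ← abs_mul, h]
      have h3 := hz₁.trans_le (min_le_right _ _)
      rw [lt_div_iff₀ (by positivity)] at h3
      nlinarith [abs_pos.2 hz₀]
    · rw [hy₁₂, abs_zero] at h1; linarith
    · exact absurd (hz₁.trans_le (min_le_left _ _)) (not_lt.2 h1)
  set ξ : ℝ := y₁ m₁ / y₁ m₀ with hξ
  set C : ℝ := |z m₁| + (|ξ| + 1) * |z m₀| with hC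
  have hC0 : 0 < C := by positivity
  obtain ⟨n, hn⟩ := exists_nat_gt (|y₁ m₀| ^ 2 * C / c')
  have hnpos : 0 < n := by
    have : (0 : ℝ) < n := lt_of_le_of_lt (by positivity) hn
    exact_mod_cast this
  obtain ⟨j, k, hk, hkn, hjk⟩ := Real.exists_int_int_abs_mul_sub_le ξ hnpos
  set m := k • m₁ - j • m₀ with hm
  have hmy₁ : y₁ m = (k * ξ - j) * y₁ m₀ := by
    rw [hm, map_sub, map_zsmul, map_zsmul, zsmul_eq_mul, zsmul_eq_mul, hξ]
    field_simp
  have hmz : z m = k * z m₁ - j * z m₀ := by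
    rw [hm, map_sub, map_zsmul, map_zsmul, zsmul_eq_mul, zsmul_eq_mul]
  have hmy₂ : y₂ m = 0 := by rw [hm, map_sub, map_zsmul, map_zsmul, hy₀, hy₁₂]; simp
  have hm0 : m ≠ 0 := by
    intro h0
    have e1 : y₁ m = 0 := by rw [h0, map_zero]
    have e2 : z m = 0 := by rw [h0, map_zero]
    have e3 : (k : ℝ) * ξ - j = 0 := by
      rw [hmy₁] at e1
      exact (mul_eq_zero.1 e1).resolve_right hy₁
    have hk' : (k : ℝ) ≠ 0 := by exact_mod_cast hk.ne'
    apply hind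
    rw [hmz, ← sub_eq_zero.1 e3] at e2
    have e4 : (k : ℝ) * (z m₁ - ξ * z m₀) = 0 := by linarith
    have e5 := (mul_eq_zero.1 e4).resolve_left hk'
    have e6 : y₁ m₁ = ξ * y₁ m₀ := by rw [hξ]; field_simp
    rw [e6]
    linear_combination (-y₁ m₀) * e5
  have hfin := key₁ m hm0 hmy₂
  have hk0 : (0 : ℝ) < k := by exact_mod_cast hk
  have hkn' : (k : ℝ) ≤ n := by exact_mod_cast hkn
  have hn1 : (1 : ℝ) ≤ n := by exact_mod_cast hnpos
  have b1 : |y₁ m| ≤ 1 / (n + 1) * |y₁ m₀| := by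
    rw [hmy₁, abs_mul]
    gcongr
  have hj : |(j : ℝ)| ≤ n * (|ξ| + 1) := by
    have h1 : |(j : ℝ)| ≤ |k * ξ| + |k * ξ - j| := by
      have := abs_sub_abs_le_abs_sub (j : ℝ) (k * ξ)
      rw [abs_sub_comm] at this
      linarith
    have h2 : (1 : ℝ) / (n + 1) ≤ 1 := by
      rw [div_le_one (by positivity)]; linarith
    rw [abs_mul, abs_of_pos hk0] at h1
    nlinarith [abs_nonneg ξ]
  have b2 : |z m| ≤ n * C := by
    rw [hmz]
    have h1 := abs_sub (k * z m₁) (j * z m₀)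
    rw [abs_mul, abs_mul, abs_of_pos hk0] at h1
    have h2 : (k : ℝ) * |z m₁| ≤ n * |z m₁| := by gcongr
    have h3 : |(j : ℝ)| * |z m₀| ≤ n * (|ξ| + 1) * |z m₀| := by gcongr
    rw [hC]
    linarith
  have b3 : |y₁ m| ^ 2 * |z m| ≤ (1 / (n + 1) * |y₁ m₀|) ^ 2 * (n * C) := by gcongr
  have b4 : (1 / ((n : ℝ) + 1) * |y₁ m₀|) ^ 2 * (n * C) ≤ |y₁ m₀| ^ 2 * C / n := by
    rw [le_div_iff₀ (by positivity)]
    have : (1 / ((n : ℝ) + 1)) ^ 2 * n * n ≤ 1 := by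
      rw [div_pow, one_pow, div_mul_eq_mul_div, div_mul_eq_mul_div, div_le_one (by positivity)]
      nlinarith
    calc (1 / ((n : ℝ) + 1) * |y₁ m₀|) ^ 2 * (n * C) * n
        = ((1 / ((n : ℝ) + 1)) ^ 2 * n * n) * (|y₁ m₀| ^ 2 * C) := by ring
      _ ≤ 1 * (|y₁ m₀| ^ 2 * C) := by gcongr
      _ = _ := one_mul _
  rw [div_lt_comm₀ hc'0 (by positivity)] at hn
  linarith

end LinearForms

namespace LatticeSpace

/-- The translations by `(s, t)` of the first two coordinates along the third one. -/
def upper (s t : ℝ) : SL3R := ⟨!![1, 0, s; 0, 1, t; 0, 0, 1], by simp [Matrix.det_fin_three]⟩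

/-- The transposes of the matrices `upper p q`. -/
def lower (p q : ℝ) : SL3R := ⟨!![1, 0, 0; 0, 1, 0; p, q, 1], by simp [Matrix.det_fin_three]⟩

/-- The elementary matrices with entry `r` in position `(1, 2)`. -/
def shear₁₂ (r : ℝ) : SL3R := ⟨!![1, r, 0; 0, 1, 0; 0, 0, 1], by simp [Matrix.det_fin_three]⟩

/-- The elementary matrices with entry `r` in position `(2, 1)`. -/
def shear₂₁ (r : ℝ) : SL3R := ⟨!![1, 0, 0; r, 1, 0; 0, 0, 1], by simp [Matrix.det_fin_three]⟩

/-- The diagonal matrices of determinant one. -/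
def dg (a b : ℝˣ) : SL3R :=
  ⟨!![(a : ℝ), 0, 0; 0, (b : ℝ), 0; 0, 0, ((a * b)⁻¹ : ℝˣ)], by
    simp [Matrix.det_fin_three]
    field_simp⟩

lemma ext_entries {g h : SL3R} (H : ∀ i j, g.1 i j = h.1 i j) : g = h :=
  Subtype.ext (Matrix.ext H)

lemma coe_mul' (g h : SL3R) : (g * h).1 = g.1 * h.1 := rfl

lemma upper_add (s t s' t' : ℝ) : upper (s + s') (t + t') = upper s t * upper s' t' := by
  refine ext_entries fun i j => ?_
  rw [coe_mul']
  fin_cases i <;> fin_cases j <;> simp [upper, Matrix.mul_apply, Fin.sum_univ_three, add_comm]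

lemma lower_add (s t s' t' : ℝ) : lower (s + s') (t + t') = lower s t * lower s' t' := by
  refine ext_entries fun i j => ?_
  rw [coe_mul']
  fin_cases i <;> fin_cases j <;> simp [lower, Matrix.mul_apply, Fin.sum_univ_three]

lemma shear₁₂_add (s t : ℝ) : shear₁₂ (s + t) = shear₁₂ s * shear₁₂ t := by
  refine ext_entries fun i j => ?_
  rw [coe_mul']
  fin_cases i <;> fin_cases j <;>
    simp [shear₁₂, Matrix.mul_apply, Fin.sum_univ_three, add_comm]

lemma shear₂₁_add (s t : ℝ) : shear₂₁ (s + t) = shear₂₁ s * shear₂₁ t := by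
  refine ext_entries fun i j => ?_
  rw [coe_mul']
  fin_cases i <;> fin_cases j <;> simp [shear₂₁, Matrix.mul_apply, Fin.sum_univ_three]

lemma upper_zero : upper 0 0 = 1 := by
  refine ext_entries fun i j => ?_
  fin_cases i <;> fin_cases j <;> simp [upper]

lemma lower_zero : lower 0 0 = 1 := by
  refine ext_entries fun i j => ?_
  fin_cases i <;> fin_cases j <;> simp [lower]

lemma dg_mul (a b a' b' : ℝˣ) : dg (a * a') (b * b') = dg a b * dg a' b' := by
  refine ext_entries fun i j => ?_
  rw [coe_mul']
  fin_cases i <;> fin_cases j <;> simp [dg, Matrix.mul_apply, Fin.sum_univ_three]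
  ring

lemma dg_one : dg 1 1 = 1 := by
  refine ext_entries fun i j => ?_
  fin_cases i <;> fin_cases j <;> simp [dg]

lemma dg_commute (a b a' b' : ℝˣ) : Commute (dg a b) (dg a' b') := by
  rw [commute_iff_eq, ← dg_mul, ← dg_mul, mul_comm a, mul_comm b]

lemma dg_inv (a b : ℝˣ) : (dg a b)⁻¹ = dg a⁻¹ b⁻¹ :=
  inv_eq_of_mul_eq_one_right (by rw [← dg_mul, mul_inv_cancel, mul_inv_cancel, dg_one])

lemma dg_pow (a b : ℝˣ) (n : ℕ) : dg a b ^ n = dg (a ^ n) (b ^ n) := by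
  induction n with
  | zero => simp [dg_one]
  | succ n ih => rw [pow_succ, ih, ← dg_mul, pow_succ, pow_succ]

lemma dg_zpow (a b : ℝˣ) (n : ℤ) : dg a b ^ n = dg (a ^ n) (b ^ n) := by
  cases n with
  | ofNat n => simpa using dg_pow a b n
  | negSucc n => rw [zpow_negSucc, zpow_negSucc, zpow_negSucc, dg_pow, dg_inv]

lemma dg_mul_upper (a b : ℝˣ) (s t : ℝ) :
    dg a b * upper s t = upper (a ^ 2 * b * s) (a * b ^ 2 * t) * dg a b := by
  refine ext_entries fun i j => ?_
  rw [coe_mul', coe_mul']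
  fin_cases i <;> fin_cases j <;> simp [dg, upper, Matrix.mul_apply, Fin.sum_univ_three] <;>
    field_simp

lemma dg_mul_lower (a b : ℝˣ) (p q : ℝ) :
    dg a b * lower p q = lower ((a ^ 2 * b : ℝ)⁻¹ * p) ((a * b ^ 2 : ℝ)⁻¹ * q) * dg a b := by
  refine ext_entries fun i j => ?_
  rw [coe_mul', coe_mul']
  fin_cases i <;> fin_cases j <;> simp [dg, lower, Matrix.mul_apply, Fin.sum_univ_three] <;>
    field_simp

lemma dg_commute_shear₁₂ (a : ℝˣ) (r : ℝ) : Commute (dg a a) (shear₁₂ r) := by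
  refine ext_entries fun i j => ?_
  rw [coe_mul', coe_mul']
  fin_cases i <;> fin_cases j <;>
    simp [dg, shear₁₂, Matrix.mul_apply, Fin.sum_univ_three, mul_comm]

lemma dg_commute_shear₂₁ (a : ℝˣ) (r : ℝ) : Commute (dg a a) (shear₂₁ r) := by
  refine ext_entries fun i j => ?_
  rw [coe_mul', coe_mul']
  fin_cases i <;> fin_cases j <;>
    simp [dg, shear₂₁, Matrix.mul_apply, Fin.sum_univ_three, mul_comm]

lemma lower_mul_upper_fst (q s : ℝ) :
    lower 0 q * upper s 0 = shear₁₂ (-(s * q)) * (upper s 0 * lower 0 q) := by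
  refine ext_entries fun i j => ?_
  simp only [coe_mul', ← Matrix.mul_assoc]
  fin_cases i <;> fin_cases j <;>
    simp [upper, lower, shear₁₂, Matrix.mul_apply, Fin.sum_univ_three]

lemma lower_mul_upper_snd (p s : ℝ) :
    lower p 0 * upper 0 s = shear₂₁ (-(s * p)) * (upper 0 s * lower p 0) := by
  refine ext_entries fun i j => ?_
  simp only [coe_mul', ← Matrix.mul_assoc]
  fin_cases i <;> fin_cases j <;>
    simp [upper, lower, shear₂₁, Matrix.mul_apply, Fin.sum_univ_three]

lemma continuous_mk {Y : Type*} [TopologicalSpace Y] {f : Y → SL3R}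
    (h : ∀ i j, Continuous fun y => (f y).1 i j) : Continuous f :=
  Continuous.subtype_mk (continuous_matrix h) _

@[fun_prop]
lemma continuous_upper {Y : Type*} [TopologicalSpace Y] {f g : Y → ℝ} (hf : Continuous f)
    (hg : Continuous g) : Continuous fun y => upper (f y) (g y) :=
  continuous_mk fun i j => by fin_cases i <;> fin_cases j <;> simp [upper] <;> fun_prop

@[fun_prop]
lemma continuous_lower {Y : Type*} [TopologicalSpace Y] {f g : Y → ℝ} (hf : Continuous f)
    (hg : Continuous g) : Continuous fun y => lower (f y) (g y) :=
  continuous_mk fun i j => by fin_cases i <;> fin_cases j <;> simp [lower] <;> fun_prop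

lemma dg_mulVec (a b : ℝˣ) (w : Fin 3 → ℝ) :
    (dg a b).1.mulVec w = ![a * w 0, b * w 1, ((a * b)⁻¹ : ℝˣ) * w 2] := by
  ext i
  fin_cases i <;> simp [dg, Matrix.mulVec, dotProduct, Fin.sum_univ_three]

lemma shear₁₂_mulVec (r : ℝ) (w : Fin 3 → ℝ) :
    (shear₁₂ r).1.mulVec w = ![w 0 + r * w 1, w 1, w 2] := by
  ext i
  fin_cases i <;> simp [shear₁₂, Matrix.mulVec, dotProduct, Fin.sum_univ_three]

lemma shear₂₁_mulVec (r : ℝ) (w : Fin 3 → ℝ) :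
    (shear₂₁ r).1.mulVec w = ![w 0, w 1 + r * w 0, w 2] := by
  ext i
  fin_cases i <;> simp [shear₂₁, Matrix.mulVec, dotProduct, Fin.sum_univ_three, add_comm]

lemma shear₁₂_zpow (r : ℝ) (n : ℤ) : shear₁₂ r ^ n = shear₁₂ (n * r) := by
  let φ : Multiplicative ℝ →* SL3R := MonoidHom.mk' (fun t => shear₁₂ t.toAdd)
    fun s t => shear₁₂_add _ _
  have := map_zpow φ (Multiplicative.ofAdd r) n
  rw [← ofAdd_zsmul, zsmul_eq_mul] at this
  exact this.symm

lemma shear₂₁_zpow (r : ℝ) (n : ℤ) : shear₂₁ r ^ n = shear₂₁ (n * r) := by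
  let φ : Multiplicative ℝ →* SL3R := MonoidHom.mk' (fun t => shear₂₁ t.toAdd)
    fun s t => shear₂₁_add _ _
  have := map_zpow φ (Multiplicative.ofAdd r) n
  rw [← ofAdd_zsmul, zsmul_eq_mul] at this
  exact this.symm

/-- The coordinates of the lattice vectors, as linear forms on `ℤ³`. -/
def coordForm (g : SL3R) (i : Fin 3) : (Fin 3 → ℤ) →+ ℝ where
  toFun m := g.1.mulVec (fun j => (m j : ℝ)) i
  map_zero' := by simp [Matrix.mulVec, dotProduct]
  map_add' m m' := by simp [Matrix.mulVec, dotProduct, mul_add, Finset.sum_add_distrib]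

lemma exists_coordForm_ge (g : SL3R) : ∃ c₀ > 0, ∀ m ≠ 0, ∃ i, c₀ ≤ |coordForm g i m| := by
  obtain ⟨c₀, hc₀, h⟩ := exists_mem_thick (g : LatticeSpace)
  refine ⟨c₀, hc₀, fun m hm => ?_⟩
  by_contra! hlt
  exact absurd (mk_mem_thick.1 h m hm) (not_le.2 ((pi_norm_lt_iff hc₀).2 hlt))

lemma not_mem_thick_of_lt {g h : SL3R} {m : Fin 3 → ℤ} (hm : m ≠ 0) {c : ℝ} (hc : 0 < c)
    (H : ∀ i, |h.1.mulVec (fun i => coordForm g i m) i| < c) :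
    h • (g : LatticeSpace) ∉ thick c := by
  intro hmem
  have h1 := mk_mem_thick.1 (show ((h * g : SL3R) : LatticeSpace) ∈ thick c from hmem) m hm
  refine absurd h1 (not_le.2 ((pi_norm_lt_iff hc).2 fun i => ?_))
  have h2 := H i
  rwa [show (fun i => coordForm g i m) = g.1.mulVec fun j => (m j : ℝ) from rfl,
    Matrix.mulVec_mulVec] at h2

theorem exists_zpow_smul_shear₁₂_notMem_thick {L : ℝˣ} (hL : 1 < (L : ℝ)) {c r : ℝ} (hc : 0 < c)
    (hr : r ≠ 0) (x : LatticeSpace) :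
    ∃ i n : ℤ, dg L L ^ i • shear₁₂ r ^ n • x ∉ thick c := by
  obtain ⟨g, rfl⟩ := QuotientGroup.mk_surjective x
  obtain ⟨c₀, hc₀, h⟩ := exists_coordForm_ge g
  obtain ⟨m, hm, i, n, h1, h2, h3⟩ := exists_ne_zero_shear_lt (coordForm g 0) (coordForm g 1)
    (coordForm g 2) hc₀ (fun m hm => by simpa [Fin.exists_fin_succ] using h m hm) hL hc hr
  have hp : 0 < (L : ℝ) ^ i := zpow_pos (by positivity) i
  refine ⟨i, n, ?_⟩
  rw [smul_smul]
  refine not_mem_thick_of_lt hm hc fun j => ?_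
  rw [coe_mul', ← Matrix.mulVec_mulVec, shear₁₂_zpow, shear₁₂_mulVec, dg_zpow, dg_mulVec]
  have e : (((L ^ i * L ^ i)⁻¹ : ℝˣ) : ℝ) = (L : ℝ) ^ (-2 * i) := by
    rw [← zpow_add, ← zpow_neg, Units.val_zpow_eq_zpow_val]
    congr 1; ring
  fin_cases j
  · simpa [abs_mul, abs_of_pos hp] using h1
  · simpa [abs_mul, abs_of_pos hp] using h2
  · simp only [e]
    simpa [abs_mul, abs_of_pos (zero_lt_one.trans hL)] using h3

theorem exists_zpow_smul_shear₂₁_notMem_thick {L : ℝˣ} (hL : 1 < (L : ℝ)) {c r : ℝ} (hc : 0 < c)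
    (hr : r ≠ 0) (x : LatticeSpace) :
    ∃ i n : ℤ, dg L L ^ i • shear₂₁ r ^ n • x ∉ thick c := by
  obtain ⟨g, rfl⟩ := QuotientGroup.mk_surjective x
  obtain ⟨c₀, hc₀, h⟩ := exists_coordForm_ge g
  obtain ⟨m, hm, i, n, h1, h2, h3⟩ := exists_ne_zero_shear_lt (coordForm g 1) (coordForm g 0)
    (coordForm g 2) hc₀ (fun m hm => by
      have := h m hm
      simp only [Fin.exists_fin_succ, IsEmpty.exists_iff, or_false] at this
      tauto) hL hc hr
  have hp : 0 < (L : ℝ) ^ i := zpow_pos (by positivity) i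
  refine ⟨i, n, ?_⟩
  rw [smul_smul]
  refine not_mem_thick_of_lt hm hc fun j => ?_
  rw [coe_mul', ← Matrix.mulVec_mulVec, shear₂₁_zpow, shear₂₁_mulVec, dg_zpow, dg_mulVec]
  have e : (((L ^ i * L ^ i)⁻¹ : ℝˣ) : ℝ) = (L : ℝ) ^ (-2 * i) := by
    rw [← zpow_add, ← zpow_neg, Units.val_zpow_eq_zpow_val]
    congr 1; ring
  fin_cases j
  · simpa [abs_mul, abs_of_pos hp] using h2
  · simpa [abs_mul, abs_of_pos hp] using h1
  · simp only [e]
    simpa [abs_mul, abs_of_pos (zero_lt_one.trans hL)] using h3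

/-- `g` is `ε`-close to the identity, entry by entry. -/
def NearOne (ε : ℝ) (g : SL3R) : Prop := ∀ i j, |g.1 i j - (1 : Matrix (Fin 3) (Fin 3) ℝ) i j| < ε

/-- `g` is block upper triangular. -/
def IsPar (g : SL3R) : Prop := g.1 2 0 = 0 ∧ g.1 2 1 = 0

lemma exists_nearOne_subset {V : Set SL3R} (hV : V ∈ 𝓝 1) :
    ∃ ε > 0, ∀ g, NearOne ε g → g ∈ V := by
  obtain ⟨W, hW, hWV⟩ := mem_comap.1 ((isClosedEmbedding_val.isEmbedding.nhds_eq_comap (1 : SL3R)).ge hV)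
  have hW' : W ∈ 𝓝 (show Fin 3 → Fin 3 → ℝ from (1 : SL3R).1) := hW
  obtain ⟨ε, hε, h⟩ := Metric.mem_nhds_iff.1 hW'
  refine ⟨ε, hε, fun g hg => hWV (h ?_)⟩
  refine (dist_pi_lt_iff hε).2 fun i => (dist_pi_lt_iff hε).2 fun j => ?_
  exact hg i j

lemma continuous_entry (i j : Fin 3) : Continuous fun g : SL3R => g.1 i j :=
  (isClosedEmbedding_val.continuous.matrix_elem i j)

lemma nearOne_mem_nhds {ε : ℝ} (hε : 0 < ε) : {g | NearOne ε g} ∈ 𝓝 (1 : SL3R) := by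
  have : ∀ i j, ∀ᶠ g : SL3R in 𝓝 1, |g.1 i j - (1 : Matrix (Fin 3) (Fin 3) ℝ) i j| < ε := by
    intro i j
    have hc : Continuous fun g : SL3R => |g.1 i j - (1 : Matrix (Fin 3) (Fin 3) ℝ) i j| :=
      ((continuous_entry i j).sub continuous_const).abs
    have := hc.tendsto 1
    refine this.eventually (gt_mem_nhds ?_)
    simpa using hε
  exact eventually_all.2 fun i => eventually_all.2 fun j => this i j

/-- Near the identity, every matrix factors through the lower unipotent matrices. -/
lemma exists_factor_nhds {ε η : ℝ} (hε : 0 < ε) (hη : 0 < η) :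
    ∃ V : Set SL3R, IsOpen V ∧ 1 ∈ V ∧ ∀ g ∈ V, ∃ p s t, IsPar p ∧ NearOne ε p ∧ |s| ≤ η ∧
      |t| ≤ η ∧ g = p * lower s t := by
  have h1 : ∀ᶠ g : SL3R in 𝓝 1, g.1 2 2 ≠ 0 :=
    (continuous_entry 2 2).continuousAt.eventually_ne (by simp)
  have hcont : ∀ j, ContinuousAt (fun g : SL3R => g.1 2 j / g.1 2 2) 1 := fun j =>
    (continuous_entry 2 j).continuousAt.div (continuous_entry 2 2).continuousAt (by simp)
  have h2 : ∀ j ≠ 2, ∀ᶠ g : SL3R in 𝓝 1, |g.1 2 j / g.1 2 2| < η := fun j hj => by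
    refine (hcont j).abs.tendsto.eventually (gt_mem_nhds ?_)
    simpa [Matrix.one_apply_ne hj.symm] using hη
  have h3 : ContinuousAt (fun g : SL3R =>
      g * lower (-(g.1 2 0 / g.1 2 2)) (-(g.1 2 1 / g.1 2 2))) 1 := by
    have hl : Continuous fun q : ℝ × ℝ => lower (-q.1) (-q.2) := by fun_prop
    have hl' : ContinuousAt ((fun q : ℝ × ℝ => lower (-q.1) (-q.2)) ∘
        fun g : SL3R => (g.1 2 0 / g.1 2 2, g.1 2 1 / g.1 2 2)) 1 :=
      hl.continuousAt.comp ((hcont 0).prodMk (hcont 1))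
    exact continuousAt_id.mul hl'
  have h4 : ∀ᶠ g : SL3R in 𝓝 1,
      NearOne ε (g * lower (-(g.1 2 0 / g.1 2 2)) (-(g.1 2 1 / g.1 2 2))) := by
    refine h3.tendsto.eventually ?_
    have : (1 : SL3R) * lower (-((1 : SL3R).1 2 0 / (1 : SL3R).1 2 2))
        (-((1 : SL3R).1 2 1 / (1 : SL3R).1 2 2)) = 1 := by
      simp [lower_zero]
    rw [this]
    exact nearOne_mem_nhds hε
  obtain ⟨V, hV, hVo, h1V⟩ := eventually_nhds_iff.1
    (h1.and ((h2 0 (by decide)).and ((h2 1 (by decide)).and h4)))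
  refine ⟨V, hVo, h1V, fun g hg => ?_⟩
  obtain ⟨k1, k2, k3, k4⟩ := hV g hg
  refine ⟨_, _, _, ?_, k4, k2.le, k3.le, ?_⟩
  · constructor <;> rw [coe_mul'] <;>
      simp [lower, Matrix.mul_apply, Fin.sum_univ_three] <;> field_simp <;> ring
  · rw [mul_assoc, ← lower_add, neg_add_cancel, neg_add_cancel, lower_zero, mul_one]

lemma isOpenMap_smul (x : LatticeSpace) : IsOpenMap fun g : SL3R => g • x := by
  obtain ⟨g₀, rfl⟩ := QuotientGroup.mk_surjective x
  exact QuotientGroup.isOpenMap_coe.comp (Homeomorph.mulRight g₀).isOpenMap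

/-- A compact set is covered by finitely many boxes. -/
lemma exists_finset_cover {K : Set LatticeSpace} (hK : IsCompact K) {V : Set SL3R}
    (hV : IsOpen V) (h1 : (1 : SL3R) ∈ V) :
    ∃ P : Finset LatticeSpace, ∀ x ∈ K, ∃ y ∈ P, ∃ g ∈ V, x = g • y := by
  obtain ⟨P, hP⟩ := hK.elim_finite_subcover (fun y : LatticeSpace => (fun g : SL3R => g • y) '' V)
    (fun y => isOpenMap_smul y _ hV)
    (fun x _ => Set.mem_iUnion.2 ⟨x, 1, h1, one_smul _ _⟩)
  refine ⟨P, fun x hx => ?_⟩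
  obtain ⟨y, hy, g, hg, h⟩ := Set.mem_iUnion₂.1 (hP hx)
  exact ⟨y, hy, g, hg, h.symm⟩

lemma dg_mul_mul_inv_entry (a b : ℝˣ) (g : SL3R) (i j : Fin 3) :
    (dg a b * g * (dg a b)⁻¹).1 i j =
      (![(a : ℝ), b, ((a * b)⁻¹ : ℝˣ)] i) * g.1 i j / ![(a : ℝ), b, ((a * b)⁻¹ : ℝˣ)] j := by
  rw [dg_inv, coe_mul', coe_mul']
  fin_cases i <;> fin_cases j <;>
    simp [dg, Matrix.mul_apply, Fin.sum_univ_three, Matrix.vecMul, dotProduct] <;> field_simp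

/-- Conjugation by a negative power of a contracting element. -/
lemma conj_par {L : ℝˣ} (hL : 1 ≤ (L : ℝ)) {ε : ℝ} {p : SL3R} (hp : IsPar p) (hε : NearOne ε p)
    (k : ℕ) : IsPar ((dg L L ^ k)⁻¹ * p * dg L L ^ k) ∧
      NearOne ε ((dg L L ^ k)⁻¹ * p * dg L L ^ k) ∧
      (∀ i : Fin 3, i ≠ 2 → |((dg L L ^ k)⁻¹ * p * dg L L ^ k).1 i 2| ≤ ε * ((L ^ 3 : ℝ) ^ k)⁻¹) := by
  have h0 : (0:ℝ) < L := zero_lt_one.trans_le hL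
  have e : dg L L ^ k = (dg (L ^ k)⁻¹ (L ^ k)⁻¹)⁻¹ := by rw [dg_pow, dg_inv, inv_inv]
  set q := (dg L L ^ k)⁻¹ * p * dg L L ^ k
  have hq : ∀ i j, q.1 i j = _ := fun i j => by
    have := dg_mul_mul_inv_entry (L ^ k)⁻¹ (L ^ k)⁻¹ p i j
    rwa [← e, show dg (L ^ k)⁻¹ (L ^ k)⁻¹ = (dg L L ^ k)⁻¹ by rw [e, inv_inv]] at this
  have hk1 : (1 : ℝ) ≤ (L ^ 3 : ℝ) ^ k := one_le_pow₀ (one_le_pow₀ hL)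
  have hinv : ((L ^ 3 : ℝ) ^ k)⁻¹ ≤ 1 := inv_le_one_of_one_le₀ hk1
  have hq2 : ∀ i : Fin 3, i ≠ 2 → q.1 i 2 = p.1 i 2 * ((L ^ 3 : ℝ) ^ k)⁻¹ := by
    intro i hi
    rw [hq]
    fin_cases i
    · simp; field_simp; ring
    · simp; field_simp; ring
    · exact absurd rfl hi
  have hε0 : 0 < ε := (abs_nonneg _).trans_lt (hε 0 0)
  have hp2 : ∀ i : Fin 3, i ≠ 2 → |q.1 i 2| ≤ |p.1 i 2| * ((L ^ 3 : ℝ) ^ k)⁻¹ := fun i hi => by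
    rw [hq2 i hi, abs_mul, abs_of_pos (by positivity : 0 < ((L ^ 3 : ℝ) ^ k)⁻¹)]
  have hpε : ∀ i : Fin 3, i ≠ 2 → |p.1 i 2| < ε := fun i hi => by
    simpa [Matrix.one_apply_ne hi] using hε i 2
  refine ⟨⟨?_, ?_⟩, fun i j => ?_, fun i hi => (hp2 i hi).trans ?_⟩
  · rw [hq, hp.1]; simp
  · rw [hq, hp.2]; simp
  · by_cases hj : j = 2
    · subst hj
      by_cases hi : i = 2
      · subst hi
        rw [hq]
        simpa using hε 2 2
      · rw [Matrix.one_apply_ne hi, sub_zero]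
        refine (hp2 i hi).trans_lt (lt_of_le_of_lt ?_ (hpε i hi))
        exact mul_le_of_le_one_right (abs_nonneg _) hinv
    · have := hε i j
      by_cases hi : i = 2
      · subst hi
        have h2 : q.1 2 j = 0 := by
          rw [hq]
          fin_cases j
          · simp [hp.1]
          · simp [hp.2]
          · exact absurd rfl hj
        rw [h2, Matrix.one_apply_ne (Ne.symm hj)]
        simpa using hε0
      · have h2 : q.1 i j = p.1 i j := by
          rw [hq]
          fin_cases i <;> fin_cases j <;> simp at hi hj ⊢ <;> field_simp
        rwa [h2]
  · exact mul_le_mul_of_nonneg_right (hpε i hi).le (by positivity)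

/-- The relative position, at an earlier time, of two points in the same box. -/
lemma smul_eq_of_box {L : ℝˣ} {x₁ x₂ y : LatticeSpace} {p₁ p₂ : SL3R} {s₁ t₁ s₂ t₂ : ℝ} {r k : ℕ}
    (h₁ : dg L L ^ (r + k) • x₁ = (p₁ * lower s₁ t₁) • y)
    (h₂ : dg L L ^ (r + k) • x₂ = (p₂ * lower s₂ t₂) • y) :
    dg L L ^ r • x₂ = (((dg L L ^ k)⁻¹ * p₂ * dg L L ^ k) *
      lower ((L ^ 3 : ℝ) ^ k * (s₂ - s₁)) ((L ^ 3 : ℝ) ^ k * (t₂ - t₁)) *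
      ((dg L L ^ k)⁻¹ * p₁ * dg L L ^ k)⁻¹) • dg L L ^ r • x₁ := by
  have hl : lower ((L ^ 3 : ℝ) ^ k * (s₂ - s₁)) ((L ^ 3 : ℝ) ^ k * (t₂ - t₁)) =
      (dg L L ^ k)⁻¹ * (lower s₂ t₂ * (lower s₁ t₁)⁻¹) * dg L L ^ k := by
    have e1 : lower s₂ t₂ * (lower s₁ t₁)⁻¹ = lower (s₂ - s₁) (t₂ - t₁) := by
      rw [mul_inv_eq_iff_eq_mul, ← lower_add]; simp
    rw [e1, mul_assoc, eq_inv_mul_iff_mul_eq, dg_pow, dg_mul_lower]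
    congr 2 <;>
    · push_cast
      field_simp
      ring
  have hy : y = (p₁ * lower s₁ t₁)⁻¹ • dg L L ^ (r + k) • x₁ := by rw [h₁, inv_smul_smul]
  have hx : dg L L ^ r • x₂ = (dg L L ^ k)⁻¹ • dg L L ^ (r + k) • x₂ := by
    rw [smul_smul, pow_add, ((Commute.refl (dg L L)).pow_pow r k).eq,
      inv_mul_cancel_left]
  rw [hx, h₂, hy, hl, pow_add, ((Commute.refl (dg L L)).pow_pow r k).eq]
  simp only [smul_smul]
  congr 1
  group

lemma exists_nearOne_mul {ε₀ : ℝ} (hε₀ : 0 < ε₀) : ∃ ε > 0, ∀ p₁ p₂ s t, NearOne ε p₁ →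
    NearOne ε p₂ → |s| ≤ ε → |t| ≤ ε → NearOne ε₀ (p₂ * lower s t * p₁⁻¹) := by
  have hc : Continuous fun q : (SL3R × SL3R) × (ℝ × ℝ) =>
      q.1.2 * lower q.2.1 q.2.2 * q.1.1⁻¹ := by fun_prop
  have h1 : ∀ᶠ q : (SL3R × SL3R) × (ℝ × ℝ) in 𝓝 ((1, 1), (0, 0)),
      NearOne ε₀ (q.1.2 * lower q.2.1 q.2.2 * q.1.1⁻¹) := by
    refine (hc.tendsto ((1, 1), (0, 0))).eventually ?_
    simp only [lower_zero, mul_one, inv_one]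
    exact nearOne_mem_nhds hε₀
  rw [nhds_prod_eq, nhds_prod_eq] at h1
  obtain ⟨A, hA, B, hB, hAB⟩ := mem_prod_iff.1 h1
  obtain ⟨A₁, hA₁, A₂, hA₂, hAA⟩ := mem_prod_iff.1 hA
  obtain ⟨ε₁, hε₁, h₁⟩ := exists_nearOne_subset hA₁
  obtain ⟨ε₂, hε₂, h₂⟩ := exists_nearOne_subset hA₂
  obtain ⟨ε₃, hε₃, h₃⟩ := Metric.mem_nhds_iff.1 hB
  refine ⟨min (min ε₁ ε₂) (ε₃ / 2), by positivity, fun p₁ p₂ s t hp₁ hp₂ hs ht => ?_⟩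
  refine hAB (a := ((p₁, p₂), (s, t))) ⟨hAA ⟨h₁ _ fun i j => (hp₁ i j).trans_le ?_,
    h₂ _ fun i j => (hp₂ i j).trans_le ?_⟩, h₃ ?_⟩
  · exact (min_le_left _ _).trans (min_le_left _ _)
  · exact (min_le_left _ _).trans (min_le_right _ _)
  · have h4 : min (min ε₁ ε₂) (ε₃ / 2) < ε₃ := (min_le_right _ _).trans_lt (half_lt_self hε₃)
    rw [Metric.mem_ball, Prod.dist_eq, max_lt_iff, Real.dist_eq, Real.dist_eq, sub_zero, sub_zero]
    exact ⟨hs.trans_lt h4, ht.trans_lt h4⟩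

/-- The points at distance about one from the origin. -/
def annulus (θ : ℝ) : Set (ℝ × ℝ) := {q | θ ≤ ‖q‖ ∧ ‖q‖ ≤ 1}

lemma isCompact_annulus (θ : ℝ) : IsCompact (annulus θ) :=
  (isCompact_closedBall (0 : ℝ × ℝ) 1).of_isClosed_subset
    ((isClosed_le continuous_const continuous_norm).inter
      (isClosed_le continuous_norm continuous_const)) fun q hq => by simpa using hq.2

/-- If no two points of `Y` differ by a lower unipotent matrix, then points of a neighborhood
of `Y` do not differ by approximate ones. -/
lemma exists_open_of_no_lower {Y : Set LatticeSpace} (hY : IsCompact Y)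
    (h : ∀ x ∈ Y, ∀ s t, (s, t) ≠ (0, 0) → lower s t • x ∉ Y) {θ : ℝ} (hθ : 0 < θ) :
    ∃ O : Set LatticeSpace, IsOpen O ∧ Y ⊆ O ∧ ∃ ε > 0, ∀ p₁ p₂ s t, NearOne ε p₁ →
      NearOne ε p₂ → (s, t) ∈ annulus θ → ∀ x ∈ O, (p₂ * lower s t * p₁⁻¹) • x ∉ O := by
  have hC : IsCompact ({((1 : SL3R), (1 : SL3R))} ×ˢ annulus θ) :=
    isCompact_singleton.prod (isCompact_annulus θ)
  obtain ⟨N, O, hN, hO, hCN, hYO, hNO⟩ := exists_open_forall_notMem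
    (f := fun q : ((SL3R × SL3R) × (ℝ × ℝ)) × LatticeSpace =>
      (q.1.1.2 * lower q.1.2.1 q.1.2.2 * q.1.1.1⁻¹) • q.2) (by fun_prop) hC hY (by
    rintro ⟨⟨p₁, p₂⟩, s, t⟩ ⟨hp, hq⟩ x hx
    obtain ⟨rfl, rfl⟩ : p₁ = 1 ∧ p₂ = 1 := by simpa using hp
    simp only [one_mul, inv_one, mul_one]
    refine h x hx s t fun h0 => ?_
    have := hq.1
    rw [h0] at this
    simp at this
    linarith)
  obtain ⟨A, B, hA, -, hA1, hB, hAB⟩ := generalized_tube_lemma isCompact_singleton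
    (isCompact_annulus θ) hN hCN
  have hA' : A ∈ 𝓝 ((1 : SL3R), (1 : SL3R)) := hA.mem_nhds (hA1 rfl)
  rw [nhds_prod_eq] at hA'
  obtain ⟨A₁, hA₁, A₂, hA₂, hAA⟩ := mem_prod_iff.1 hA'
  obtain ⟨ε₁, hε₁, h₁⟩ := exists_nearOne_subset hA₁
  obtain ⟨ε₂, hε₂, h₂⟩ := exists_nearOne_subset hA₂
  refine ⟨O, hO, hYO, min ε₁ ε₂, lt_min hε₁ hε₂, fun p₁ p₂ s t hp₁ hp₂ hq x hx => ?_⟩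
  exact hNO ((p₁, p₂), (s, t)) (hAB ⟨hAA ⟨h₁ _ fun i j => (hp₁ i j).trans_le (min_le_left _ _),
    h₂ _ fun i j => (hp₂ i j).trans_le (min_le_right _ _)⟩, hB hq⟩) x hx

lemma abs_le_of_upper_eq {p₁ p₂ : SL3R} {s t a b ε e : ℝ} (h : p₂ * lower s t * p₁⁻¹ = upper a b)
    (hε : ε ≤ 1 / 4) (he : 0 ≤ e) (h₁ : NearOne ε p₁) (h₁' : ∀ i : Fin 3, i ≠ 2 → |p₁.1 i 2| ≤ ε * e)
    (h₂' : ∀ i : Fin 3, i ≠ 2 → |p₂.1 i 2| ≤ ε * e) : |a| ≤ e ∧ |b| ≤ e := by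
  have h' : p₂ * lower s t = upper a b * p₁ := mul_inv_eq_iff_eq_mul.1 h
  have hent : ∀ i, (p₂ * lower s t).1 i 2 = (upper a b * p₁).1 i 2 := fun i => by rw [h']
  have e0 : p₂.1 0 2 = p₁.1 0 2 + a * p₁.1 2 2 := by
    have := hent 0
    rw [coe_mul', coe_mul'] at this
    simpa [lower, upper, Matrix.mul_apply, Fin.sum_univ_three, Matrix.vecMul, dotProduct] using this
  have e1 : p₂.1 1 2 = p₁.1 1 2 + b * p₁.1 2 2 := by
    have := hent 1
    rw [coe_mul', coe_mul'] at this
    simpa [lower, upper, Matrix.mul_apply, Fin.sum_univ_three, Matrix.vecMul, dotProduct] using this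
  have h22 : 3 / 4 ≤ p₁.1 2 2 := by
    have := (abs_lt.1 (h₁ 2 2)).1
    simp at this
    linarith
  have key : ∀ {x u v : ℝ}, u = v + x * p₁.1 2 2 → |v| ≤ ε * e → |u| ≤ ε * e → |x| ≤ e := by
    intro x u v hu hv hw
    have h3 : |x| * p₁.1 2 2 ≤ 2 * (ε * e) := by
      rw [← abs_of_pos (by linarith : 0 < p₁.1 2 2), ← abs_mul, show x * p₁.1 2 2 = u - v by
        rw [hu]; ring]
      exact (abs_sub _ _).trans (by linarith)
    nlinarith [abs_nonneg x, mul_le_mul_of_nonneg_right hε he]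
  exact ⟨key e0 (h₁' 0 (by decide)) (h₂' 0 (by decide)),
    key e1 (h₁' 1 (by decide)) (h₂' 1 (by decide))⟩

/-- The points whose time `n` position lies in a box around `y` of size `Λ ^ (-k)` in the directions
contracted by the dynamics. -/
def box (L : ℝˣ) (ε : ℝ) (n k : ℕ) (y : LatticeSpace) (u v : ℝ) : Set LatticeSpace :=
  {x | ∃ p s t, IsPar p ∧ NearOne ε p ∧ |s - u| * (L ^ 3 : ℝ) ^ k ≤ 1 / 2 ∧
    |t - v| * (L ^ 3 : ℝ) ^ k ≤ 1 / 2 ∧ dg L L ^ n • x = (p * lower s t) • y}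

lemma exists_finset_box_succ {L : ℝˣ} (hL : 1 ≤ (L : ℝ)) (ε : ℝ) (n k : ℕ) (y : LatticeSpace)
    (u v : ℝ) : ∃ F : Finset (Set LatticeSpace), F.card ≤ (⌈(L ^ 3 : ℝ)⌉₊ + 1) ^ 2 ∧
      box L ε n k y u v ⊆ ⋃ C ∈ F, C ∧ ∀ C ∈ F, ∃ u' v', C = box L ε n (k + 1) y u' v' := by
  classical
  set Λ : ℝ := L ^ 3
  have hΛ : 0 < Λ := by positivity
  obtain ⟨T, hT, hT'⟩ := exists_grid ⌈Λ⌉₊ (Nat.ceil_pos.2 hΛ)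
  have hscale : ∀ s u : ℝ, |s - u| * Λ ^ k ≤ 1 / 2 → ∃ w ∈ T,
      |s - (u + (Λ ^ k)⁻¹ * w)| * Λ ^ (k + 1) ≤ 1 / 2 := by
    intro s u h
    obtain ⟨w, hw, hw'⟩ := hT' ((s - u) * Λ ^ k) (by
      rwa [abs_mul, abs_of_pos (by positivity : 0 < Λ ^ k)])
    refine ⟨w, hw, ?_⟩
    have h1 : (s - u) * Λ ^ k - w = (s - (u + (Λ ^ k)⁻¹ * w)) * Λ ^ k := by
      field_simp; ring
    rw [h1, abs_mul, abs_of_pos (by positivity : 0 < Λ ^ k)] at hw'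
    have h2 : 1 / (2 * (⌈Λ⌉₊ : ℝ)) ≤ 1 / (2 * Λ) :=
      one_div_le_one_div_of_le (by positivity) (by linarith [Nat.le_ceil Λ])
    have h3 := hw'.trans h2
    rw [le_div_iff₀ (by positivity)] at h3
    rw [pow_succ]
    linarith
  refine ⟨(T ×ˢ T).image fun w => box L ε n (k + 1) y (u + (Λ ^ k)⁻¹ * w.1) (v + (Λ ^ k)⁻¹ * w.2),
    ?_, ?_, ?_⟩
  · refine Finset.card_image_le.trans ?_
    rw [Finset.card_product, sq]
    exact Nat.mul_le_mul hT hT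
  · rintro x ⟨p, s, t, hp, hpε, hs, ht, hx⟩
    obtain ⟨w₁, hw₁, h₁⟩ := hscale s u hs
    obtain ⟨w₂, hw₂, h₂⟩ := hscale t v ht
    refine Set.mem_iUnion₂.2 ⟨_, Finset.mem_image_of_mem _ (Finset.mk_mem_product hw₁ hw₂), ?_⟩
    exact ⟨p, s, t, hp, hpε, h₁, h₂, hx⟩
  · intro C hC
    obtain ⟨w, -, rfl⟩ := Finset.mem_image.1 hC
    exact ⟨_, _, rfl⟩

lemma abs_sub_mul_le_one {u s₁ s₂ c : ℝ} (hc : 0 < c) (h₁ : |s₁ - u| * c ≤ 1 / 2)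
    (h₂ : |s₂ - u| * c ≤ 1 / 2) : |c * (s₂ - s₁)| ≤ 1 := by
  rw [abs_mul, abs_of_pos hc]
  have : |s₂ - s₁| ≤ |s₂ - u| + |s₁ - u| := by
    rw [show s₂ - s₁ = (s₂ - u) - (s₁ - u) by ring]
    exact abs_sub _ _
  nlinarith

theorem measureReal_le_of_box {μ : Measure LatticeSpace} [IsProbabilityMeasure μ] {L : ℝˣ}
    (hL : 1 ≤ (L : ℝ)) {Z O A : Set LatticeSpace} {ε ε₀ : ℝ} (hε : ε ≤ 1 / 4)
    (hinj : ∀ x ∈ Z, ∀ σ, NearOne ε₀ σ → σ • x ∈ Z → ∃ a b, σ = upper a b)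
    (hO : ∀ p₁ p₂ s t, NearOne ε p₁ → NearOne ε p₂ → (s, t) ∈ annulus (1 / (2 * (L ^ 3 : ℝ))) →
      ∀ x ∈ O, (p₂ * lower s t * p₁⁻¹) • x ∉ O)
    (hσ : ∀ p₁ p₂ s t, NearOne ε p₁ → NearOne ε p₂ → |s| ≤ (L ^ 3 : ℝ)⁻¹ → |t| ≤ (L ^ 3 : ℝ)⁻¹ →
      NearOne ε₀ (p₂ * lower s t * p₁⁻¹))
    (hAZ : A ⊆ Z) {n : ℕ} {P : Finset LatticeSpace} (hP : ∀ x ∈ A, ∃ y ∈ P, x ∈ box L ε n 0 y 0 0)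
    {b : ℝ} (hbad : ∀ x ∈ A, ∃ S : Finset ℕ, S ⊆ Finset.range (n + 1) ∧ (S.card : ℝ) ≤ b ∧
      ∀ k < n + 1, k ∉ S → dg L L ^ (n - k) • x ∈ O) {m : ℝ} (hm : 0 ≤ m)
    (hbox : ∀ y, μ.real (A ∩ orbitBox (fun s => upper s 0) (fun t => upper 0 t)
      ((L ^ 3 : ℝ) ^ n)⁻¹ y) ≤ m) :
    μ.real A ≤ P.card * (2 ^ (n + 1) * ((((⌈(L ^ 3 : ℝ)⌉₊ + 1) ^ 2 : ℕ) : ℝ) ^ b * m)) := by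
  classical
  set Λ : ℝ := L ^ 3
  have hΛ1 : 1 ≤ Λ := one_le_pow₀ hL
  have hΛ : 0 < Λ := by positivity
  set Small : ℕ → Set LatticeSpace → Prop := fun k B => ∃ y u v, B ⊆ box L ε n k y u v
  set PB : Finset (Set LatticeSpace) := P.image fun y => box L ε n 0 y 0 0
  have hPBc : (PB.card : ℝ) ≤ P.card := by exact_mod_cast Finset.card_image_le
  have hmain := measureReal_le_of_branching (μ := μ) (Small := Small) (A := A) (N := n + 1) (L := 1)
    (C := (⌈Λ⌉₊ + 1) ^ 2) (b := b) le_rfl (Nat.one_le_pow _ _ (by omega))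
    (fun k => {x | dg L L ^ (n - k) • x ∉ O})
    (fun x hx => by
      obtain ⟨S, h1, h2, h3⟩ := hbad x hx
      exact ⟨S, h1, h2, fun k hk hkS h => h (h3 k hk hkS)⟩)
    (fun k B B' hB ⟨y, u, v, h⟩ => ⟨y, u, v, hB.trans h⟩) ?_ ?_ PB ?_ ?_ hm ?_
  · refine hmain.trans ?_
    push_cast
    rw [one_pow, one_mul]
    gcongr
  · rintro k hk B hBA hgood ⟨y, u, v, hB⟩
    rcases B.eq_empty_or_nonempty with rfl | ⟨x₁, hx₁⟩
    · exact ⟨∅, by simp, by simp, by simp⟩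
    obtain ⟨p₁, s₁, t₁, hp₁, hp₁ε, hs₁, ht₁, h₁⟩ := hB hx₁
    refine ⟨{B}, by simp, by simp, fun C hC => ?_⟩
    rw [Finset.mem_singleton.1 hC]
    refine ⟨y, s₁, t₁, fun x₂ hx₂ => ?_⟩
    obtain ⟨p₂, s₂, t₂, hp₂, hp₂ε, hs₂, ht₂, h₂⟩ := hB hx₂
    have hn : n - k + k = n := by omega
    rw [← hn] at h₁ h₂
    have hrel := smul_eq_of_box h₁ h₂
    rw [hn] at h₁ h₂
    obtain ⟨-, hq₁, -⟩ := conj_par hL hp₁ hp₁ε k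
    obtain ⟨-, hq₂, -⟩ := conj_par hL hp₂ hp₂ε k
    have hΛk : 0 < Λ ^ k := by positivity
    have hann : (Λ ^ k * (s₂ - s₁), Λ ^ k * (t₂ - t₁)) ∉ annulus (1 / (2 * Λ)) := fun h =>
      hO _ _ _ _ hq₁ hq₂ h _ (not_not.1 (hgood x₁ hx₁)) (by
        rw [← hrel]; exact not_not.1 (hgood x₂ hx₂))
    have hle : ‖(Λ ^ k * (s₂ - s₁), Λ ^ k * (t₂ - t₁))‖ ≤ 1 := by
      rw [Prod.norm_def, max_le_iff]
      exact ⟨abs_sub_mul_le_one hΛk hs₁ hs₂, abs_sub_mul_le_one hΛk ht₁ ht₂⟩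
    have hlt : ‖(Λ ^ k * (s₂ - s₁), Λ ^ k * (t₂ - t₁))‖ < 1 / (2 * Λ) := by
      by_contra! h
      exact hann ⟨h, hle⟩
    rw [Prod.norm_def, max_lt_iff, Real.norm_eq_abs, Real.norm_eq_abs, abs_mul, abs_mul,
      abs_of_pos hΛk, lt_div_iff₀ (by positivity), lt_div_iff₀ (by positivity)] at hlt
    refine ⟨p₂, s₂, t₂, hp₂, hp₂ε, ?_, ?_, h₂⟩
    · rw [pow_succ]; linarith [hlt.1]
    · rw [pow_succ]; linarith [hlt.2]
  · rintro k hk B hBA ⟨y, u, v, hB⟩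
    obtain ⟨F, hF, hcov, hF'⟩ := exists_finset_box_succ hL ε n k y u v
    refine ⟨F, hF, hB.trans hcov, fun C hC => ?_⟩
    obtain ⟨u', v', rfl⟩ := hF' C hC
    exact ⟨y, u', v', subset_rfl⟩
  · intro x hx
    obtain ⟨y, hy, h⟩ := hP x hx
    exact Set.mem_iUnion₂.2 ⟨_, Finset.mem_image_of_mem _ hy, h⟩
  · intro C hC
    obtain ⟨y, -, rfl⟩ := Finset.mem_image.1 hC
    exact ⟨y, 0, 0, subset_rfl⟩
  · rintro B hBA ⟨y, u, v, hB⟩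
    rcases B.eq_empty_or_nonempty with rfl | ⟨x₁, hx₁⟩
    · simpa using hm
    refine (measureReal_mono ?_ (measure_ne_top _ _)).trans (hbox x₁)
    intro x₂ hx₂
    refine ⟨hBA hx₂, ?_⟩
    obtain ⟨p₁, s₁, t₁, hp₁, hp₁ε, hs₁, ht₁, h₁⟩ := hB hx₁
    obtain ⟨p₂, s₂, t₂, hp₂, hp₂ε, hs₂, ht₂, h₂⟩ := hB hx₂
    rw [← zero_add n] at h₁ h₂
    have hrel := smul_eq_of_box h₁ h₂
    rw [pow_zero, one_smul, one_smul] at hrel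
    obtain ⟨-, hq₁, hq₁'⟩ := conj_par hL hp₁ hp₁ε n
    obtain ⟨-, hq₂, hq₂'⟩ := conj_par hL hp₂ hp₂ε n
    have hsc : ∀ {u s₁ s₂ : ℝ}, |s₁ - u| * Λ ^ (n + 1) ≤ 1 / 2 → |s₂ - u| * Λ ^ (n + 1) ≤ 1 / 2 →
        |Λ ^ n * (s₂ - s₁)| ≤ Λ⁻¹ := by
      intro u s₁ s₂ h₁ h₂
      have := abs_sub_mul_le_one (by positivity) h₁ h₂
      rw [pow_succ, mul_right_comm, abs_mul, abs_of_pos hΛ] at this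
      rwa [← one_div, le_div_iff₀ hΛ]
    have hnear := hσ _ _ _ _ hq₁ hq₂ (hsc hs₁ hs₂) (hsc ht₁ ht₂)
    obtain ⟨a, b, hab⟩ := hinj x₁ (hAZ (hBA hx₁)) _ hnear (by rw [← hrel]; exact hAZ (hBA hx₂))
    obtain ⟨ha, hb⟩ := abs_le_of_upper_eq hab hε (by positivity) hq₁ hq₁' hq₂'
    refine ⟨a, b, ha, hb, ?_⟩
    rw [hrel, hab, ← upper_add, add_zero, zero_add]

lemma exists_thick_measureReal_compl_le {μ : Measure LatticeSpace} [IsProbabilityMeasure μ]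
    {a : SL3R} (h : ∀ᵐ x ∂μ, ∃ c > 0, ∀ n : ℕ, a ^ n • x ∈ thick c) {e : ℝ} (he : 0 < e) :
    ∃ c > 0, MeasurableSet {x | ∀ n : ℕ, a ^ n • x ∈ thick c} ∧
      μ.real {x | ∀ n : ℕ, a ^ n • x ∈ thick c}ᶜ ≤ e := by
  have hcl : ∀ c, IsClosed {x : LatticeSpace | ∀ n : ℕ, a ^ n • x ∈ thick c} := fun c => by
    rw [Set.ofPred_forall]
    exact isClosed_iInter fun n => (isClosed_thick c).preimage (continuous_const_smul _)
  set T : ℕ → Set LatticeSpace := fun m => {x | ∀ n : ℕ, a ^ n • x ∈ thick (1 / ((m : ℝ) + 1))}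
  have hmono : Monotone T := fun m m' hm x hx n =>
    thick_anti (one_div_le_one_div_of_le (by positivity) (by gcongr)) (hx n)
  have hlim : Tendsto (fun m => μ.real (T m)) atTop (𝓝 (μ.real (⋃ m, T m))) :=
    (ENNReal.tendsto_toReal (measure_ne_top _ _)).comp (tendsto_measure_iUnion_atTop hmono)
  have huniv : μ.real (⋃ m, T m) = 1 := by
    rw [measureReal_def, (prob_compl_eq_zero_iff (MeasurableSet.iUnion fun m =>
      (hcl _).measurableSet)).1 ?_, ENNReal.toReal_one]
    refine (measure_mono_null ?_ (ae_iff.1 h))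
    rintro x hx ⟨c, hc, hxc⟩
    obtain ⟨m, hm⟩ := exists_nat_one_div_lt hc
    exact hx (Set.mem_iUnion.2 ⟨m, fun n => thick_anti hm.le (hxc n)⟩)
  rw [huniv] at hlim
  obtain ⟨m, hm⟩ := (hlim.eventually (lt_mem_nhds (by linarith : 1 - e < 1))).exists
  refine ⟨1 / ((m : ℝ) + 1), by positivity, (hcl _).measurableSet, ?_⟩
  rw [measureReal_compl (hcl _).measurableSet, probReal_univ]
  change 1 - μ.real (T m) ≤ e
  linarith

lemma exists_isCompact_measureReal_compl_lt {ν : Measure LatticeSpace} [IsProbabilityMeasure ν]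
    {Y : Set LatticeSpace} (hY : MeasurableSet Y) {δ : ℝ} (hδ : ν.real Yᶜ < δ) :
    ∃ K ⊆ Y, IsCompact K ∧ ν.real Kᶜ < δ := by
  obtain ⟨K, hKY, hK, h⟩ := hY.exists_isCompact_sdiff_lt (measure_ne_top ν Y)
    (ε := ENNReal.ofReal (δ - ν.real Yᶜ)) (by simpa using hδ)
  refine ⟨K, hKY, hK, ?_⟩
  have h1 : Kᶜ ⊆ Yᶜ ∪ Y \ K := fun x hx => by
    by_cases h : x ∈ Y
    · exact Or.inr ⟨h, hx⟩
    · exact Or.inl h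
  have h2 := (measureReal_mono h1 (measure_ne_top ν _)).trans (measureReal_union_le _ _)
  have h3 : ν.real (Y \ K) < δ - ν.real Yᶜ :=
    (ENNReal.lt_ofReal_iff_toReal_lt (measure_ne_top _ _)).1 h
  linarith

lemma exists_forall_scale {κ ε : ℝ} (hκ : 0 < κ) (hε : 0 < ε) : ∃ Λ₁ > 1, ∀ L : ℝ, Λ₁ ≤ L →
    2 * (((⌈L ^ 3⌉₊ + 1) ^ 2 : ℕ) : ℝ) ^ (κ / 8) * ((L ^ 3)⁻¹) ^ κ < 1 ∧ (L ^ 3)⁻¹ ≤ ε := by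
  have h3 : Tendsto (fun L : ℝ => L ^ 3) atTop atTop := tendsto_pow_atTop (by norm_num)
  have h1 : Tendsto (fun L : ℝ => 2 * 9 ^ (κ / 8) * (L ^ 3) ^ (-(3 * κ / 4))) atTop (𝓝 0) := by
    simpa using ((tendsto_rpow_neg_atTop (by positivity : 0 < 3 * κ / 4)).comp h3).const_mul
      (2 * 9 ^ (κ / 8))
  have h2 : Tendsto (fun L : ℝ => (L ^ 3)⁻¹) atTop (𝓝 0) := tendsto_inv_atTop_zero.comp h3
  obtain ⟨Λ₁, h⟩ := eventually_atTop.1 ((h1.eventually (gt_mem_nhds one_pos)).and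
    (h2.eventually (ge_mem_nhds hε)))
  refine ⟨max Λ₁ 2, lt_max_of_lt_right one_lt_two, fun L hL => ?_⟩
  obtain ⟨h4, h5⟩ := h L ((le_max_left _ _).trans hL)
  refine ⟨lt_of_le_of_lt ?_ h4, h5⟩
  set Λ : ℝ := L ^ 3
  have hΛ1 : 1 ≤ Λ := one_le_pow₀ (one_le_two.trans ((le_max_right _ _).trans hL))
  have hΛ : 0 < Λ := by positivity
  have h6 : (((⌈Λ⌉₊ + 1) ^ 2 : ℕ) : ℝ) ≤ 9 * Λ ^ (2 : ℝ) := by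
    push_cast
    have : (⌈Λ⌉₊ : ℝ) + 1 ≤ 3 * Λ := by linarith [Nat.ceil_lt_add_one hΛ.le]
    rw [Real.rpow_two]
    nlinarith
  have h7 : (((⌈Λ⌉₊ + 1) ^ 2 : ℕ) : ℝ) ^ (κ / 8) ≤ 9 ^ (κ / 8) * Λ ^ (κ / 4) := by
    refine (Real.rpow_le_rpow (by positivity) h6 (by positivity)).trans_eq ?_
    rw [Real.mul_rpow (by norm_num) (by positivity), ← Real.rpow_mul hΛ.le]
    congr 2; ring
  rw [Real.inv_rpow hΛ.le, ← Real.rpow_neg hΛ.le]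
  calc 2 * (((⌈Λ⌉₊ + 1) ^ 2 : ℕ) : ℝ) ^ (κ / 8) * Λ ^ (-κ)
      ≤ 2 * (9 ^ (κ / 8) * Λ ^ (κ / 4)) * Λ ^ (-κ) := by gcongr
    _ = 2 * 9 ^ (κ / 8) * (Λ ^ (κ / 4) * Λ ^ (-κ)) := by ring
    _ = _ := by rw [← Real.rpow_add hΛ]; congr 2; ring

lemma tendsto_count {C Λ β κ P K : ℝ} (hC : 0 ≤ C) (hΛ : 0 < Λ) (h : 2 * C ^ β * (Λ⁻¹) ^ κ < 1) :
    Tendsto (fun n : ℕ => P * (2 ^ (n + 1) * (C ^ (β * ((n + 1 : ℕ) : ℝ)) *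
      (K * ((Λ ^ n)⁻¹) ^ κ)))) atTop (𝓝 0) := by
  have h1 : Tendsto (fun n : ℕ => P * K * (2 * C ^ β) * (2 * C ^ β * (Λ⁻¹) ^ κ) ^ n) atTop (𝓝 0) := by
    simpa using (tendsto_pow_atTop_nhds_zero_of_lt_one (by positivity) h).const_mul
      (P * K * (2 * C ^ β))
  refine h1.congr fun n => ?_
  rw [Real.rpow_mul hC, Real.rpow_natCast, ← inv_pow, ← Real.rpow_pow_comm (by positivity)]
  ring

theorem exists_lower_pair {κ ε₀ : ℝ} (hκ : 0 < κ) (hε₀ : 0 < ε₀) {Z : Set LatticeSpace}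
    (hinj : ∀ x ∈ Z, ∀ σ, NearOne ε₀ σ → σ • x ∈ Z → ∃ a b, σ = upper a b) :
    ∃ Λ₁ > 1, ∀ L : ℝˣ, Λ₁ ≤ (L : ℝ) → ∀ (μ : Measure LatticeSpace) [IsProbabilityMeasure μ],
      (∀ᵐ x ∂μ, x ∈ Z) → BoxDim (fun s => upper s 0) (fun t => upper 0 t) μ κ →
      (∀ᵐ x ∂μ, ∃ c > 0, ∀ n : ℕ, dg L L ^ n • x ∈ thick c) →
      ∃ δ > 0, ∀ (ν : Measure LatticeSpace) [IsProbabilityMeasure ν],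
        (∀ O, IsOpen O → ∀ c < ν.real O, ∃ᶠ n in atTop, c < (avgMeasure (dg L L) μ n).real O) →
        ∀ Y, MeasurableSet Y → ν.real Yᶜ < δ → ∃ x ∈ Y, ∃ s t, (s, t) ≠ (0, 0) ∧
          lower s t • x ∈ Y := by
  classical
  obtain ⟨ε₁, hε₁, hσ⟩ := exists_nearOne_mul hε₀
  obtain ⟨Λ₁, hΛ₁, hscale⟩ := exists_forall_scale hκ hε₁
  refine ⟨Λ₁, hΛ₁, fun L hL μ _ hZ hdim hthick => ?_⟩
  obtain ⟨hcount, hLε⟩ := hscale L hL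
  have hL1 : 1 ≤ (L : ℝ) := hΛ₁.le.trans hL
  obtain ⟨β, hβ⟩ : ∃ β, β = κ / 8 := ⟨_, rfl⟩
  rw [← hβ] at hcount
  have hβ0 : 0 < β := by linarith
  have hΛ : 0 < (L ^ 3 : ℝ) := by positivity
  obtain ⟨D, hDm, hDμ, K, r₁, hK, hr₁, hD⟩ := hdim
  obtain ⟨c, hc, hTm, hTμ⟩ := exists_thick_measureReal_compl_le hthick (e := 1 / 16) (by norm_num)
  refine ⟨β / 16, by positivity, fun ν _ hlim Y hYm hYν => ?_⟩
  by_contra! hno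
  obtain ⟨Y', hY'Y, hY'c, hY'ν⟩ := exists_isCompact_measureReal_compl_lt hYm hYν
  obtain ⟨O, hO, hY'O, ε₂, hε₂, hOε⟩ := exists_open_of_no_lower hY'c
    (fun x hx s t hst h => hno x (hY'Y hx) s t hst (hY'Y h))
    (θ := 1 / (2 * (L ^ 3 : ℝ))) (by positivity)
  obtain ⟨ε, hε⟩ : ∃ ε, ε = min (min ε₁ ε₂) (1 / 4) := ⟨_, rfl⟩
  have hε0 : 0 < ε := by rw [hε]; positivity
  have hεε₁ : ε ≤ ε₁ := by rw [hε]; exact (min_le_left _ _).trans (min_le_left _ _)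
  have hεε₂ : ε ≤ ε₂ := by rw [hε]; exact (min_le_left _ _).trans (min_le_right _ _)
  obtain ⟨V, hVo, h1V, hV⟩ := exists_factor_nhds hε0 (η := 1 / 2) (by norm_num)
  obtain ⟨P, hP⟩ := exists_finset_cover (isCompact_thick hc) hVo h1V
  set T : Set LatticeSpace := {x | ∀ n : ℕ, dg L L ^ n • x ∈ thick c}
  have hOν : 1 - β / 16 < ν.real O := by
    rw [measureReal_compl hY'c.measurableSet, probReal_univ] at hY'ν
    have := measureReal_mono (μ := ν) hY'O (measure_ne_top _ _)
    linarith
  have hev := (tendsto_count (P := P.card) (K := K) (Nat.cast_nonneg _) hΛ hcount).eventually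
    (gt_mem_nhds (by norm_num : (0 : ℝ) < 1 / 2))
  have hr : ∀ᶠ n : ℕ in atTop, ((L ^ 3 : ℝ) ^ n)⁻¹ ≤ r₁ :=
    ((tendsto_inv_atTop_zero.comp (tendsto_pow_atTop_atTop_of_one_lt
      (one_lt_pow₀ (hΛ₁.trans_le hL) (by norm_num)))).eventually (ge_mem_nhds hr₁))
  obtain ⟨n, hn, hnlt, hnr⟩ := ((hlim O hO _ hOν).and_eventually (hev.and hr)).exists
  set Bad : ℕ → Set LatticeSpace := fun k => {x | dg L L ^ (n - k) • x ∉ O}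
  have hBadm : ∀ k, MeasurableSet (Bad k) := fun k =>
    (hO.preimage (continuous_const_smul (dg L L ^ (n - k)))).measurableSet.compl
  set Ω : Set LatticeSpace :=
    {x | β * (n + 1 : ℕ) < (((Finset.range (n + 1)).filter fun k => x ∈ Bad k).card : ℝ)}
  have hΩ : μ.real Ω ≤ 1 / 16 := by
    have := measureReal_lt_card_filter_le (μ := μ) hBadm (N := n + 1) (δ := β / 16) (by omega) hβ0 ?_
    swap
    · have h1 : ∑ k ∈ Finset.range (n + 1), μ.real (Bad k) =
          ∑ k ∈ Finset.range (n + 1), (1 - μ.real {x | dg L L ^ k • x ∈ O}) := by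
        rw [← Finset.sum_range_reflect]
        refine Finset.sum_congr rfl fun k hk => ?_
        have hk' := Finset.mem_range.1 hk
        have h2 : MeasurableSet {x : LatticeSpace | dg L L ^ k • x ∈ O} :=
          (hO.preimage (continuous_const_smul (dg L L ^ k))).measurableSet
        rw [← probReal_univ (μ := μ), ← measureReal_compl h2]
        simp only [Bad, show n - (n + 1 - 1 - k) = k by omega]
        rfl
      rw [measureReal_avgMeasure _ _ _ hO.measurableSet, ← div_eq_inv_mul,
        lt_div_iff₀ (by positivity)] at hn
      rw [h1, Finset.sum_sub_distrib]
      simp only [Finset.sum_const, Finset.card_range, nsmul_eq_mul, mul_one]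
      linarith
    refine this.trans (le_of_eq ?_)
    field_simp
  set A : Set LatticeSpace := D ∩ Z ∩ T ∩ Ωᶜ
  have hA : 1 / 2 ≤ μ.real A := by
    have h1 : (Set.univ : Set LatticeSpace) ⊆ A ∪ (Dᶜ ∪ (Zᶜ ∪ (Tᶜ ∪ Ω))) := by
      intro x _
      by_cases hx1 : x ∈ D <;> by_cases hx2 : x ∈ Z <;> by_cases hx3 : x ∈ T <;>
        by_cases hx4 : x ∈ Ω <;> simp [A, hx1, hx2, hx3, hx4]
    have h2 := measureReal_mono (μ := μ) h1 (measure_ne_top _ _)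
    rw [probReal_univ] at h2
    have h3 := measureReal_union_le (μ := μ) A (Dᶜ ∪ (Zᶜ ∪ (Tᶜ ∪ Ω)))
    have h4 := measureReal_union_le (μ := μ) Dᶜ (Zᶜ ∪ (Tᶜ ∪ Ω))
    have h5 := measureReal_union_le (μ := μ) Zᶜ (Tᶜ ∪ Ω)
    have h6 := measureReal_union_le (μ := μ) Tᶜ Ω
    have h7 : μ.real Zᶜ = 0 := by
      rw [measureReal_def, show μ Zᶜ = 0 from ae_iff.1 hZ]; rfl
    rw [measureReal_compl hDm, probReal_univ] at h4
    linarith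
  refine absurd (hA.trans (measureReal_le_of_box hL1 (Z := Z) (O := O) (ε := ε) (ε₀ := ε₀)
    (b := β * (n + 1 : ℕ)) (n := n) (P := P) (by rw [hε]; exact min_le_right _ _) hinj ?_ ?_
    (fun x hx => hx.1.1.2) ?_ ?_ (by positivity)
    (fun y => (measureReal_mono (Set.inter_subset_inter_left _ fun x hx => hx.1.1.1)
      (measure_ne_top _ _)).trans (hD _ (by positivity) hnr y)))) (not_le.2 hnlt)
  · intro p₁ p₂ s t h1 h2
    exact hOε p₁ p₂ s t (fun i j => (h1 i j).trans_le hεε₂) (fun i j => (h2 i j).trans_le hεε₂)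
  · intro p₁ p₂ s t h1 h2 hs ht
    exact hσ p₁ p₂ s t (fun i j => (h1 i j).trans_le hεε₁) (fun i j => (h2 i j).trans_le hεε₁)
      (hs.trans hLε) (ht.trans hLε)
  · intro x hx
    obtain ⟨y, hy, g, hg, hxy⟩ := hP _ (hx.1.2 n)
    obtain ⟨p, s, t, hp, hpε, hs, ht, rfl⟩ := hV g hg
    exact ⟨y, hy, p, s, t, hp, hpε, by simpa using hs, by simpa using ht, hxy⟩
  · intro x hx
    refine ⟨(Finset.range (n + 1)).filter fun k => x ∈ Bad k, Finset.filter_subset _ _,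
      not_lt.1 hx.2, fun k hk hkS => ?_⟩
    by_contra h
    exact hkS (Finset.mem_filter.2 ⟨Finset.mem_range.2 hk, h⟩)

lemma measurePreserving_inv_smul {ν : Measure LatticeSpace} {a : SL3R}
    (h : MeasurePreserving (a • ·) ν ν) : MeasurePreserving (a⁻¹ • ·) ν ν :=
  MeasurePreserving.symm (Homeomorph.smul a).toMeasurableEquiv h

lemma measurePreserving_mul_smul {ν : Measure LatticeSpace} {a b : SL3R}
    (ha : MeasurePreserving (a • ·) ν ν) (hb : MeasurePreserving (b • ·) ν ν) :
    MeasurePreserving ((a * b) • ·) ν ν := by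
  simpa [Function.comp_def, mul_smul] using ha.comp hb

lemma measurePreserving_pow_smul {ν : Measure LatticeSpace} {a : SL3R}
    (ha : MeasurePreserving (a • ·) ν ν) (n : ℕ) : MeasurePreserving (a ^ n • ·) ν ν := by
  induction n with
  | zero => simpa using! MeasurePreserving.id ν
  | succ n ih => exact pow_succ a n ▸ measurePreserving_mul_smul ih ha

lemma isClosed_forall_pow_smul_mem_thick (a : SL3R) (c : ℝ) :
    IsClosed {x : LatticeSpace | ∀ n : ℕ, a ^ n • x ∈ thick c} := by
  rw [Set.ofPred_forall]
  exact isClosed_iInter fun n => (isClosed_thick c).preimage (continuous_const_smul _)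

lemma ae_exists_forall_zpow_smul_mem_thick {ν : Measure LatticeSpace} [IsProbabilityMeasure ν]
    {a : SL3R} (ha : MeasurePreserving (a • ·) ν ν)
    (h : ∀ ε > 0, ∃ c > 0, ν.real {x | ∀ n : ℕ, a ^ n • x ∈ thick c}ᶜ ≤ ε) :
    ∀ᵐ x ∂ν, ∃ m : ℕ, ∀ k : ℤ, a ^ k • x ∈ thick (1 / ((m : ℝ) + 1)) := by
  suffices H : ∀ ε : ℝ, 0 < ε → ν.real {x | ¬ ∃ m : ℕ, ∀ k : ℤ,
      a ^ k • x ∈ thick (1 / ((m : ℝ) + 1))} ≤ ε by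
    rw [ae_iff]
    exact (measureReal_eq_zero_iff (measure_ne_top _ _)).1
      (le_antisymm (le_of_forall_pos_le_add fun ε hε => by simpa using H ε hε) measureReal_nonneg)
  intro ε hε
  obtain ⟨c, hc, hcε⟩ := h ε hε
  set T : Set LatticeSpace := {x | ∀ n : ℕ, a ^ n • x ∈ thick c}
  have hT : MeasurableSet T := (isClosed_forall_pow_smul_mem_thick a c).measurableSet
  set F : ℕ → Set LatticeSpace := fun j => (a⁻¹ ^ j • ·) ⁻¹' Tᶜ
  have hF : ∀ j, ν.real (F j) ≤ ε := fun j => by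
    rw [(measurePreserving_pow_smul (measurePreserving_inv_smul ha) j).measureReal_preimage
      hT.compl.nullMeasurableSet]
    exact hcε
  have hmono : Monotone F := monotone_nat_of_le_succ fun j x hx => by
    contrapose! hx
    simp only [F, Set.mem_preimage, Set.mem_compl_iff, not_not] at hx ⊢
    intro n
    have := hx (n + 1)
    rwa [pow_succ a, pow_succ' a⁻¹, mul_smul, mul_smul, smul_inv_smul] at this
  have hlim : Tendsto (fun j => ν.real (F j)) atTop (𝓝 (ν.real (⋃ j, F j))) :=
    (ENNReal.tendsto_toReal (measure_ne_top _ _)).comp (tendsto_measure_iUnion_atTop hmono)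
  refine (measureReal_mono ?_ (measure_ne_top _ _)).trans (le_of_tendsto' hlim hF)
  intro x hx
  by_contra hxF
  simp only [F, Set.mem_iUnion, Set.mem_preimage, Set.mem_compl_iff, not_exists, not_not] at hxF
  obtain ⟨m, hm⟩ := exists_nat_one_div_lt hc
  refine hx ⟨m, fun k => thick_anti hm.le ?_⟩
  have h1 := hxF k.natAbs (k + k.natAbs).toNat
  rw [← mul_smul, ← zpow_natCast, ← zpow_natCast, inv_zpow', ← zpow_add] at h1
  convert h1 using 3
  omega

theorem false_of_lower_pair {L : ℝˣ} (hL : 1 < (L : ℝ)) {μ : Measure LatticeSpace}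
    [IsProbabilityMeasure μ] (hg : MeasurePreserving (dg (L ^ 3) (L ^ 3)⁻¹ • ·) μ μ)
    (hthick : ∀ᵐ x ∂μ, ∃ c > 0, ∀ n : ℕ, dg L L ^ n • x ∈ thick c)
    (h₁ : PairProp (X := LatticeSpace) (fun s => upper s 0) μ)
    (h₂ : PairProp (X := LatticeSpace) (fun t => upper 0 t) μ) {δ : ℝ} (hδ : 0 < δ)
    (hpair : ∀ (ν : Measure LatticeSpace) [IsProbabilityMeasure ν],
        (∀ O, IsOpen O → ∀ c < ν.real O, ∃ᶠ n in atTop, c < (avgMeasure (dg L L) μ n).real O) →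
        ∀ Y, MeasurableSet Y → ν.real Yᶜ < δ → ∃ x ∈ Y, ∃ s t, (s, t) ≠ (0, 0) ∧
          lower s t • x ∈ Y) : False := by
  set a := dg L L with ha
  set g := dg (L ^ 3) (L ^ 3)⁻¹ with hgdef
  have hL0 : (L : ℝ) ≠ 0 := L.ne_zero
  have hd : |((L : ℝ) ^ 6)⁻¹| < 1 := by
    rw [abs_of_nonneg (by positivity)]
    exact inv_lt_one_of_one_lt₀ (one_lt_pow₀ hL (by norm_num))
  have hd' : |((L : ℝ) ^ 3)⁻¹| < 1 := by
    rw [abs_of_nonneg (by positivity)]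
    exact inv_lt_one_of_one_lt₀ (one_lt_pow₀ hL (by norm_num))
  have hag : Commute a g := dg_commute _ _ _ _
  obtain ⟨ν, hν, haν, hgν, hlim⟩ := exists_limit_avgMeasure (X := LatticeSpace) hag hg
    (fun ε hε => by
      obtain ⟨c, hc, hm, h⟩ := exists_thick_measureReal_compl_le hthick hε
      refine ⟨thick c, isCompact_thick hc, fun k => (measureReal_mono ?_ (measure_ne_top _ _)).trans h⟩
      exact fun x hx hx' => hx (hx' k))
  have hνthick : ∀ ε > 0, ∃ c > 0, ν.real {x | ∀ n : ℕ, a ^ n • x ∈ thick c}ᶜ ≤ ε := by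
    intro ε hε
    obtain ⟨c, hc, hm, h⟩ := exists_thick_measureReal_compl_le hthick hε
    refine ⟨c, hc, not_lt.1 fun hlt => ?_⟩
    have hO := (isClosed_forall_pow_smul_mem_thick a c).isOpen_compl
    obtain ⟨n, hn⟩ := (hlim _ hO _ hlt).exists
    obtain ⟨k, hk⟩ := exists_lt_of_lt_avgMeasure hO hn
    refine absurd (h.trans_lt hk) (not_lt.2 (measureReal_mono ?_ (measure_ne_top _ _)))
    intro x hx hx'
    refine hx fun n => ?_
    rw [← mul_smul, ← pow_add]
    exact hx' _
  have hae := ae_exists_forall_zpow_smul_mem_thick haν hνthick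
  have hK : ∀ m : ℕ, IsCompact (thick (1 / ((m : ℝ) + 1))) := fun m =>
    isCompact_thick (by positivity)
  have haν' := measurePreserving_inv_smul haν
  have hgν' := measurePreserving_inv_smul hgν
  obtain ⟨N, hN, hagree⟩ := exists_seq_ae_mem_agreeSet haν haν' hK hae
  set A := agreeSet a N fun m : ℕ => thick (1 / ((m : ℝ) + 1)) with hA
  obtain ⟨Y, hYA, hYc, hYν⟩ : ∃ Y ⊆ A, IsCompact Y ∧ ν.real Yᶜ < δ / 3 / 16 := by
    have h0 : ν Aᶜ = 0 := hagree
    set Y₀ := (toMeasurable ν Aᶜ)ᶜ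
    have hY₀ : MeasurableSet Y₀ := (measurableSet_toMeasurable _ _).compl
    obtain ⟨Y, hY, hYc, h⟩ := exists_isCompact_measureReal_compl_lt (ν := ν) hY₀
      (δ := δ / 3 / 16) (by
        rw [compl_compl, measureReal_def, measure_toMeasurable, h0]; simpa using by positivity)
    exact ⟨Y, hY.trans (Set.compl_subset_comm.1 (subset_toMeasurable _ _)), hYc, h⟩
  have hp₁ : PairProp (X := LatticeSpace) (fun s => upper s 0) ν :=
    PairProp.of_limit (continuous_upper continuous_id' continuous_const) (h := g) hag (fun s => by
      rw [ha, hgdef, dg_inv, ← dg_mul, commute_iff_eq, dg_mul_upper]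
      congr 2
      · push_cast; field_simp
      · simp) hg hlim h₁
  have hp₂ : PairProp (X := LatticeSpace) (fun t => upper 0 t) ν :=
    PairProp.of_limit (continuous_upper continuous_const continuous_id') (h := g⁻¹) hag.inv_right
      (fun s => by
        rw [ha, hgdef, inv_inv, ← dg_mul, commute_iff_eq, dg_mul_upper]
        congr 2
        · simp
        · push_cast; field_simp) (measurePreserving_inv_smul hg) hlim h₂
  obtain ⟨Y₁, hY₁m, hY₁ν, hY₁⟩ := PairProp.exists_four_points (b := a * g)
    (ℓ' := fun p => lower p 0) (d := ((L : ℝ) ^ 6)⁻¹)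
    (measurePreserving_mul_smul haν hgν)
    (measurePreserving_inv_smul (measurePreserving_mul_smul haν hgν))
    (continuous_upper continuous_id' continuous_const)
    (fun s t => by simpa using upper_add s 0 t 0) hd
    (fun s => by
      rw [ha, hgdef, ← dg_mul, dg_inv, dg_mul_upper]
      congr 2
      · push_cast; field_simp
      · simp)
    (continuous_lower continuous_id' continuous_const) lower_zero
    (fun p => by
      rw [ha, hgdef, ← dg_mul, dg_mul_lower]
      congr 2
      · push_cast; field_simp
      · simp) hp₁ (δ := δ / 3) (by positivity) hYc hYν.le
  obtain ⟨Y₂, hY₂m, hY₂ν, hY₂⟩ := PairProp.exists_four_points (b := a * g⁻¹)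
    (ℓ' := fun p => lower 0 p) (d := ((L : ℝ) ^ 6)⁻¹)
    (measurePreserving_mul_smul haν hgν')
    (measurePreserving_inv_smul (measurePreserving_mul_smul haν hgν'))
    (continuous_upper continuous_const continuous_id')
    (fun s t => by simpa using upper_add 0 s 0 t) hd
    (fun s => by
      rw [ha, hgdef, dg_inv, ← dg_mul, dg_inv, dg_mul_upper]
      congr 2
      · simp
      · push_cast; field_simp)
    (continuous_lower continuous_const continuous_id') lower_zero
    (fun p => by
      rw [ha, hgdef, dg_inv, ← dg_mul, dg_mul_lower]
      congr 2
      · simp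
      · push_cast; field_simp) hp₂ (δ := δ / 3) (by positivity) hYc hYν.le
  obtain ⟨x, ⟨hx₁, hx₂⟩, p, q, hpq, hy₁, hy₂⟩ := hpair ν hlim (Y₁ ∩ Y₂) (hY₁m.inter hY₂m) (by
    rw [Set.compl_inter]
    linarith [measureReal_union_le (μ := ν) Y₁ᶜ Y₂ᶜ])
  by_cases hq : q = 0
  · have hp : p ≠ 0 := by rintro rfl; exact hpq (by rw [hq])
    obtain ⟨z, s, hs, hz, hℓz, huz, hℓuz⟩ := hY₂ x hx₂ q (lower p 0) (by
      rw [ha, hgdef, dg_inv, ← dg_mul, commute_iff_eq, dg_mul_lower]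
      congr 2
      · push_cast; field_simp
      · simp) (by
      rw [← mul_smul, ← lower_add]
      simpa using hy₂)
    refine not_four_points_mem_agreeSet (X := LatticeSpace) (a := a) (c := shear₂₁ (-(s * p)))
      (u := fun t => upper 0 t) (ℓ := fun t => lower t 0) (q := p) (s := s)
      (d := ((L : ℝ) ^ 3)⁻¹) (continuous_upper continuous_const continuous_id')
      (fun s t => by simpa using upper_add 0 s 0 t)
      (continuous_lower continuous_id' continuous_const)
      (fun s t => by simpa using lower_add s 0 t 0) hd' ?_ ?_ (dg_commute_shear₂₁ L _)
      (lower_mul_upper_snd p s) hN hK (fun m x _ => exists_zpow_smul_shear₂₁_notMem_thick hL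
        (by positivity) (by simp [hs.ne', hp]) x) (hYA hz) (hYA hℓz) (hYA huz) (hYA hℓuz)
    · intro t
      rw [ha, dg_inv, dg_mul_upper]
      congr 2
      · simp
      · push_cast; field_simp
    · intro t
      rw [ha, dg_mul_lower]
      congr 2
      field_simp
      simp
  · obtain ⟨z, s, hs, hz, hℓz, huz, hℓuz⟩ := hY₁ x hx₁ p (lower 0 q) (by
      rw [ha, hgdef, ← dg_mul, commute_iff_eq, dg_mul_lower]
      congr 2
      · simp
      · push_cast; field_simp) (by
      rw [← mul_smul, ← lower_add]
      simpa using hy₁)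
    refine not_four_points_mem_agreeSet (X := LatticeSpace) (a := a) (c := shear₁₂ (-(s * q)))
      (u := fun t => upper t 0) (ℓ := fun t => lower 0 t) (q := q) (s := s)
      (d := ((L : ℝ) ^ 3)⁻¹) (continuous_upper continuous_id' continuous_const)
      (fun s t => by simpa using upper_add s 0 t 0)
      (continuous_lower continuous_const continuous_id')
      (fun s t => by simpa using lower_add 0 s 0 t) hd' ?_ ?_ (dg_commute_shear₁₂ L _)
      (lower_mul_upper_fst q s) hN hK (fun m x _ => exists_zpow_smul_shear₁₂_notMem_thick hL
        (by positivity) (by simp [hs.ne', hq]) x) (hYA hz) (hYA hℓz) (hYA huz) (hYA hℓuz)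
    · intro t
      rw [ha, dg_inv, dg_mul_upper]
      congr 2
      · push_cast; field_simp
      · simp
    · intro t
      rw [ha, dg_mul_lower]
      congr 2 <;> field_simp
      simp

/-- The block diagonal matrices with blocks `h` and `1`. -/
def blk (h : Matrix.SpecialLinearGroup (Fin 2) ℝ) : SL3R :=
  ⟨!![h.1 0 0, h.1 0 1, 0; h.1 1 0, h.1 1 1, 0; 0, 0, 1], by
    have := h.2
    rw [Matrix.det_fin_two] at this
    simp [Matrix.det_fin_three, this]⟩

/-- The lattice spanned by the vectors `(h m, 0)`, for integral `m`, and `(h v, 1)`. -/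
def affLat (h : Matrix.SpecialLinearGroup (Fin 2) ℝ) (v : Fin 2 → ℝ) : LatticeSpace :=
  ((blk h * upper (v 0) (v 1) : SL3R) : LatticeSpace)

variable {h : Matrix.SpecialLinearGroup (Fin 2) ℝ}

lemma blk_mul_upper (s t : ℝ) : blk h * upper s t =
    upper (h.1 0 0 * s + h.1 0 1 * t) (h.1 1 0 * s + h.1 1 1 * t) * blk h := by
  refine ext_entries fun i j => ?_
  rw [coe_mul', coe_mul']
  fin_cases i <;> fin_cases j <;> simp [blk, upper, Matrix.mul_apply, Fin.sum_univ_three]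

lemma det_entries : h.1 0 0 * h.1 1 1 - h.1 0 1 * h.1 1 0 = 1 := by
  rw [← Matrix.det_fin_two, h.2]

lemma upper_smul_affLat (v w : Fin 2 → ℝ) :
    upper (h.1 0 0 * w 0 + h.1 0 1 * w 1) (h.1 1 0 * w 0 + h.1 1 1 * w 1) • affLat h v =
      affLat h (v + w) := by
  change ((upper _ _ * (blk h * upper _ _) : SL3R) : LatticeSpace) = _
  rw [← mul_assoc, ← blk_mul_upper, mul_assoc, ← upper_add, affLat, add_comm (w 0), add_comm (w 1)]
  rfl

lemma mk_mul_intCast {g σ : SL3R} (hσ : σ ∈ SL3Z) :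
    ((g * σ : SL3R) : LatticeSpace) = (g : LatticeSpace) :=
  QuotientGroup.mk_mul_of_mem g hσ

lemma map_intCast_entry {n : ℕ} (δ : Matrix.SpecialLinearGroup (Fin n) ℤ) (i j : Fin n) :
    (Matrix.SpecialLinearGroup.map (Int.castRingHom ℝ) δ).1 i j = δ.1 i j := rfl

lemma upper_mem_SL3Z (m n : ℤ) : upper m n ∈ SL3Z := by
  refine ⟨⟨!![1, 0, m; 0, 1, n; 0, 0, 1], by simp [Matrix.det_fin_three]⟩, ext_entries fun i j => ?_⟩
  refine (map_intCast_entry _ i j).trans ?_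
  fin_cases i <;> fin_cases j <;> simp [upper]

lemma blk_mem_SL3Z (γ : Matrix.SpecialLinearGroup (Fin 2) ℤ) :
    blk (γ.map (Int.castRingHom ℝ)) ∈ SL3Z := by
  refine ⟨⟨!![γ.1 0 0, γ.1 0 1, 0; γ.1 1 0, γ.1 1 1, 0; 0, 0, 1], ?_⟩, ext_entries fun i j => ?_⟩
  · have := γ.2
    rw [Matrix.det_fin_two] at this
    simp [Matrix.det_fin_three, this]
  · refine (map_intCast_entry _ i j).trans ?_
    fin_cases i <;> fin_cases j <;> simp [blk]

lemma affLat_add_intCast (v : Fin 2 → ℝ) (n : Fin 2 → ℤ) :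
    affLat h (fun i => v i + n i) = affLat h v := by
  rw [affLat, upper_add, ← mul_assoc, mk_mul_intCast (upper_mem_SL3Z _ _)]
  rfl

lemma dg_smul_affLat {γ : Matrix.SpecialLinearGroup (Fin 2) ℤ} {l : ℝˣ}
    (hl : dg l l⁻¹ * blk h = blk h * blk (γ.map (Int.castRingHom ℝ))) (v : Fin 2 → ℝ) :
    dg l l⁻¹ • affLat h v = affLat h (torusAuto γ v) := by
  have e : torusAuto γ v = fun i => (∑ j, (γ.1 i j : ℝ) * v j) +
      ((-⌊∑ j, (γ.1 i j : ℝ) * v j⌋ : ℤ) : ℝ) := by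
    ext i
    rw [torusAuto, Int.fract, Int.cast_neg, sub_eq_add_neg]
  rw [e, affLat_add_intCast]
  change ((dg l l⁻¹ * (blk h * upper _ _) : SL3R) : LatticeSpace) = _
  rw [← mul_assoc, hl, mul_assoc, blk_mul_upper, ← mul_assoc, mk_mul_intCast (blk_mem_SL3Z γ), affLat]
  simp [Fin.sum_univ_two]

lemma exists_diagonalization {γ : Matrix.SpecialLinearGroup (Fin 2) ℤ}
    (hγ : 2 < |Matrix.trace γ.1|) : ∃ l : ℝˣ, 1 < |(l : ℝ)| ∧
      ∃ h, dg l l⁻¹ * blk h = blk h * blk (γ.map (Int.castRingHom ℝ)) := by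
  obtain ⟨p, hp⟩ : ∃ p : ℝ, p = γ.1 0 0 := ⟨_, rfl⟩
  obtain ⟨q, hq⟩ : ∃ q : ℝ, q = γ.1 0 1 := ⟨_, rfl⟩
  obtain ⟨r, hr⟩ : ∃ r : ℝ, r = γ.1 1 0 := ⟨_, rfl⟩
  obtain ⟨s, hs⟩ : ∃ s : ℝ, s = γ.1 1 1 := ⟨_, rfl⟩
  have hdet : p * s - q * r = 1 := by
    have := γ.2
    rw [Matrix.det_fin_two] at this
    rw [hp, hq, hr, hs]; exact_mod_cast this
  have htr : 2 < |p + s| := by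
    rw [Matrix.trace_fin_two] at hγ
    rw [hp, hs]; exact_mod_cast hγ
  have htr2 : 4 < (p + s) ^ 2 := by
    rw [← sq_abs]; nlinarith
  have hr0 : r ≠ 0 := by
    rintro rfl
    have h1 : γ.1 0 0 * γ.1 1 1 = 1 := by
      have : p * s = 1 := by linarith
      rw [hp, hs] at this; exact_mod_cast this
    rcases Int.eq_one_or_neg_one_of_mul_eq_one' h1 with ⟨h2, h3⟩ | ⟨h2, h3⟩ <;>
      rw [hp, hs, h2, h3] at htr2 <;> norm_num at htr2
  obtain ⟨x, hx, hx1⟩ : ∃ x : ℝ, x ^ 2 - (p + s) * x + 1 = 0 ∧ 1 < |x| := by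
    have hsq := Real.sq_sqrt (show 0 ≤ (p + s) ^ 2 - 4 by linarith)
    have hnn := Real.sqrt_nonneg ((p + s) ^ 2 - 4)
    set w := √((p + s) ^ 2 - 4)
    rcases lt_abs.1 htr with h1 | h1
    · refine ⟨((p + s) + w) / 2, by linear_combination hsq / 4, lt_abs.2 (Or.inl ?_)⟩
      linarith
    · refine ⟨((p + s) - w) / 2, by linear_combination hsq / 4, lt_abs.2 (Or.inr ?_)⟩
      linarith
  have hx0 : x ≠ 0 := by rintro rfl; simp at hx1; linarith
  have hinv : x⁻¹ = p + s - x := by field_simp; linear_combination hx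
  have hdne : x⁻¹ - x ≠ 0 := by
    intro h0
    have : x ^ 2 = 1 := by field_simp at h0; linarith
    rw [← sq_abs] at this; nlinarith
  have hD : r * (x⁻¹ - x) ≠ 0 := mul_ne_zero hr0 hdne
  obtain ⟨c, hc⟩ : ∃ c, c * (r * (x⁻¹ - x)) = 1 := ⟨_, inv_mul_cancel₀ hD⟩
  refine ⟨Units.mk0 x hx0, hx1, ⟨!![r, x - p; c * r, c * (x⁻¹ - p)], ?_⟩, ?_⟩
  · rw [Matrix.det_fin_two_of]; linear_combination hc
  · refine ext_entries fun i j => ?_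
    rw [coe_mul', coe_mul']
    fin_cases i <;> fin_cases j <;>
      simp [blk, dg, Matrix.mul_apply, Fin.sum_univ_three, ← hp, ← hq, ← hr, ← hs]
    · ring
    · linear_combination hx + hdet
    · ring
    · rw [hinv]; linear_combination c * hx + c * hdet

lemma continuous_blk_mul_upper :
    Continuous fun v : Fin 2 → ℝ => blk h * upper (v 0) (v 1) :=
  continuous_const.mul (continuous_upper (continuous_apply 0) (continuous_apply 1))

lemma continuous_affLat : Continuous (affLat h) :=
  QuotientGroup.continuous_mk.comp continuous_blk_mul_upper

lemma exists_entry_bound {F : (Fin 2 → ℝ) → SL3R} (hF : Continuous F) :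
    ∃ M > 0, ∀ v ∈ Set.Icc (0 : Fin 2 → ℝ) 1, ∀ i j, |(F v).1 i j| ≤ M := by
  have hc : Continuous fun v => (fun i j => (F v).1 i j : Fin 3 → Fin 3 → ℝ) :=
    continuous_pi fun i => continuous_pi fun j => (continuous_entry i j).comp hF
  obtain ⟨M, hM⟩ := (isCompact_Icc (a := (0 : Fin 2 → ℝ)) (b := 1)).exists_bound_of_continuousOn
    hc.continuousOn
  refine ⟨max M 1, by positivity, fun v hv i j => le_max_of_le_left ?_⟩
  exact (norm_le_pi_norm (f := fun j => (F v).1 i j) j).trans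
    ((norm_le_pi_norm (f := fun i j => (F v).1 i j) i).trans (hM v hv))

lemma exists_int_of_smul_affLat_eq {σ : SL3R} {v v' : Fin 2 → ℝ}
    (hσ : σ • affLat h v = affLat h v') : ∃ ρ : Matrix.SpecialLinearGroup (Fin 3) ℤ,
      σ * (blk h * upper (v 0) (v 1)) =
        blk h * upper (v' 0) (v' 1) * ρ.map (Int.castRingHom ℝ) := by
  obtain ⟨ρ, hρ⟩ := QuotientGroup.eq.1 (show ((blk h * upper (v' 0) (v' 1) : SL3R) : LatticeSpace) =
    ((σ * (blk h * upper (v 0) (v 1)) : SL3R) : LatticeSpace) from hσ.symm)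
  exact ⟨ρ, by rw [hρ, mul_inv_cancel_left]⟩

lemma abs_sum_sum_le {f : Fin 3 → Fin 3 → ℝ} {e : ℝ} (hf : ∀ i j, |f i j| ≤ e) :
    |∑ i, ∑ j, f i j| ≤ 9 * e := by
  calc |∑ i, ∑ j, f i j| ≤ ∑ i, ∑ j, |f i j| :=
        (Finset.abs_sum_le_sum_abs _ _).trans
          (Finset.sum_le_sum fun i _ => Finset.abs_sum_le_sum_abs _ _)
    _ ≤ ∑ i : Fin 3, ∑ j : Fin 3, e :=
        Finset.sum_le_sum fun i _ => Finset.sum_le_sum fun j _ => hf i j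
    _ = 9 * e := by simp; ring

lemma upper_conj_sub_entry_le {σ g g' : SL3R} {M ε : ℝ} (hM : 0 ≤ M) (hσ : NearOne ε σ)
    (hg : ∀ i j, |g.1 i j| ≤ M) (hg' : ∀ i j, |g'.1 i j| ≤ M) (i j : Fin 3) :
    |(g' * σ * g).1 i j - (g' * g).1 i j| ≤ 9 * (M * ε * M) := by
  have e : (g' * σ * g).1 i j - (g' * g).1 i j =
      ∑ k, ∑ l, g'.1 i l * (σ.1 l k - (1 : Matrix (Fin 3) (Fin 3) ℝ) l k) * g.1 k j := by
    have h1 : (g' * σ * g).1 - (g' * g).1 = g'.1 * (σ.1 - 1) * g.1 := by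
      rw [coe_mul', coe_mul', coe_mul', mul_sub, sub_mul, mul_one]
    rw [← Matrix.sub_apply, h1, Matrix.mul_apply]
    simp_rw [Matrix.mul_apply, Finset.sum_mul, Matrix.sub_apply]
  rw [e]
  have hε : 0 ≤ ε := (abs_nonneg _).trans (hσ 0 0).le
  refine abs_sum_sum_le fun k l => ?_
  rw [abs_mul, abs_mul]
  gcongr
  exacts [hg' i l, (hσ l k).le, hg k j]

lemma exists_nearOne_eq_upper : ∃ ε > 0, ∀ v ∈ Set.Icc (0 : Fin 2 → ℝ) 1,
    ∀ v' ∈ Set.Icc (0 : Fin 2 → ℝ) 1, ∀ σ, NearOne ε σ → σ • affLat h v = affLat h v' →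
      ∃ n : Fin 2 → ℤ, σ = blk h * upper (v' 0 + n 0 - v 0) (v' 1 + n 1 - v 1) * (blk h)⁻¹ := by
  obtain ⟨M₁, hM₁, hb₁⟩ := exists_entry_bound (continuous_blk_mul_upper (h := h))
  obtain ⟨M₂, hM₂, hb₂⟩ := exists_entry_bound (continuous_blk_mul_upper (h := h)).inv
  simp only [Pi.inv_apply] at hb₂
  set M := max M₁ M₂
  have hM : 0 < M := lt_max_of_lt_left hM₁
  refine ⟨(10 * (M * M))⁻¹, by positivity, fun v hv v' hv' σ hσ heq => ?_⟩
  obtain ⟨ρ, hρ⟩ := exists_int_of_smul_affLat_eq heq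
  have key := upper_conj_sub_entry_le hM.le hσ (fun i j => (hb₁ v hv i j).trans (le_max_left _ _))
    (fun i j => (hb₂ v' hv' i j).trans (le_max_right _ _))
  have e1 : (blk h * upper (v' 0) (v' 1))⁻¹ * σ * (blk h * upper (v 0) (v 1)) =
      ρ.map (Int.castRingHom ℝ) := by rw [mul_assoc, hρ, inv_mul_cancel_left]
  have e2 : (blk h * upper (v' 0) (v' 1))⁻¹ * (blk h * upper (v 0) (v 1)) =
      upper (v 0 - v' 0) (v 1 - v' 1) := by
    rw [mul_inv_rev, mul_assoc, inv_mul_cancel_left, inv_mul_eq_iff_eq_mul, ← upper_add]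
    congr 1 <;> ring
  have e3 : 9 * (M * (10 * (M * M))⁻¹ * M) = 9 / 10 := by field_simp
  rw [e1, e2, e3] at key
  have hint : ∀ i j (d : ℤ), (upper (v 0 - v' 0) (v 1 - v' 1)).1 i j = d → ρ.1 i j = d := by
    intro i j d hd
    have h1 : |(ρ.1 i j : ℝ) - d| < 1 := by
      have := key i j
      rw [hd] at this
      exact this.trans_lt (by norm_num)
    rw [← sub_eq_zero]
    exact Int.abs_lt_one_iff.1 (by exact_mod_cast h1)
  have hρu : ρ.map (Int.castRingHom ℝ) = upper (ρ.1 0 2) (ρ.1 1 2) := by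
    have h00 := hint 0 0 1 (by simp [upper])
    have h01 := hint 0 1 0 (by simp [upper])
    have h10 := hint 1 0 0 (by simp [upper])
    have h11 := hint 1 1 1 (by simp [upper])
    have h20 := hint 2 0 0 (by simp [upper])
    have h21 := hint 2 1 0 (by simp [upper])
    have h22 := hint 2 2 1 (by simp [upper])
    refine ext_entries fun i j => (map_intCast_entry ρ i j).trans ?_
    fin_cases i <;> fin_cases j <;> simp [upper, h00, h01, h10, h11, h20, h21, h22]
  refine ⟨![ρ.1 0 2, ρ.1 1 2], ?_⟩
  rw [eq_mul_inv_iff_mul_eq, ← mul_left_inj (upper (v 0) (v 1)), mul_assoc, hρ, hρu, mul_assoc,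
    ← upper_add, mul_assoc, ← upper_add]
  simp

lemma isClosed_image_affLat : IsClosed (affLat h '' Set.Icc 0 1) :=
  (isCompact_Icc.image continuous_affLat).isClosed

lemma exists_nearOne_exists_eq_upper : ∃ ε > 0, ∀ x ∈ affLat h '' Set.Icc 0 1,
    ∀ σ, NearOne ε σ → σ • x ∈ affLat h '' Set.Icc 0 1 → ∃ a b, σ = upper a b := by
  obtain ⟨ε, hε, H⟩ := exists_nearOne_eq_upper (h := h)
  refine ⟨ε, hε, ?_⟩
  rintro _ ⟨v, hv, rfl⟩ σ hσ ⟨v', hv', heq⟩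
  obtain ⟨n, rfl⟩ := H v hv v' hv' σ hσ heq.symm
  exact ⟨_, _, by rw [blk_mul_upper, mul_inv_cancel_right]⟩

lemma nearOne_upper {ε s t : ℝ} (hs : |s| < ε) (ht : |t| < ε) : NearOne ε (upper s t) := by
  have hε : 0 < ε := (abs_nonneg s).trans_lt hs
  intro i j
  fin_cases i <;> fin_cases j <;> simp [upper, hε, hs, ht]

lemma upper_eq_iff {s t s' t' : ℝ} : upper s t = upper s' t' ↔ s = s' ∧ t = t' := by
  refine ⟨fun h => ⟨?_, ?_⟩, by rintro ⟨rfl, rfl⟩; rfl⟩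
  · simpa [upper] using congrArg (fun g : SL3R => g.1 0 2) h
  · simpa [upper] using congrArg (fun g : SL3R => g.1 1 2) h

lemma exists_abs_entry_le : ∃ B > 0, ∀ i j, |h.1 i j| ≤ B := by
  refine ⟨1 + ∑ i, ∑ j, |h.1 i j|, by positivity, fun i j => ?_⟩
  have h1 := (Finset.single_le_sum (f := fun j => |h.1 i j|) (fun _ _ => abs_nonneg _)
    (Finset.mem_univ j)).trans (Finset.single_le_sum (f := fun i => ∑ j, |h.1 i j|)
    (fun _ _ => Finset.sum_nonneg fun _ _ => abs_nonneg _) (Finset.mem_univ i))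
  linarith

lemma exists_int_of_mem_orbitBox : ∃ C > 0, ∃ r₁ > 0, ∀ r ≤ r₁, ∀ y,
    ∀ v ∈ Set.Icc (0 : Fin 2 → ℝ) 1, ∀ v' ∈ Set.Icc (0 : Fin 2 → ℝ) 1,
      affLat h v ∈ orbitBox (fun s => upper s 0) (fun t => upper 0 t) r y →
      affLat h v' ∈ orbitBox (fun s => upper s 0) (fun t => upper 0 t) r y →
      ∃ n : Fin 2 → ℤ, (∀ i, n i ∈ Finset.Icc (-1) 1) ∧ ∀ i, |v' i + n i - v i| ≤ C * r := by
  obtain ⟨ε, hε, H⟩ := exists_nearOne_eq_upper (h := h)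
  obtain ⟨B, hB0, hBle⟩ := exists_abs_entry_le (h := h)
  obtain ⟨C, hC⟩ : ∃ C, C = 4 * B + 1 := ⟨_, rfl⟩
  have hC0 : 0 < C := by linarith
  refine ⟨C, hC0, min (ε / 4) (1 / (2 * C)), by positivity, ?_⟩
  rintro r hr y v hv v' hv' ⟨s, t, hs, ht, hy⟩ ⟨s', t', hs', ht', hy'⟩
  have hr1 : r ≤ ε / 4 := hr.trans (min_le_left _ _)
  have hr2 : C * r ≤ 1 / 2 := by
    have := hr.trans (min_le_right _ _)
    rw [le_div_iff₀ (by positivity)] at this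
    linarith
  simp only [← upper_add, add_zero, zero_add] at hy hy'
  have hr0 : 0 ≤ r := (abs_nonneg _).trans hs
  have hσs : |s' - s| ≤ 2 * r := by rw [abs_le] at *; constructor <;> linarith
  have hσt : |t' - t| ≤ 2 * r := by rw [abs_le] at *; constructor <;> linarith
  obtain ⟨n, hn⟩ := H v hv v' hv' (upper (s' - s) (t' - t))
    (nearOne_upper (by linarith) (by linarith)) (by
      rw [hy, hy', ← mul_smul, ← upper_add, sub_add_cancel, sub_add_cancel])
  rw [eq_mul_inv_iff_mul_eq, blk_mul_upper, mul_left_inj, upper_eq_iff] at hn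
  obtain ⟨h1, h2⟩ := hn
  have hd := det_entries (h := h)
  have hlin : ∀ a b, |a| ≤ B → |b| ≤ B → |a * (s' - s) - b * (t' - t)| ≤ C * r := by
    intro a b ha hb
    calc _ ≤ |a| * |s' - s| + |b| * |t' - t| := by
          rw [← abs_mul, ← abs_mul]; exact abs_sub _ _
      _ ≤ B * (2 * r) + B * (2 * r) := by gcongr
      _ ≤ C * r := by rw [hC]; linarith
  have hle : ∀ i, |v' i + n i - v i| ≤ C * r := by
    rw [Fin.forall_fin_two]
    constructor
    · refine le_of_eq_of_le ?_ (hlin _ _ (hBle 1 1) (hBle 0 1))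
      congr 1
      rw [h1, h2]
      linear_combination (-(v' 0 + n 0 - v 0)) * hd
    · refine le_of_eq_of_le ?_ (hlin _ _ (hBle 1 0) (hBle 0 0))
      rw [← abs_neg]
      congr 1
      rw [h1, h2]
      linear_combination (v' 1 + n 1 - v 1) * hd
  refine ⟨n, fun i => ?_, hle⟩
  have h3 := abs_le.1 (hle i)
  have h4 : 0 ≤ v i := hv.1 i
  have h5 : v i ≤ 1 := hv.2 i
  have h6 : 0 ≤ v' i := hv'.1 i
  have h7 : v' i ≤ 1 := hv'.2 i
  rw [Finset.mem_Icc]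
  constructor
  · have : (-2 : ℝ) < n i := by linarith
    have : (-2 : ℤ) < n i := by exact_mod_cast this
    omega
  · have : (n i : ℝ) < 2 := by linarith
    have : n i < (2 : ℤ) := by exact_mod_cast this
    omega

end LatticeSpace

lemma isClosed_measure_ball_le {X : Type*} [PseudoMetricSpace X] [MeasurableSpace X]
    (μ : Measure X) (r : ℝ) (c : ℝ≥0∞) : IsClosed {x | μ (Metric.ball x r) ≤ c} := by
  refine isClosed_of_closure_subset fun x hx => ?_
  have hmono : Monotone fun n : ℕ => Metric.ball x (r - 1 / ((n : ℝ) + 1)) := fun m n hmn =>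
    Metric.ball_subset_ball (by
      have := one_div_le_one_div_of_le (by positivity : (0 : ℝ) < m + 1)
        (by gcongr : (m : ℝ) + 1 ≤ n + 1)
      linarith)
  have hU : ⋃ n : ℕ, Metric.ball x (r - 1 / ((n : ℝ) + 1)) = Metric.ball x r := by
    refine Set.Subset.antisymm (Set.iUnion_subset fun n => Metric.ball_subset_ball ?_) ?_
    · have : 0 < 1 / ((n : ℝ) + 1) := by positivity
      linarith
    · intro y hy
      obtain ⟨n, hn⟩ := exists_nat_one_div_lt (sub_pos.2 (Metric.mem_ball.1 hy))
      exact Set.mem_iUnion.2 ⟨n, Metric.mem_ball.2 (by linarith)⟩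
  have hlim := tendsto_measure_iUnion_atTop (μ := μ) hmono
  rw [hU] at hlim
  refine le_of_tendsto' hlim fun n => ?_
  obtain ⟨y, hy, hxy⟩ := Metric.mem_closure_iff.1 hx (1 / ((n : ℝ) + 1)) (by positivity)
  refine (measure_mono (Metric.ball_subset_ball' ?_)).trans hy
  linarith

lemma ExactDimensional.exists_isCompact {X : Type*} [MetricSpace X] [MeasurableSpace X]
    [BorelSpace X] {μ : Measure X} [IsProbabilityMeasure μ] [μ.InnerRegularCompactLTTop] {κ κ' : ℝ}
    (hdim : ExactDimensional μ κ) (hκ : κ' < κ) {E : Set X} (hE : MeasurableSet E)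
    (hE1 : μ E = 1) {η : ℝ} (hη : 0 ≤ η)
    (hη1 : η < 1) :
    ∃ D ⊆ E, IsCompact D ∧ η ≤ μ.real D ∧ ∃ r₁ > 0, ∀ x ∈ D, ∀ r > 0, r ≤ r₁ →
      μ.real (Metric.ball x r) ≤ r ^ κ' := by
  set F : ℕ → Set X := fun k => {x | ∀ r > 0, r ≤ 1 / ((k : ℝ) + 1) → μ.real (Metric.ball x r) ≤ r ^ κ'}
  have hF : ∀ k, MeasurableSet (F k) := fun k => by
    simp only [F, Set.ofPred_forall]
    refine (isClosed_iInter fun r => isClosed_iInter fun hr => isClosed_iInter fun _ => ?_).measurableSet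
    convert isClosed_measure_ball_le μ r (ENNReal.ofReal (r ^ κ')) using 3 with x
    rw [measureReal_def, ENNReal.le_ofReal_iff_toReal_le (measure_ne_top _ _) (by positivity)]
  have hmono : Monotone F := fun k k' hk x hx r hr hrk =>
    hx r hr (hrk.trans (one_div_le_one_div_of_le (by positivity) (by gcongr)))
  have hae : ∀ᵐ x ∂μ, x ∈ ⋃ k, F k := by
    filter_upwards [hdim] with x hx
    have h1 := (hx.eventually (lt_mem_nhds hκ)).and
      (Ioo_mem_nhdsGT (zero_lt_one : (0 : ℝ) < 1) : ∀ᶠ r in 𝓝[>] (0 : ℝ), r ∈ Set.Ioo (0 : ℝ) 1)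
    obtain ⟨e, he, hsub⟩ := (mem_nhdsGT_iff_exists_Ioo_subset).1 h1
    obtain ⟨k, hk⟩ := exists_nat_one_div_lt (Set.mem_Ioi.1 he)
    refine Set.mem_iUnion.2 ⟨k, fun r hr hrk => ?_⟩
    obtain ⟨h2, -, hr1⟩ := hsub ⟨hr, hrk.trans_lt hk⟩
    have hlog := Real.log_neg hr hr1
    rw [lt_div_iff_of_neg hlog] at h2
    rcases (measureReal_nonneg (μ := μ) (s := Metric.ball x r)).eq_or_lt with h0 | h0
    · rw [← h0]; positivity
    · rw [← Real.log_le_log_iff h0 (by positivity), Real.log_rpow hr]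
      exact h2.le
  have h1 : μ (⋃ k, F k) = 1 := by
    rw [← prob_compl_eq_zero_iff (MeasurableSet.iUnion hF)]
    exact hae
  have hlim : Tendsto (fun k => μ.real (F k)) atTop (𝓝 1) := by
    rw [← ENNReal.toReal_one, ← h1]
    exact (ENNReal.tendsto_toReal (measure_ne_top _ _)).comp (tendsto_measure_iUnion_atTop hmono)
  obtain ⟨k, hk⟩ := (hlim.eventually (lt_mem_nhds hη1)).exists
  have hFE : ENNReal.ofReal η < μ (F k ∩ E) := by
    rw [Set.inter_comm, Measure.measure_inter_eq_of_ae ((prob_compl_eq_zero_iff hE).2 hE1)]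
    exact (ENNReal.ofReal_lt_iff_lt_toReal hη (measure_ne_top _ _)).2 hk
  obtain ⟨D, hDF, hD, hlt⟩ := ((hF k).inter hE).exists_lt_isCompact_of_ne_top (measure_ne_top _ _) hFE
  refine ⟨D, hDF.trans Set.inter_subset_right, hD, ?_, 1 / ((k : ℝ) + 1), by positivity,
    fun x hx => (hDF hx).1⟩
  exact (ENNReal.ofReal_le_iff_le_toReal (measure_ne_top _ _)).1 hlt.le

namespace LatticeSpace

variable {h : Matrix.SpecialLinearGroup (Fin 2) ℝ} {μ : Measure (Fin 2 → ℝ)}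

lemma ae_map_affLat (hsupp : ∀ᵐ v ∂μ, v ∈ Set.univ.pi fun _ : Fin 2 => Set.Ico (0 : ℝ) 1) :
    ∀ᵐ x ∂μ.map (affLat h), x ∈ affLat h '' Set.Icc 0 1 := by
  refine (ae_map_iff continuous_affLat.aemeasurable isClosed_image_affLat.measurableSet).2 ?_
  filter_upwards [hsupp] with v hv
  exact ⟨v, ⟨fun i => (hv i trivial).1, fun i => (hv i trivial).2.le⟩, rfl⟩

lemma exists_finset_orbitBox {τ : ℝ} (hτ : 0 < τ) : ∃ P : Finset LatticeSpace,
    ∀ x ∈ affLat h '' Set.Icc 0 1, ∃ p ∈ P, ∃ s t, |s| ≤ τ ∧ |t| ≤ τ ∧ x = upper s t • p := by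
  classical
  obtain ⟨B, hB0, hB⟩ := exists_abs_entry_le (h := h)
  obtain ⟨η, hη⟩ : ∃ η, η = τ / (2 * B) := ⟨_, rfl⟩
  have hη0 : 0 < η := by rw [hη]; positivity
  obtain ⟨t, -, ht, hcov⟩ := (isCompact_Icc (a := (0 : Fin 2 → ℝ)) (b := 1)).finite_cover_balls hη0
  refine ⟨ht.toFinset.image (affLat h), ?_⟩
  rintro _ ⟨v, hv, rfl⟩
  obtain ⟨w, hw, hvw⟩ := Set.mem_iUnion₂.1 (hcov hv)
  have hd : ∀ i, |(v - w) i| ≤ η := fun i =>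
    (norm_le_pi_norm (v - w) i).trans (by rw [← dist_eq_norm]; exact (Metric.mem_ball.1 hvw).le)
  have hle : ∀ i, |h.1 i 0 * (v - w) 0 + h.1 i 1 * (v - w) 1| ≤ τ := fun i => by
    calc _ ≤ |h.1 i 0| * |(v - w) 0| + |h.1 i 1| * |(v - w) 1| := by
          rw [← abs_mul, ← abs_mul]; exact abs_add_le _ _
      _ ≤ B * η + B * η := by
          gcongr
          exacts [hB i 0, hd 0, hB i 1, hd 1]
      _ = τ := by rw [hη]; field_simp; ring
  refine ⟨affLat h w, Finset.mem_image_of_mem _ (ht.mem_toFinset.2 hw), _, _, hle 0, hle 1, ?_⟩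
  rw [upper_smul_affLat, add_sub_cancel]

lemma boxDim_map_affLat [IsProbabilityMeasure μ] {κ κ' : ℝ} (hκ' : 0 < κ') (hκ : κ' < κ)
    (hsupp : μ (Set.univ.pi fun _ => Set.Ico (0 : ℝ) 1) = 1) (hdim : ExactDimensional μ κ) :
    BoxDim (X := LatticeSpace) (fun s => upper s 0) (fun t => upper 0 t) (μ.map (affLat h)) κ' := by
  have hm : Measurable (affLat h) := continuous_affLat.measurable
  set E : Set (Fin 2 → ℝ) := Set.univ.pi fun _ => Set.Ico (0 : ℝ) 1 with hEdef
  have hE : MeasurableSet E := MeasurableSet.univ_pi fun _ => measurableSet_Ico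
  have hEI : E ⊆ Set.Icc 0 1 := fun v hv => ⟨fun i => (hv i trivial).1, fun i => (hv i trivial).2.le⟩
  obtain ⟨D, hDE, hD, hDμ, ρ, hρ, hball⟩ :=
    hdim.exists_isCompact hκ hE hsupp (η := 3 / 4) (by norm_num) (by norm_num)
  have hDX : MeasurableSet (affLat h '' D) := (hD.image continuous_affLat).measurableSet
  obtain ⟨C, hC, r₁, hr₁, H⟩ := exists_int_of_mem_orbitBox (h := h)
  have hinj : ∀ v ∈ E, affLat h v ∈ affLat h '' D → v ∈ D := by
    rintro v hv ⟨d, hd, hdv⟩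
    have hbox : ∀ y : LatticeSpace,
        y ∈ orbitBox (fun s => upper s 0) (fun t => upper 0 t) 0 y := fun y =>
      ⟨0, 0, by simp, by simp, by simp [upper_zero]⟩
    obtain ⟨n, -, hn⟩ := H 0 hr₁.le (affLat h v) v (hEI hv) d (hEI (hDE hd)) (hbox _)
      (by rw [hdv]; exact hbox _)
    convert hd using 1
    ext i
    have h1 : d i + n i - v i = 0 := by simpa using hn i
    have h2 : n i = 0 := by
      have h3 := hv i trivial
      have h4 := hDE hd i trivial
      rw [Set.mem_Ico] at h3 h4
      have h5 : |(n i : ℝ)| < 1 := by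
        rw [abs_lt]; constructor <;> linarith
      exact Int.abs_lt_one_iff.1 (by exact_mod_cast h5)
    rw [h2, Int.cast_zero] at h1
    linarith
  refine ⟨affLat h '' D, hDX, ?_, 9 * (3 * C) ^ κ', min r₁ (ρ / (3 * C)), by positivity,
    by positivity, fun r hr hrr y => ?_⟩
  · rw [map_measureReal_apply hm hDX]
    exact hDμ.trans (measureReal_mono (Set.subset_preimage_image _ _) (measure_ne_top _ _))
  rw [map_measureReal_apply hm (hDX.inter (measurableSet_orbitBox
    (continuous_upper continuous_id' continuous_const)
    (continuous_upper continuous_const continuous_id') _ _))]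
  set box := orbitBox (fun s => upper s 0) (fun t => upper 0 t) r y
  have hEc : μ.real Eᶜ = 0 := by
    rw [measureReal_def, (prob_compl_eq_zero_iff hE).2 hsupp, ENNReal.toReal_zero]
  set A : Set (Fin 2 → ℝ) := {v | v ∈ D ∧ affLat h v ∈ box}
  have hA : μ.real (affLat h ⁻¹' (affLat h '' D ∩ box)) ≤ μ.real A := by
    have hsub : affLat h ⁻¹' (affLat h '' D ∩ box) ⊆ A ∪ Eᶜ := fun v hv => by
      by_cases hvE : v ∈ E
      · exact Or.inl ⟨hinj v hvE hv.1, hv.2⟩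
      · exact Or.inr hvE
    have := (measureReal_mono hsub (measure_ne_top μ _)).trans (measureReal_union_le _ _)
    linarith
  refine hA.trans ?_
  have hpos : 0 ≤ 9 * (3 * C) ^ κ' * r ^ κ' := by positivity
  rcases A.eq_empty_or_nonempty with h0 | ⟨d, hd⟩
  · rw [h0, measureReal_empty]; exact hpos
  set I : Finset (Fin 2 → ℤ) := Fintype.piFinset fun _ => Finset.Icc (-1) 1
  have hcov : A ⊆ ⋃ n ∈ I, {v ∈ A | ∀ i, |v i + n i - d i| ≤ C * r} := fun v hv => by
    obtain ⟨n, hn, hn'⟩ := H r (hrr.trans (min_le_left _ _)) y d (hEI (hDE hd.1)) v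
      (hEI (hDE hv.1)) hd.2 hv.2
    exact Set.mem_iUnion₂.2 ⟨n, Fintype.mem_piFinset.2 hn, hv, hn'⟩
  have hI : (I.card : ℝ) = 9 := by
    simp [I, Fintype.card_piFinset]
  have hone : ∀ n : Fin 2 → ℤ, μ.real {v ∈ A | ∀ i, |v i + n i - d i| ≤ C * r} ≤ (3 * C * r) ^ κ' := by
    intro n
    rcases ({v ∈ A | ∀ i, |v i + n i - d i| ≤ C * r}).eq_empty_or_nonempty with h0 | ⟨w, hw, hwn⟩
    · rw [h0, measureReal_empty]; positivity
    refine (measureReal_mono (fun v hv => ?_) (measure_ne_top _ _)).trans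
      (hball w hw.1 (3 * C * r) (by positivity) ?_)
    · rw [Metric.mem_ball, dist_pi_lt_iff (by positivity)]
      intro i
      have h1 := abs_le.1 (hv.2 i)
      have h2 := abs_le.1 (hwn i)
      have h3 : 0 < C * r := by positivity
      rw [Real.dist_eq, abs_lt]
      constructor <;> linarith
    · have := hrr.trans (min_le_right _ _)
      rw [le_div_iff₀ (by positivity)] at this
      linarith
  calc μ.real A ≤ ∑ n ∈ I, μ.real {v ∈ A | ∀ i, |v i + n i - d i| ≤ C * r} :=
        (measureReal_mono hcov (measure_ne_top _ _)).trans (measureReal_biUnion_finset_le _ _)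
    _ ≤ ∑ n ∈ I, (3 * C * r) ^ κ' := Finset.sum_le_sum fun n _ => hone n
    _ = 9 * (3 * C) ^ κ' * r ^ κ' := by
        rw [Finset.sum_const, nsmul_eq_mul, hI, Real.mul_rpow (by positivity) hr.le, mul_assoc]

lemma orbitBox_swap (r : ℝ) (y : LatticeSpace) :
    orbitBox (fun t => upper 0 t) (fun s => upper s 0) r y =
      orbitBox (fun s => upper s 0) (fun t => upper 0 t) r y := by
  ext x
  simp only [orbitBox, ← upper_add, add_zero, zero_add, Set.mem_ofPred_eq]
  exact ⟨fun ⟨s, t, hs, ht, hx⟩ => ⟨t, s, ht, hs, hx⟩, fun ⟨s, t, hs, ht, hx⟩ => ⟨t, s, ht, hs, hx⟩⟩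

lemma boxCover_map_affLat (hsupp : ∀ᵐ v ∂μ, v ∈ Set.univ.pi fun _ : Fin 2 => Set.Ico (0 : ℝ) 1) :
    BoxCover (X := LatticeSpace) (fun s => upper s 0) (fun t => upper 0 t) (μ.map (affLat h)) := by
  intro τ hτ
  obtain ⟨P, hP⟩ := exists_finset_orbitBox (h := h) hτ
  refine ⟨P, ?_⟩
  filter_upwards [ae_map_affLat hsupp] with x hx
  obtain ⟨p, hp, s, t, hs, ht, rfl⟩ := hP x hx
  exact ⟨p, hp, s, t, hs, ht, by rw [← upper_add, add_zero, zero_add]⟩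

lemma blk_mul_upper_mulVec (s t : ℝ) (w : Fin 3 → ℝ) : (blk h * upper s t).1.mulVec w =
    ![h.1 0 0 * (w 0 + w 2 * s) + h.1 0 1 * (w 1 + w 2 * t),
      h.1 1 0 * (w 0 + w 2 * s) + h.1 1 1 * (w 1 + w 2 * t), w 2] := by
  rw [coe_mul', ← Matrix.mulVec_mulVec]
  ext i
  fin_cases i <;> simp [blk, upper, Matrix.mulVec, dotProduct, Fin.sum_univ_three] <;> ring

lemma abs_lt_of_abs_mul_lt {B c T x y : ℝ} (hB : ∀ i j, |h.1 i j| ≤ B)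
    (h₁ : |T * (h.1 0 0 * x + h.1 0 1 * y)| < c) (h₂ : |T * (h.1 1 0 * x + h.1 1 1 * y)| < c)
    (hB0 : 0 < B) : |T * x| < 2 * B * c ∧ |T * y| < 2 * B * c := by
  have hd := det_entries (h := h)
  have key : ∀ p q a b : ℝ, |p| ≤ B → |q| ≤ B → |a| < c → |b| < c → |p * a - q * b| < 2 * B * c := by
    intro p q a b hp hq ha hb
    calc |p * a - q * b| ≤ |p| * |a| + |q| * |b| := by
          rw [← abs_mul, ← abs_mul]; exact abs_sub _ _
      _ ≤ B * |a| + B * |b| := by gcongr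
      _ < B * c + B * c := by gcongr
      _ = 2 * B * c := by ring
  constructor
  · convert key (h.1 1 1) (h.1 0 1) _ _ (hB _ _) (hB _ _) h₁ h₂ using 2
    linear_combination (-T * x) * hd
  · convert key (h.1 0 0) (h.1 1 0) _ _ (hB _ _) (hB _ _) h₂ h₁ using 2
    linear_combination (-T * y) * hd

/-- The forward orbit of the lattice of a badly approximable vector is bounded. -/
lemma exists_forall_pow_smul_affLat_mem_thick {L : ℝˣ} (hL : 1 < (L : ℝ)) {v : Fin 2 → ℝ}
    (hv : ¬ IsWAVec 2 v) : ∃ c > 0, ∀ n : ℕ, dg L L ^ n • affLat h v ∈ thick c := by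
  rw [IsWAVec] at hv
  push Not at hv
  obtain ⟨ε, hε, hv⟩ := hv
  obtain ⟨B, hB, hhB⟩ := exists_abs_entry_le (h := h)
  refine ⟨min 1 (min (1 / (2 * B)) (ε / (2 * B))), by positivity, fun n => ?_⟩
  set c := min 1 (min (1 / (2 * B)) (ε / (2 * B)))
  have hc1 : c ≤ 1 := min_le_left _ _
  have hc2 : 2 * B * c ≤ 1 := by
    rw [← le_div_iff₀' (by positivity)]; exact (min_le_right _ _).trans (min_le_left _ _)
  have hc3 : 2 * B * c ≤ ε := by
    rw [← le_div_iff₀' (by positivity)]; exact (min_le_right _ _).trans (min_le_right _ _)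
  have hc : 0 < c := by positivity
  change ((dg L L ^ n * (blk h * upper (v 0) (v 1)) : SL3R) : LatticeSpace) ∈ thick c
  refine mk_mem_thick.2 fun m hm => not_lt.1 fun hlt => ?_
  rw [coe_mul', ← Matrix.mulVec_mulVec, dg_pow, dg_mulVec, blk_mul_upper_mulVec,
    pi_norm_lt_iff hc] at hlt
  have hT : 1 ≤ (L : ℝ) ^ n := one_le_pow₀ hL.le
  set T := (L : ℝ) ^ n with hTdef
  have e0 := hlt 0
  have e1 := hlt 1
  have e2 := hlt 2
  simp only [Matrix.cons_val, Units.val_pow_eq_pow_val, mul_inv, Units.val_mul,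
    Units.val_inv_eq_inv_val, ← hTdef, Real.norm_eq_abs] at e0 e1 e2
  obtain ⟨f0, f1⟩ := abs_lt_of_abs_mul_lt hhB e0 e1 hB
  rw [abs_mul, abs_of_pos (zero_lt_one.trans_le hT)] at f0 f1
  by_cases hk : m 2 = 0
  · have aux : ∀ j : ℤ, T * |(j : ℝ)| < 2 * B * c → j = 0 := fun j hj => by
      have h1 : |(j : ℝ)| < 1 :=
        (le_mul_of_one_le_left (abs_nonneg _) hT).trans_lt (hj.trans_le hc2)
      exact Int.abs_lt_one_iff.1 (by exact_mod_cast h1)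
    rw [hk] at f0 f1
    simp only [Int.cast_zero, zero_mul, add_zero] at f0 f1
    refine hm (funext fun i => ?_)
    have := aux _ f0
    have := aux _ f1
    fin_cases i <;> assumption
  · have hkpos : 0 < (m 2).natAbs := Int.natAbs_pos.2 hk
    obtain ⟨i, hi⟩ := hv (fun i => -((m 2).sign * m i.castSucc)) (m 2).natAbs hkpos
    refine absurd hi (not_le.2 ?_)
    have hkT : ((m 2).natAbs : ℝ) ≤ T ^ 2 := by
      rw [abs_mul, abs_of_pos (by positivity), ← Int.cast_abs, ← mul_inv,
        inv_mul_lt_iff₀ (by positivity)] at e2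
      have : T * T * c ≤ T * T := mul_le_of_le_one_right (by positivity) hc1
      rw [sq, Nat.cast_natAbs]
      exact e2.le.trans this
    have hroot : ((m 2).natAbs : ℝ) ^ ((1 : ℝ) / (2 : ℕ)) ≤ T := by
      rw [Nat.cast_ofNat, ← Real.sqrt_eq_rpow]
      exact Real.sqrt_le_iff.2 ⟨by positivity, hkT⟩
    have hkR : (0 : ℝ) < ((m 2).natAbs : ℝ) := Nat.cast_pos.2 hkpos
    have e4 : ((m 2).natAbs : ℝ) = ((m 2).sign : ℝ) * (m 2 : ℝ) := by
      rw [← Int.cast_natCast, ← Int.cast_mul, Int.sign_mul_self_eq_natAbs]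
    have hs : |((m 2).sign : ℝ)| = 1 := by
      rw [← Int.cast_abs, Int.abs_sign_of_ne_zero hk, Int.cast_one]
    have e5 : |((m 2).natAbs : ℝ) * v i - ((-((m 2).sign * m i.castSucc) : ℤ) : ℝ)| =
        |(m i.castSucc : ℝ) + (m 2 : ℝ) * v i| := by
      rw [e4]
      push_cast
      rw [show ((m 2).sign : ℝ) * (m 2 : ℝ) * v i - -(((m 2).sign : ℝ) * (m i.castSucc : ℝ)) =
        ((m 2).sign : ℝ) * ((m i.castSucc : ℝ) + (m 2 : ℝ) * v i) by ring, abs_mul, hs, one_mul]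
    rw [e5, lt_div_iff₀ (by positivity)]
    refine (mul_le_mul_of_nonneg_left hroot (abs_nonneg _)).trans_lt ?_
    rw [mul_comm]
    revert i
    rw [Fin.forall_fin_two]
    exact ⟨fun _ _ => f0.trans_le hc3, fun _ _ => f1.trans_le hc3⟩

end LatticeSpace

lemma IsWAVec.intMatrix_add {d : ℕ} {v : Fin d → ℝ} (hv : IsWAVec d v)
    (A : Matrix (Fin d) (Fin d) ℤ) (n : Fin d → ℤ) :
    IsWAVec d fun i => ∑ j, (A i j : ℝ) * v j + n i := by
  intro ε hε
  set C : ℝ := ∑ i, ∑ j, |(A i j : ℝ)| + 1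
  have hC : 0 < C := by positivity
  obtain ⟨m, k, hk, hm⟩ := hv (ε / C) (by positivity)
  have hkR : (0 : ℝ) < k := Nat.cast_pos.2 hk
  refine ⟨fun i => ∑ j, A i j * m j + k * n i, k, hk, fun i => ?_⟩
  have hρ : 0 < ε / C / (k : ℝ) ^ ((1 : ℝ) / d) := by positivity
  have hAi : ∑ j, |(A i j : ℝ)| < C :=
    (Finset.single_le_sum (f := fun i => ∑ j, |(A i j : ℝ)|)
      (fun _ _ => Finset.sum_nonneg fun _ _ => abs_nonneg _) (Finset.mem_univ i)).trans_lt
      (lt_add_one _)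
  calc |(k : ℝ) * (∑ j, (A i j : ℝ) * v j + n i) - ((∑ j, A i j * m j + k * n i : ℤ) : ℝ)|
      = |∑ j, (A i j : ℝ) * (k * v j - m j)| := by
        congr 1
        push_cast
        simp only [mul_sub, Finset.sum_sub_distrib, mul_add, Finset.mul_sum, mul_left_comm]
        ring
    _ ≤ ∑ j, |(A i j : ℝ)| * |k * v j - m j| := by
        simpa only [abs_mul] using Finset.abs_sum_le_sum_abs (fun j => (A i j : ℝ) * (k * v j - m j))
          Finset.univ
    _ ≤ ∑ j, |(A i j : ℝ)| * (ε / C / (k : ℝ) ^ ((1 : ℝ) / d)) := by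
        gcongr with j; exact (hm j).le
    _ < C * (ε / C / (k : ℝ) ^ ((1 : ℝ) / d)) := by
        rw [← Finset.sum_mul]; gcongr
    _ = ε / (k : ℝ) ^ ((1 : ℝ) / d) := by field_simp

lemma IsWAVec.add_intCast {d : ℕ} {v : Fin d → ℝ} (hv : IsWAVec d v) (p : Fin d → ℤ) :
    IsWAVec d fun i => v i + p i := by
  simpa [Matrix.one_apply] using hv.intMatrix_add 1 p

lemma IsWAVec.torusAuto {v : Fin 2 → ℝ} (hv : IsWAVec 2 v)
    (γ : Matrix.SpecialLinearGroup (Fin 2) ℤ) : IsWAVec 2 (torusAuto γ v) := by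
  convert hv.intMatrix_add γ.1 fun i => -⌊∑ j, (γ.1 i j : ℝ) * v j⌋ using 2 with i
  rw [_root_.torusAuto, Int.fract, Int.cast_neg, sub_eq_add_neg]

lemma measurableSet_setOf_isWAVec (d : ℕ) : MeasurableSet {v | IsWAVec d v} := by
  have : {v | IsWAVec d v} = ⋂ N : ℕ, ⋃ (m : Fin d → ℤ) (k : ℕ) (_ : 0 < k),
      {v | ∀ i, |(k : ℝ) * v i - (m i : ℝ)| < (1 / ((N : ℝ) + 1)) / (k : ℝ) ^ ((1 : ℝ) / d)} := by
    ext v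
    simp only [Set.mem_iInter, Set.mem_iUnion, Set.mem_ofPred_eq, exists_prop]
    refine ⟨fun hv N => hv _ (by positivity), fun H ε hε => ?_⟩
    obtain ⟨N, hN⟩ := exists_nat_one_div_lt hε
    obtain ⟨m, k, hk, h⟩ := H N
    exact ⟨m, k, hk, fun i => (h i).trans_le (by gcongr)⟩
  rw [this]
  refine MeasurableSet.iInter fun N => MeasurableSet.iUnion fun m => MeasurableSet.iUnion fun k =>
    MeasurableSet.iUnion fun _ => ?_
  rw [Set.ofPred_forall]
  exact MeasurableSet.iInter fun i => measurableSet_lt (by fun_prop) measurable_const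

namespace LatticeSpace

variable {h : Matrix.SpecialLinearGroup (Fin 2) ℝ} {μ : Measure (Fin 2 → ℝ)}

lemma measurableSet_setOf_exists_forall_pow_smul_mem_thick (a : SL3R) :
    MeasurableSet {x : LatticeSpace | ∃ c > 0, ∀ n : ℕ, a ^ n • x ∈ thick c} := by
  have : {x : LatticeSpace | ∃ c > 0, ∀ n : ℕ, a ^ n • x ∈ thick c} =
      ⋃ N : ℕ, {x : LatticeSpace | ∀ n : ℕ, a ^ n • x ∈ thick (1 / ((N : ℝ) + 1))} := by
    ext x
    simp only [Set.mem_iUnion, Set.mem_ofPred_eq]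
    refine ⟨fun ⟨c, hc, H⟩ => ?_, fun ⟨N, H⟩ => ⟨_, by positivity, H⟩⟩
    obtain ⟨N, hN⟩ := exists_nat_one_div_lt hc
    exact ⟨N, fun n => thick_anti hN.le (H n)⟩
  rw [this]
  exact MeasurableSet.iUnion fun N => (isClosed_forall_pow_smul_mem_thick a _).measurableSet

lemma ergodic_inv_smul {ν : Measure LatticeSpace} {g : SL3R} (hg : Ergodic (g • ·) ν) :
    Ergodic (g⁻¹ • ·) ν :=
  Ergodic.symm (e := (Homeomorph.smul g).toMeasurableEquiv) hg

lemma dg_inv_mul_upper (l : ℝˣ) (s t : ℝ) :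
    dg l l⁻¹ * upper s t = upper (l * s) ((l : ℝ)⁻¹ * t) * dg l l⁻¹ := by
  rw [dg_mul_upper]
  congr 2
  · push_cast; field_simp
  · push_cast; field_simp

lemma dg_inv_mul_upper' (l : ℝˣ) (s t : ℝ) :
    (dg l l⁻¹)⁻¹ * upper s t = upper ((l : ℝ)⁻¹ * s) (l * t) * (dg l l⁻¹)⁻¹ := by
  rw [dg_inv, dg_mul_upper]
  congr 2
  · push_cast; field_simp
  · push_cast; field_simp

lemma pairProp_of_ergodic {ν : Measure LatticeSpace} [IsProbabilityMeasure ν] {l : ℝˣ}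
    (hl : 1 < |(l : ℝ)|) (herg : Ergodic (dg l l⁻¹ • ·) ν) {κ : ℝ} (hκ : 0 < κ)
    (hdim : BoxDim (fun s => upper s 0) (fun t => upper 0 t) ν κ)
    (hcov : BoxCover (fun s => upper s 0) (fun t => upper 0 t) ν) :
    PairProp (X := LatticeSpace) (fun s => upper s 0) ν ∧
      PairProp (X := LatticeSpace) (fun t => upper 0 t) ν := by
  have hU : Continuous fun s => upper s 0 := continuous_upper continuous_id' continuous_const
  have hS : Continuous fun t => upper 0 t := continuous_upper continuous_const continuous_id'
  have hUadd : ∀ s t, upper (s + t) 0 = upper s 0 * upper t 0 := fun s t => by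
    simpa using upper_add s 0 t 0
  have hSadd : ∀ s t, upper 0 (s + t) = upper 0 s * upper 0 t := fun s t => by
    simpa using upper_add 0 s 0 t
  have hcomm : ∀ s t, upper s 0 * upper 0 t = upper 0 t * upper s 0 := fun s t => by
    rw [← upper_add, ← upper_add, add_comm s, add_comm t]
  refine ⟨pairProp_of_boxDim (S := fun t => upper 0 t) (h := dg l l⁻¹) (c := l) hU hS hUadd hSadd
    hcomm hl (fun s => ?_) (fun t => ?_) herg hκ hdim hcov,
    pairProp_of_boxDim (S := fun s => upper s 0) (h := (dg l l⁻¹)⁻¹) (c := l) hS hU hSadd hUadd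
      (fun s t => (hcomm t s).symm) hl (fun t => ?_) (fun s => ?_) (ergodic_inv_smul herg) hκ ?_ ?_⟩
  · simpa using dg_inv_mul_upper l s 0
  · simpa using dg_inv_mul_upper l 0 t
  · simpa using dg_inv_mul_upper' l 0 t
  · simpa using dg_inv_mul_upper' l s 0
  · simpa only [BoxDim, orbitBox_swap] using hdim
  · simpa only [BoxCover, orbitBox_swap] using hcov

end LatticeSpace

open LatticeSpace in
theorem ae_isWAVec {γ : Matrix.SpecialLinearGroup (Fin 2) ℤ}
    (hγ : 2 < |Matrix.trace (γ : Matrix (Fin 2) (Fin 2) ℤ)|)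
    {μ : Measure (Fin 2 → ℝ)} [IsProbabilityMeasure μ]
    (hsupp : μ (Set.univ.pi fun _ => Set.Ico (0 : ℝ) 1) = 1)
    (herg : Ergodic (torusAuto γ) μ) {κ : ℝ} (hκ : 0 < κ) (hdim : ExactDimensional μ κ) :
    ∀ᵐ v ∂μ, IsWAVec 2 v := by
  rcases herg.ae_empty_or_univ_of_ae_le_preimage (measurableSet_setOf_isWAVec 2).nullMeasurableSet
    (LE.le.eventuallyLE fun v hv => IsWAVec.torusAuto hv γ) with hWA | hWA
  swap
  · exact eventuallyEq_univ.1 hWA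
  exfalso
  have hsupp' : ∀ᵐ v ∂μ, v ∈ Set.univ.pi fun _ : Fin 2 => Set.Ico (0 : ℝ) 1 :=
    mem_ae_iff.2 ((prob_compl_eq_zero_iff (MeasurableSet.univ_pi fun _ => measurableSet_Ico)).2 hsupp)
  obtain ⟨l, hl, h, hlh⟩ := exists_diagonalization hγ
  have hcont : Continuous (affLat h) := continuous_affLat
  set ν := μ.map (affLat h)
  have hmp : MeasurePreserving (affLat h) μ ν := hcont.measurable.measurePreserving μ
  have : IsProbabilityMeasure ν := Measure.isProbabilityMeasure_map hcont.measurable.aemeasurable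
  have hergν : Ergodic (dg l l⁻¹ • ·) ν :=
    hmp.ergodic_of_ergodic_semiconj herg (measurable_const_smul _) fun v =>
      (dg_smul_affLat hlh v).symm
  have hbox := boxDim_map_affLat (h := h) (half_pos hκ) (half_lt_self hκ) hsupp hdim
  obtain ⟨h₁, h₂⟩ := pairProp_of_ergodic hl hergν (half_pos hκ) hbox
    (boxCover_map_affLat hsupp')
  obtain ⟨ε₀, hε₀, hinj⟩ := exists_nearOne_exists_eq_upper (h := h)
  obtain ⟨Λ₁, hΛ₁, hpair⟩ := exists_lower_pair (half_pos hκ) hε₀ hinj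
  have hl2 : 1 < (l : ℝ) ^ 2 := by rwa [one_lt_sq_iff_one_lt_abs]
  obtain ⟨W, hW⟩ := pow_unbounded_of_one_lt Λ₁ hl2
  have hL : Λ₁ ≤ ((l ^ (2 * W) : ℝˣ) : ℝ) := by
    rw [Units.val_pow_eq_pow_val, pow_mul]; exact hW.le
  set L : ℝˣ := l ^ (2 * W) with hLdef
  have hthick : ∀ᵐ x ∂ν, ∃ c > 0, ∀ n : ℕ, dg L L ^ n • x ∈ thick c := by
    rw [ae_map_iff hcont.measurable.aemeasurable
      (measurableSet_setOf_exists_forall_pow_smul_mem_thick _)]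
    filter_upwards [eventuallyEq_empty.1 hWA] with v hv
    exact exists_forall_pow_smul_affLat_mem_thick (hΛ₁.trans_le hL) hv
  obtain ⟨δ, hδ, hδpair⟩ := hpair L hL ν (ae_map_affLat hsupp') hbox hthick
  refine false_of_lower_pair (hΛ₁.trans_le hL) ?_ hthick h₁ h₂ hδ hδpair
  rw [show dg (L ^ 3) (L ^ 3)⁻¹ = dg l l⁻¹ ^ (2 * W * 3) by
    rw [dg_pow, hLdef, ← pow_mul, inv_pow]]
  exact measurePreserving_pow_smul hergν.toMeasurePreserving _

/-- if `γ ∈ SL₂(ℤ)` is hyperbolic (`|trace γ| > 2`) and `μ` is a probability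
measure on the `2`-torus (identified with `[0,1)²`) invariant and ergodic under the induced
automorphism and exact dimensional of dimension `κ > 0`, then for `μ`-almost every point,
every lift `v + p` (`p ∈ ℤ²`) is well approximable. -/
theorem stmt1 (γ : Matrix.SpecialLinearGroup (Fin 2) ℤ)
    (hγ : 2 < |Matrix.trace (γ : Matrix (Fin 2) (Fin 2) ℤ)|)
    (μ : Measure (Fin 2 → ℝ)) [IsProbabilityMeasure μ]
    (hsupp : μ (Set.univ.pi fun _ => Set.Ico (0 : ℝ) 1) = 1)
    (herg : Ergodic (torusAuto γ) μ)
    (κ : ℝ) (hκ : 0 < κ) (hdim : ExactDimensional μ κ) :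
    ∀ᵐ v ∂μ, ∀ p : Fin 2 → ℤ, IsWAVec 2 (fun i => v i + (p i : ℝ)) := by
  filter_upwards [ae_isWAVec hγ hsupp herg hκ hdim] with v hv p using hv.add_intCast p
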